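/- arXiv:1505.05241 — 2 statements merged into one kernel-verified Lean document; each statement's English description precedes it below -/
import Mathlib

section
/- Let n, ℓ ≥ 1 be integers and let a_0, a_1, …, a_{n+ℓ} ∈ ℤ^n be pairwise distinct exponent vectors. For any real coefficients c_{i,k}, the system of n Laurent polynomial functions Φ_i(x) = Σ_{k=0}^{n+ℓ} c_{i,k} x^{a_k} = 0 (i = 1, …, n) has fewer than ((e² + 3)/4)·2^{ℓ(ℓ−1)/2}·n^ℓ nondegenerate solutions in the positive orthant (0,∞)^n; in particular, the set of such solutions is finite. -/
section

open MvPolynomial Filter Topology Set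
open scoped NNReal

/-- The evaluation of a real polynomial is strictly differentiable. -/
theorem MvPolynomial.hasStrictFDerivAt_eval {σ : Type*} [Fintype σ] (p : MvPolynomial σ ℝ)
    (x : σ → ℝ) :
    HasStrictFDerivAt (fun y => eval y p)
      (∑ i, (eval x (pderiv i p)) • (ContinuousLinearMap.proj i : (σ → ℝ) →L[ℝ] ℝ)) x := by
  classical
  induction p using MvPolynomial.induction_on with
  | C r => simpa using hasStrictFDerivAt_const r x
  | add p q hp hq =>
    simp only [map_add, add_smul, Finset.sum_add_distrib]
    exact hp.fun_add hq
  | mul_X p j hp =>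
    have hj : HasStrictFDerivAt (fun y : σ → ℝ => y j)
        (ContinuousLinearMap.proj j : (σ → ℝ) →L[ℝ] ℝ) x :=
      (ContinuousLinearMap.proj j : (σ → ℝ) →L[ℝ] ℝ).hasStrictFDerivAt
    have := hp.fun_mul hj
    simp only [map_mul, eval_X]
    refine this.congr_fderiv ?_
    ext v
    have h1 : ∀ i, eval x ((Pi.single i 1 : σ → MvPolynomial σ ℝ) j) = if j = i then 1 else 0 := by
      intro i
      rw [Pi.single_apply]
      split_ifs <;> simp
    simp [h1, add_mul, Finset.sum_add_distrib, Finset.mul_sum, mul_assoc]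

theorem MvPolynomial.contDiff_eval {σ : Type*} [Fintype σ] (p : MvPolynomial σ ℝ) {n : WithTop ℕ∞} :
    ContDiff ℝ n (fun y : σ → ℝ => eval y p) := by
  induction p using MvPolynomial.induction_on with
  | C r => simpa using contDiff_const
  | add p q hp hq => simpa using hp.add hq
  | mul_X p j hp => simpa using hp.mul (contDiff_apply ℝ ℝ j)

/-- Lagrange polynomials for finitely many points. -/
theorem MvPolynomial.exists_lagrange {σ : Type*} [Fintype σ] (S : Finset (σ → ℝ)) (s : σ → ℝ) :
    ∃ g : MvPolynomial σ ℝ, eval s g = 1 ∧ ∀ t ∈ S, t ≠ s → eval t g = 0 := by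
  classical
  let w : (σ → ℝ) → MvPolynomial σ ℝ := fun t => ∑ a, (X a - C (t a)) ^ 2
  have hw : ∀ t u, eval u (w t) = ∑ a, (u a - t a) ^ 2 := by intro t u; simp [w]
  have hne : eval s (∏ t ∈ S.erase s, w t) ≠ 0 := by
    rw [map_prod, Finset.prod_ne_zero_iff]
    intro t ht h0
    rw [hw, Finset.sum_eq_zero_iff_of_nonneg (fun _ _ => sq_nonneg _)] at h0
    apply (Finset.mem_erase.1 ht).1
    ext a
    have := h0 a (Finset.mem_univ _)
    nlinarith [pow_eq_zero_iff (two_ne_zero) |>.1 this]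
  refine ⟨C (eval s (∏ t ∈ S.erase s, w t))⁻¹ * ∏ t ∈ S.erase s, w t, ?_, ?_⟩
  · rw [map_mul, eval_C, inv_mul_cancel₀ hne]
  · intro t ht hts
    have h0 : eval t (w t) = 0 := by rw [hw]; simp
    have h1 : eval t (∏ t ∈ S.erase s, w t) = 0 := by
      rw [map_prod]
      exact Finset.prod_eq_zero (Finset.mem_erase.2 ⟨hts, ht⟩) h0
    rw [map_mul, h1, mul_zero]

/-- A continuous local right inverse at a nondegenerate zero. -/
theorem exists_local_section {m : ℕ} {F : (Fin m → ℝ) → Fin m → ℝ}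
    {F' : (Fin m → ℝ) →L[ℝ] (Fin m → ℝ)} {s : Fin m → ℝ} (hF : HasStrictFDerivAt F F' s)
    (hinj : Function.Injective F') :
    ∃ σ : (Fin m → ℝ) → (Fin m → ℝ), Tendsto σ (𝓝 (F s)) (𝓝 s) ∧
      ∀ᶠ u in 𝓝 (F s), F (σ u) = u := by
  have hbij : Function.Bijective F'.toLinearMap :=
    ⟨hinj, LinearMap.injective_iff_surjective.1 hinj⟩
  let e : (Fin m → ℝ) ≃L[ℝ] (Fin m → ℝ) :=
    (LinearEquiv.ofBijective F'.toLinearMap hbij).toContinuousLinearEquiv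
  have he : (e : (Fin m → ℝ) →L[ℝ] (Fin m → ℝ)) = F' := by ext v; rfl
  have hF' : HasStrictFDerivAt F (e : (Fin m → ℝ) →L[ℝ] (Fin m → ℝ)) s := he ▸ hF
  exact ⟨hF'.localInverse F e s, by
    have := hF'.localInverse_continuousAt
    rwa [ContinuousAt, hF'.localInverse_apply_image] at this, hF'.eventually_right_inverse⟩

section Bezout

variable {m : ℕ}

/-- The Jacobian matrix of a square polynomial system. -/
noncomputable def polyJacobian (f : Fin m → MvPolynomial (Fin m) ℝ) (x : Fin m → ℝ) :
    Matrix (Fin m) (Fin m) ℝ :=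
  Matrix.of fun i a => eval x (pderiv a (f i))

theorem hasStrictFDerivAt_polySystem (f : Fin m → MvPolynomial (Fin m) ℝ) (x : Fin m → ℝ) :
    HasStrictFDerivAt (fun y i => eval y (f i))
      (LinearMap.toContinuousLinearMap (Matrix.toLin' (polyJacobian f x))) x := by
  rw [hasStrictFDerivAt_pi']
  intro i
  refine (MvPolynomial.hasStrictFDerivAt_eval (f i) x).congr_fderiv ?_
  ext v
  simp [polyJacobian, Matrix.mulVec, dotProduct]

theorem lagrange_comp_eq_zero (f : Fin m → MvPolynomial (Fin m) ℝ) (S : Finset (Fin m → ℝ))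
    (hS : ∀ s ∈ S, (∀ i, eval s (f i) = 0) ∧ (polyJacobian f s).det ≠ 0)
    (g : S → MvPolynomial (Fin m) ℝ)
    (hg : ∀ s t : S, eval (t : Fin m → ℝ) (g s) = if s = t then 1 else 0)
    (h : S → MvPolynomial (Fin m) ℝ) (h0 : ∑ s, g s * bind₁ f (h s) = 0) : h = 0 := by
  classical
  have key : ∀ s : S, ∃ σ : (Fin m → ℝ) → (Fin m → ℝ), Tendsto σ (𝓝 0) (𝓝 s) ∧
      ∀ᶠ u in 𝓝 0, (fun i => eval (σ u) (f i)) = u := by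
    intro s
    have h1 := hasStrictFDerivAt_polySystem f (s : Fin m → ℝ)
    have h2 : (fun i => eval (s : Fin m → ℝ) (f i)) = 0 := by
      ext i; exact (hS s s.2).1 i
    have := exists_local_section h1 (by
      intro v w hvw
      have hd := (hS s s.2).2
      have hu : IsUnit (polyJacobian f s) := by
        rw [Matrix.isUnit_iff_isUnit_det]; exact hd.isUnit
      exact Matrix.mulVec_injective_iff_isUnit.2 hu (by simpa using hvw))
    rwa [h2] at this
  choose σ hσ1 hσ2 using key
  let A : (Fin m → ℝ) → Matrix S S ℝ := fun u => Matrix.of fun t s => eval (σ t u) (g s)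
  have hA : Tendsto (fun u => (A u).det) (𝓝 0) (𝓝 1) := by
    have h1 : Tendsto A (𝓝 0) (𝓝 (1 : Matrix S S ℝ)) := by
      refine tendsto_pi_nhds.2 fun t => tendsto_pi_nhds.2 fun s => ?_
      have := ((MvPolynomial.continuous_eval (g s)).tendsto (t : Fin m → ℝ)).comp (hσ1 t)
      rw [hg] at this
      simpa [A, Matrix.one_apply, eq_comm, Function.comp_def] using this
    have h2 : Continuous (fun B : Matrix S S ℝ => B.det) := continuous_id.matrix_det
    have := (h2.tendsto 1).comp h1
    rwa [Matrix.det_one] at this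
  have hdet : ∀ᶠ u in 𝓝 (0 : Fin m → ℝ), (A u).det ≠ 0 :=
    hA.eventually_ne one_ne_zero
  have hz : ∀ᶠ u in 𝓝 (0 : Fin m → ℝ), ∀ s, eval u (h s) = 0 := by
    filter_upwards [hdet, eventually_all.2 hσ2] with u hu1 hu2
    have : (A u).mulVec (fun s => eval u (h s)) = 0 := by
      ext t
      have e := congrArg (eval (σ t u)) h0
      simp only [map_sum, map_mul, map_zero] at e
      have e2 : ∀ s, eval (σ t u) (bind₁ f (h s)) = eval u (h s) := by
        intro s
        conv_rhs => rw [← hu2 t]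
        exact eval₂Hom_bind₁ (RingHom.id ℝ) _ _ _
      simp only [e2] at e
      simpa [A, Matrix.mulVec, dotProduct] using e
    have := Matrix.eq_zero_of_mulVec_eq_zero hu1 this
    intro s; exact congrFun this s
  rw [Metric.eventually_nhds_iff_ball] at hz
  obtain ⟨ε, hε, hz⟩ := hz
  funext s
  refine MvPolynomial.funext_set (fun _ => Set.Ioo (-ε) ε) (fun _ => Set.Ioo_infinite (by linarith)) ?_
  intro u hu
  have : u ∈ Metric.ball (0 : Fin m → ℝ) ε := by
    rw [mem_ball_zero_iff, pi_norm_lt_iff hε]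
    intro i
    have := hu i (Set.mem_univ _)
    rw [Real.norm_eq_abs, abs_lt]; exact this
  simpa using hz u this s


theorem finrank_restrictSupport {s : Set (Fin m →₀ ℕ)} :
    Module.finrank ℝ (restrictSupport ℝ s) = Nat.card s :=
  Module.finrank_eq_nat_card_basis (basisRestrictSupport ℝ s)

/-- Exponents of weighted degree at most `E`. -/
def weightedExponents (d : Fin m → ℕ) (E : ℕ) : Set (Fin m →₀ ℕ) := {β | ∑ i, d i * β i ≤ E}

theorem weightedExponents_finite {d : Fin m → ℕ} (hd : ∀ i, 1 ≤ d i) (E : ℕ) :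
    (weightedExponents d E).Finite := by
  refine (Set.finite_Iic (Finsupp.equivFunOnFinite.symm fun _ : Fin m => E)).subset ?_
  intro β hβ i
  have h1 : d i * β i ≤ ∑ i, d i * β i :=
    Finset.single_le_sum (f := fun i => d i * β i) (fun _ _ => Nat.zero_le _) (Finset.mem_univ i)
  have h2 : ∑ i, d i * β i ≤ E := hβ
  have := Nat.le_mul_of_pos_left (β i) (hd i)
  simp only [Finsupp.equivFunOnFinite_symm_apply_apply]
  omega

theorem card_weightedExponents_one_le (E : ℕ) :
    Nat.card (weightedExponents (fun _ : Fin m => 1) E) ≤ (E + 1) ^ m := by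
  let φ : weightedExponents (fun _ : Fin m => 1) E → (Fin m → Fin (E + 1)) := fun α i =>
    ⟨α.1 i, by
      have h1 : 1 * α.1 i ≤ ∑ i, 1 * α.1 i :=
        Finset.single_le_sum (f := fun i => 1 * α.1 i) (fun _ _ => Nat.zero_le _)
          (Finset.mem_univ i)
      have h2 : ∑ i, 1 * α.1 i ≤ E := α.2
      omega⟩
  have hφ : Function.Injective φ := by
    intro α β h
    ext i
    exact congrArg Fin.val (congrFun h i)
  simpa using Nat.card_le_card_of_injective φ hφ

theorem card_weightedExponents_one_le_mul {d : Fin m → ℕ} (hd : ∀ i, 1 ≤ d i) (E : ℕ) :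
    Nat.card (weightedExponents (fun _ : Fin m => 1) E) ≤
      (∏ i, d i) * Nat.card (weightedExponents d E) := by
  have hfin := (weightedExponents_finite hd E).to_subtype
  let φ : weightedExponents (fun _ : Fin m => 1) E →
      (∀ i, Fin (d i)) × weightedExponents d E := fun α =>
    (fun i => ⟨α.1 i % d i, Nat.mod_lt _ (hd i)⟩,
      ⟨Finsupp.equivFunOnFinite.symm fun i => α.1 i / d i, by
        have h2 : ∑ i, 1 * α.1 i ≤ E := α.2
        refine le_trans (Finset.sum_le_sum fun i _ => ?_) h2
        simpa using Nat.mul_div_le _ _⟩)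
  have hφ : Function.Injective φ := by
    intro α β h
    ext i
    have h1 := congrArg Fin.val (congrFun (congrArg Prod.fst h) i)
    have h2 := DFunLike.congr_fun (congrArg Subtype.val (congrArg Prod.snd h)) i
    simp only [φ, Finsupp.equivFunOnFinite_symm_apply_apply] at h1 h2
    rw [← Nat.mod_add_div (α.1 i) (d i), h1, h2, Nat.mod_add_div]
  simpa [Nat.card_prod, Nat.card_pi] using Nat.card_le_card_of_injective φ hφ

theorem card_mul_card_weightedExponents_le (f : Fin m → MvPolynomial (Fin m) ℝ) (d : Fin m → ℕ)
    (hd : ∀ i, 1 ≤ d i) (hf : ∀ i, (f i).totalDegree ≤ d i) (S : Finset (Fin m → ℝ))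
    (hS : ∀ s ∈ S, (∀ i, eval s (f i) = 0) ∧ (polyJacobian f s).det ≠ 0) :
    ∃ c, ∀ E, S.card * Nat.card (weightedExponents d E) ≤
      Nat.card (weightedExponents (fun _ : Fin m => 1) (E + c)) := by
  classical
  choose g hg1 hg2 using fun s : S => MvPolynomial.exists_lagrange S (s : Fin m → ℝ)
  have hg : ∀ s t : S, eval (t : Fin m → ℝ) (g s) = if s = t then 1 else 0 := by
    intro s t
    split_ifs with h
    · rw [← h, hg1]
    · exact hg2 s t t.2 fun h' => h (Subtype.ext h'.symm)
  refine ⟨Finset.univ.sup fun s => (g s).totalDegree, fun E => ?_⟩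
  set c := Finset.univ.sup fun s => (g s).totalDegree
  have hW : ∀ p : MvPolynomial (Fin m) ℝ,
      p ∈ restrictSupport ℝ (weightedExponents (fun _ : Fin m => 1) (E + c)) ↔
        p.totalDegree ≤ E + c := by
    intro p
    rw [mem_restrictSupport_iff, totalDegree, Finset.sup_le_iff]
    refine forall₂_congr fun α _ => ?_
    simp [weightedExponents, Finsupp.sum_fintype]
  have hcomp : ∀ h ∈ restrictSupport ℝ (weightedExponents d E),
      (bind₁ f h).totalDegree ≤ E := by
    intro h hh
    rw [mem_restrictSupport_iff] at hh
    rw [h.as_sum, map_sum]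
    refine totalDegree_finsetSum_le fun β hβ => ?_
    rw [bind₁_monomial]
    refine (totalDegree_mul _ _).trans ?_
    rw [totalDegree_C, zero_add]
    refine (totalDegree_finsetProd _ _).trans (le_trans ?_ (hh hβ))
    refine (Finset.sum_le_univ_sum_of_nonneg fun _ => Nat.zero_le _).trans
      (Finset.sum_le_sum fun i _ => ?_)
    refine (totalDegree_pow _ _).trans ?_
    rw [mul_comm]
    exact Nat.mul_le_mul_right _ (hf i)
  let L : (S → restrictSupport ℝ (weightedExponents d E)) →ₗ[ℝ]
      restrictSupport ℝ (weightedExponents (fun _ : Fin m => 1) (E + c)) :=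
    LinearMap.codRestrict _
      (∑ s : S, (LinearMap.mulLeft ℝ (g s)) ∘ₗ (bind₁ f).toLinearMap ∘ₗ
        (Submodule.subtype _) ∘ₗ LinearMap.proj s) (by
        intro h
        rw [hW]
        simp only [LinearMap.sum_apply, LinearMap.comp_apply, LinearMap.mulLeft_apply]
        refine totalDegree_finsetSum_le fun s _ => (totalDegree_mul _ _).trans ?_
        rw [add_comm]
        exact add_le_add (hcomp _ (h s).2)
          (Finset.le_sup (f := fun s => (g s).totalDegree) (Finset.mem_univ s)))
  have hL : Function.Injective L := by
    rw [← LinearMap.ker_eq_bot, LinearMap.ker_eq_bot']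
    intro h hh
    have h1 := congrArg Subtype.val hh
    simp only [L, LinearMap.codRestrict_apply, LinearMap.sum_apply, LinearMap.comp_apply,
      LinearMap.mulLeft_apply] at h1
    have := lagrange_comp_eq_zero f S hS g hg (fun s => (h s : MvPolynomial (Fin m) ℝ)) h1
    ext1 s
    exact Subtype.ext (congrFun this s)
  have hfin1 := (weightedExponents_finite hd E).to_subtype
  have hfin2 := (weightedExponents_finite (d := fun _ : Fin m => 1) (fun _ => le_rfl)
    (E + c)).to_subtype
  have := Module.Finite.of_basis (basisRestrictSupport ℝ (weightedExponents d E))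
  have := Module.Finite.of_basis (basisRestrictSupport ℝ
    (weightedExponents (fun _ : Fin m => 1) (E + c)))
  have h2 := LinearMap.finrank_le_finrank_of_injective hL
  rw [Module.finrank_pi_fintype, finrank_restrictSupport] at h2
  simpa [finrank_restrictSupport] using h2

/-- **Bezout's inequality** for nondegenerate real zeros of a square polynomial system. -/
theorem card_nondegenerate_zeros_le_prod (f : Fin m → MvPolynomial (Fin m) ℝ) (d : Fin m → ℕ)
    (hd : ∀ i, 1 ≤ d i) (hf : ∀ i, (f i).totalDegree ≤ d i) (S : Finset (Fin m → ℝ))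
    (hS : ∀ s ∈ S, (∀ i, eval s (f i) = 0) ∧ (polyJacobian f s).det ≠ 0) :
    S.card ≤ ∏ i, d i := by
  by_contra! hlt
  obtain ⟨c, hc⟩ := card_mul_card_weightedExponents_le f d hd hf S hS
  set D := ∏ i, d i
  have hD : 0 < D := Finset.prod_pos fun i _ => hd i
  set a : ℕ → ℕ := fun E => Nat.card (weightedExponents (fun _ : Fin m => 1) E)
  have ha : ∀ E, S.card * a E ≤ D * a (E + c) := fun E =>
    calc S.card * a E ≤ S.card * (D * Nat.card (weightedExponents d E)) :=
          Nat.mul_le_mul_left _ (card_weightedExponents_one_le_mul hd E)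
      _ = D * (S.card * Nat.card (weightedExponents d E)) := by ring
      _ ≤ D * a (E + c) := Nat.mul_le_mul_left _ (hc E)
  have ha0 : 1 ≤ a 0 := by
    have hfin := (weightedExponents_finite (d := fun _ : Fin m => 1) (fun _ => le_rfl)
      0).to_subtype
    have : Nonempty (weightedExponents (fun _ : Fin m => 1) 0) := ⟨0, by simp [weightedExponents]⟩
    exact Nat.card_pos
  set r : ℝ := S.card / D
  have hD' : (0 : ℝ) < D := by exact_mod_cast hD
  have hr : 1 < r := by
    rw [one_lt_div hD']; exact_mod_cast hlt
  have hgrow : ∀ k : ℕ, r ^ k ≤ a (k * c) := by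
    intro k
    induction k with
    | zero => simpa using ha0
    | succ k ih =>
      have h1 : (S.card : ℝ) * a (k * c) ≤ D * a (k * c + c) := by exact_mod_cast ha (k * c)
      calc r ^ (k + 1) = r ^ k * r := pow_succ _ _
        _ ≤ a (k * c) * r := by gcongr
        _ ≤ a ((k + 1) * c) := by
          rw [add_mul, one_mul, ← mul_div_assoc, div_le_iff₀ hD']
          linarith
  have hbound : ∀ k : ℕ, 1 ≤ k → 1 ≤ ((c : ℝ) + 1) ^ m * ((k : ℝ) ^ m / r ^ k) := by
    intro k hk
    rw [← mul_div_assoc, one_le_div (by positivity), ← mul_pow]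
    refine (hgrow k).trans ?_
    have h1 : (a (k * c) : ℝ) ≤ ((k * c + 1 : ℕ) : ℝ) ^ m := by
      exact_mod_cast card_weightedExponents_one_le (m := m) (k * c)
    refine h1.trans ?_
    have h2 : (1 : ℝ) ≤ k := by exact_mod_cast hk
    gcongr
    push_cast
    nlinarith
  have hlim := (tendsto_pow_const_div_const_pow_of_one_lt m hr).const_mul (((c : ℝ) + 1) ^ m)
  rw [mul_zero] at hlim
  have := ge_of_tendsto hlim (eventually_atTop.2 ⟨1, hbound⟩)
  linarith

end Bezout

section Flow

variable {E : Type*} [NormedAddCommGroup E] [NormedSpace ℝ E]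

/-- `γ` is a globally defined integral curve of the autonomous vector field `X`. -/
def IsGlobalCurve (X : E → E) (γ : ℝ → E) : Prop := ∀ t, HasDerivAt γ (X (γ t)) t

theorem IsGlobalCurve.eq_of_eq {X : E → E} {K : ℝ≥0} (hX : LipschitzWith K X) {γ δ : ℝ → E}
    (hγ : IsGlobalCurve X γ) (hδ : IsGlobalCurve X δ) {t₀ : ℝ} (h : γ t₀ = δ t₀) : γ = δ :=
  ODE_solution_unique_univ (v := fun _ => X) (s := fun _ => univ) (K := K)
    (fun _ => hX.lipschitzOnWith) (fun t => ⟨hγ t, trivial⟩) (fun t => ⟨hδ t, trivial⟩) h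

theorem IsGlobalCurve.shift {X : E → E} {γ : ℝ → E} (hγ : IsGlobalCurve X γ) (a : ℝ) :
    IsGlobalCurve X fun t => γ (t + a) := fun t => by
  simpa using (hγ (t + a)).comp_add_const t a

theorem exists_isGlobalCurve [CompleteSpace E] {X : E → E} {K B : ℝ≥0} (hX : LipschitzWith K X)
    (hB : ∀ x, ‖X x‖ ≤ B) (x : E) : ∃ γ : ℝ → E, γ 0 = x ∧ IsGlobalCurve X γ := by
  have h1 : ∀ a : ℝ≥0, ∃ γ : ℝ → E, γ 0 = x ∧
      ∀ t ∈ Icc (-(a : ℝ)) a, HasDerivWithinAt γ (X (γ t)) (Icc (-(a : ℝ)) a) t := by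
    intro a
    have hpl : IsPicardLindelof (fun _ => X) (tmin := -(a : ℝ)) (tmax := a)
        ⟨0, by simp⟩ x (B * a) 0 B K :=
      IsPicardLindelof.of_time_independent (fun y _ => hB y) hX.lipschitzOnWith (by simp)
    exact hpl.exists_eq_forall_mem_Icc_hasDerivWithinAt₀
  choose γ hγ0 hγ using h1
  have h2 : ∀ a : ℝ≥0, ∀ t ∈ Ioo (-(a : ℝ)) a, HasDerivAt (γ a) (X (γ a t)) t := fun a t ht =>
    (hγ a t (Ioo_subset_Icc_self ht)).hasDerivAt (Icc_mem_nhds ht.1 ht.2)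
  have h3 : ∀ a b : ℝ≥0, a ≤ b → EqOn (γ a) (γ b) (Ioo (-(a : ℝ)) a) := by
    intro a b hab t ht
    have hab' : (a : ℝ) ≤ b := by exact_mod_cast hab
    refine ODE_solution_unique_of_mem_Ioo (v := fun _ => X) (s := fun _ => univ) (K := K)
      (t₀ := 0) (fun _ _ => hX.lipschitzOnWith) ⟨by linarith [ht.1, ht.2], by linarith [ht.1, ht.2]⟩
      (fun t ht => ⟨h2 a t ht, trivial⟩)
      (fun t ht => ⟨h2 b t ⟨by linarith [ht.1], by linarith [ht.2]⟩, trivial⟩) ?_ ht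
    rw [hγ0, hγ0]
  refine ⟨fun t => γ (‖t‖₊ + 1) t, hγ0 _, fun t => ?_⟩
  have hev : (fun u => γ (‖u‖₊ + 1) u) =ᶠ[𝓝 t] γ (‖t‖₊ + 2) := by
    have : ∀ᶠ u in 𝓝 t, ‖u‖ < ‖t‖ + 1 :=
      continuous_norm.continuousAt.eventually_lt continuousAt_const (by linarith)
    filter_upwards [this] with u hu
    refine h3 _ _ ?_ ?_
    · rw [← NNReal.coe_le_coe]; push_cast; linarith
    · rw [mem_Ioo, ← abs_lt]; push_cast; rw [← Real.norm_eq_abs]; linarith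
  have hmem : t ∈ Ioo (-((‖t‖₊ + 2 : ℝ≥0) : ℝ)) ((‖t‖₊ + 2 : ℝ≥0) : ℝ) := by
    rw [mem_Ioo, ← abs_lt]; push_cast; rw [← Real.norm_eq_abs]; linarith
  have := (h2 _ t hmem).congr_of_eventuallyEq hev
  rwa [← hev.eq_of_nhds] at this

/-- Along an integral curve, the vector field either vanishes identically or never. -/
theorem IsGlobalCurve.eq_const_of_zero {X : E → E} {K : ℝ≥0} (hX : LipschitzWith K X) {γ : ℝ → E}
    (hγ : IsGlobalCurve X γ) {t₀ : ℝ} (h : X (γ t₀) = 0) (t : ℝ) : γ t = γ t₀ := by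
  have : IsGlobalCurve X fun _ => γ t₀ := fun s => by
    simpa [h] using hasDerivAt_const s (γ t₀)
  exact congrFun (hγ.eq_of_eq hX this (t₀ := t₀) rfl) t

theorem IsGlobalCurve.neg {X : E → E} {γ : ℝ → E} (hγ : IsGlobalCurve X γ) :
    IsGlobalCurve (fun y => -X y) fun t => γ (-t) := fun t => by
  simpa [Function.comp_def] using (hγ (-t)).scomp t (hasDerivAt_neg t)

/-- Following the flow from the level set `g = 0` inside `J > t` until it reaches `J = t` or
`g = L`. -/
theorem exists_forward_ends [CompleteSpace E] {X : E → E} {K B : ℝ≥0} (hX : LipschitzWith K X)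
    (hB : ∀ x, ‖X x‖ ≤ B) {C : Set E}
    (hC : ∀ γ, IsGlobalCurve X γ → γ 0 ∈ C → ∀ s, γ s ∈ C)
    {g J χ : E → ℝ} {t L : ℝ} (ht : 0 < t) (hL : 0 < L)
    (hJ : ∀ γ, IsGlobalCurve X γ → γ 0 ∈ C → Continuous (J ∘ γ))
    (hg : ∀ γ, IsGlobalCurve X γ → γ 0 ∈ C → ∀ s,
      HasDerivAt (g ∘ γ) (χ (γ s) * J (γ s)) s)
    (hχ0 : ∀ y, 0 ≤ χ y) (hχ : ∀ y ∈ C, |g y| ≤ L → χ y = 1)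
    (S : Finset E) (hS : ∀ s ∈ S, s ∈ C ∧ g s = 0 ∧ t < J s) :
    ∃ e : E → E, InjOn e S ∧ ∀ s ∈ S, e s ∈ C ∧ 0 < g (e s) ∧
      ((J (e s) = t ∧ g (e s) ≤ L) ∨ (g (e s) = L ∧ t < J (e s))) := by
  choose γ hγ0 hγ using exists_isGlobalCurve hX hB
  have key : ∀ s ∈ S, ∃ τ : ℝ, 0 < τ ∧ (∀ u ∈ Ioc 0 τ, 0 < g (γ s u)) ∧
      ((J (γ s τ) = t ∧ g (γ s τ) ≤ L) ∨ (g (γ s τ) = L ∧ t < J (γ s τ))) := by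
    intro s hs
    obtain ⟨hsC, hgs, hJs⟩ := hS s hs
    have h0 : γ s 0 ∈ C := by rwa [hγ0]
    have hJc := hJ _ (hγ s) h0
    have hgd := hg _ (hγ s) h0
    have hgc : Continuous (g ∘ γ s) := continuous_iff_continuousAt.2 fun u => (hgd u).continuousAt
    have hCu := hC _ (hγ s) h0
    -- growth of `g` while staying in the region
    have grow : ∀ τ, 0 ≤ τ → (∀ u ∈ Ico 0 τ, t < J (γ s u) ∧ g (γ s u) < L) →
        ∀ u ∈ Icc 0 τ, t * u ≤ g (γ s u) := by
      intro τ hτ hreg u hu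
      have hmono : MonotoneOn (g ∘ γ s) (Icc 0 τ) := by
        refine monotoneOn_of_deriv_nonneg (convex_Icc _ _) hgc.continuousOn
          (fun v _ => (hgd v).differentiableAt.differentiableWithinAt) fun v hv => ?_
        rw [interior_Icc] at hv
        rw [(hgd v).deriv]
        exact mul_nonneg (hχ0 _) (ht.le.trans (hreg v ⟨hv.1.le, hv.2⟩).1.le)
      have hnn : ∀ v ∈ Icc 0 τ, 0 ≤ g (γ s v) := by
        intro v hv
        have := hmono (left_mem_Icc.2 hτ) hv hv.1
        simpa [hγ0, hgs] using this
      have := (convex_Icc 0 τ).mul_sub_le_image_sub_of_le_deriv (f := g ∘ γ s) (C := t)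
        hgc.continuousOn (fun v _ => (hgd v).differentiableAt.differentiableWithinAt) (fun v hv => by
          rw [interior_Icc] at hv
          have hr := hreg v ⟨hv.1.le, hv.2⟩
          have hn := hnn v ⟨hv.1.le, hv.2.le⟩
          rw [(hgd v).deriv, hχ _ (hCu v) (by rw [abs_of_nonneg hn]; exact hr.2.le), one_mul]
          exact hr.1.le) 0 (left_mem_Icc.2 hτ) u hu hu.1
      simpa [hγ0, hgs] using this
    let T : Set ℝ := {u | 0 ≤ u ∧ (J (γ s u) ≤ t ∨ L ≤ g (γ s u))}
    have hTc : IsClosed T :=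
      (isClosed_le continuous_const continuous_id).inter
        ((isClosed_le hJc continuous_const).union (isClosed_le continuous_const hgc))
    have hTne : T.Nonempty := by
      by_contra hT
      have hreg : ∀ u, 0 ≤ u → t < J (γ s u) ∧ g (γ s u) < L := by
        intro u hu
        by_contra hcon
        refine hT ⟨u, hu, ?_⟩
        by_contra hcon'
        push Not at hcon'
        exact hcon hcon'
      have h1 := grow (L / t) (by positivity) (fun u hu => hreg u hu.1) (L / t)
        ⟨by positivity, le_rfl⟩
      have h2 := (hreg (L / t) (by positivity)).2
      rw [mul_div_cancel₀ _ ht.ne'] at h1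
      linarith
    have hTb : BddBelow T := ⟨0, fun u hu => hu.1⟩
    have hmem : sInf T ∈ T := hTc.csInf_mem hTne hTb
    set τ := sInf T
    have hreg : ∀ u ∈ Ico 0 τ, t < J (γ s u) ∧ g (γ s u) < L := by
      intro u hu
      have : u ∉ T := notMem_of_lt_csInf hu.2 hTb
      by_contra hcon
      refine this ⟨hu.1, ?_⟩
      by_contra hcon'
      push Not at hcon'
      exact hcon hcon'
    have hτ : 0 < τ := by
      refine lt_of_le_of_ne hmem.1 fun h => ?_
      have := hmem.2
      rw [← h, hγ0, hgs] at this
      rcases this with h | h <;> linarith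
    have hclos : τ ∈ closure (Ico 0 τ) := by
      rw [closure_Ico hτ.ne]; exact right_mem_Icc.2 hτ.le
    have hJτ : t ≤ J (γ s τ) :=
      closure_minimal (fun u hu => (hreg u hu).1.le) (isClosed_le continuous_const hJc) hclos
    have hgτ : g (γ s τ) ≤ L :=
      closure_minimal (fun u hu => (hreg u hu).2.le) (isClosed_le hgc continuous_const) hclos
    refine ⟨τ, hτ, fun u hu => lt_of_lt_of_le (mul_pos ht hu.1)
      (grow τ hτ.le hreg u ⟨hu.1.le, hu.2⟩), ?_⟩
    rcases hJτ.eq_or_lt with h | h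
    · exact Or.inl ⟨h.symm, hgτ⟩
    · exact Or.inr ⟨le_antisymm hgτ (hmem.2.resolve_left (by linarith)), h⟩
  choose! τ hτ0 hτ1 hτ2 using key
  refine ⟨fun s => γ s (τ s), ?_, fun s hs => ⟨hC _ (hγ s) (by rw [hγ0]; exact (hS s hs).1) _,
    hτ1 s hs _ ⟨hτ0 s hs, le_rfl⟩, hτ2 s hs⟩⟩
  have main : ∀ s ∈ S, ∀ s' ∈ S, γ s (τ s) = γ s' (τ s') → τ s ≤ τ s' → s = s' := by
    intro s hs s' hs' h hle
    have h1 := ((hγ s).shift (τ s)).eq_of_eq hX ((hγ s').shift (τ s')) (t₀ := 0) (by simpa using h)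
    have h2 : s = γ s' (τ s' - τ s) := by
      have := congrFun h1 (-τ s)
      simpa [hγ0, add_comm, sub_eq_add_neg] using this
    rcases hle.eq_or_lt with h3 | h3
    · rw [h2, h3, sub_self, hγ0]
    · have := hτ1 s' hs' (τ s' - τ s) ⟨by linarith, by linarith [hτ0 s hs]⟩
      rw [← h2, (hS s hs).2.1] at this
      exact absurd this (lt_irrefl 0)
  intro s hs s' hs' h
  rcases le_total (τ s) (τ s') with hle | hle
  · exact main s hs s' hs' h hle
  · exact (main s' hs' s hs h.symm hle).symm

theorem exists_arc_ends [CompleteSpace E] {X : E → E} {K B : ℝ≥0} (hX : LipschitzWith K X)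
    (hB : ∀ x, ‖X x‖ ≤ B) {C : Set E}
    (hC : ∀ γ, IsGlobalCurve X γ → γ 0 ∈ C → ∀ s, γ s ∈ C)
    {g J χ : E → ℝ} {t L : ℝ} (ht : 0 < t) (hL : 0 < L)
    (hJ : ∀ γ, IsGlobalCurve X γ → γ 0 ∈ C → Continuous (J ∘ γ))
    (hg : ∀ γ, IsGlobalCurve X γ → γ 0 ∈ C → ∀ s,
      HasDerivAt (g ∘ γ) (χ (γ s) * J (γ s)) s)
    (hχ0 : ∀ y, 0 ≤ χ y) (hχ : ∀ y ∈ C, |g y| ≤ L → χ y = 1)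
    (S : Finset E) (hS : ∀ s ∈ S, s ∈ C ∧ g s = 0 ∧ t < J s) :
    ∃ T : Finset E, 2 * S.card ≤ T.card ∧ ∀ y ∈ T, y ∈ C ∧
      (J y = t ∨ (|g y| = L ∧ t < J y)) := by
  classical
  obtain ⟨e, he, he'⟩ := exists_forward_ends hX hB hC ht hL hJ hg hχ0 hχ S hS
  have hX' : LipschitzWith K fun y => -X y := hX.neg
  have hneg : ∀ γ, IsGlobalCurve (fun y => -X y) γ → IsGlobalCurve X fun u => γ (-u) := by
    intro γ hγ
    simpa using hγ.neg
  obtain ⟨f, hf, hf'⟩ := exists_forward_ends (X := fun y => -X y) (g := fun y => -g y) (χ := χ)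
    (C := C) (J := J) hX' (by simpa using hB)
    (fun γ hγ h0 s => by simpa using hC _ (hneg γ hγ) (by simpa using h0) (-s)) ht hL
    (fun γ hγ h0 => by
      have := (hJ _ (hneg γ hγ) (by simpa using h0)).comp continuous_neg
      simpa [Function.comp_def] using this)
    (fun γ hγ h0 s => by
      have h1 := hg _ (hneg γ hγ) (by simpa using h0) (-s)
      have := (h1.scomp s (hasDerivAt_neg s)).fun_neg
      simpa [Function.comp_def] using this) hχ0
    (fun y hy h => hχ y hy (by simpa using h)) S
    (fun s hs => by simpa using hS s hs)
  refine ⟨S.image e ∪ S.image f, ?_, ?_⟩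
  · rw [Finset.card_union_of_disjoint, Finset.card_image_of_injOn he, Finset.card_image_of_injOn hf,
      two_mul]
    rw [Finset.disjoint_left]
    intro y hy hy'
    obtain ⟨s, hs, rfl⟩ := Finset.mem_image.1 hy
    obtain ⟨s', hs', h⟩ := Finset.mem_image.1 hy'
    have h1 := (he' s hs).2.1
    have h2 := (hf' s' hs').2.1
    rw [h] at h2
    linarith
  · intro y hy
    rcases Finset.mem_union.1 hy with hy | hy
    · obtain ⟨s, hs, rfl⟩ := Finset.mem_image.1 hy
      obtain ⟨h1, h2, h3 | h3⟩ := he' s hs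
      · exact ⟨h1, Or.inl h3.1⟩
      · exact ⟨h1, Or.inr ⟨by rw [abs_of_pos h2, h3.1], h3.2⟩⟩
    · obtain ⟨s, hs, rfl⟩ := Finset.mem_image.1 hy
      obtain ⟨h1, h2, h3 | h3⟩ := hf' s hs
      · exact ⟨h1, Or.inl h3.1⟩
      · exact ⟨h1, Or.inr ⟨by rw [abs_of_neg (by linarith), h3.1], h3.2⟩⟩

end Flow

section PolynomialDegree

variable {σ : Type*}

theorem MvPolynomial.totalDegree_pderiv_le {p : MvPolynomial σ ℝ} {d : ℕ}
    (hp : p.totalDegree ≤ d) (a : σ) : (pderiv a p).totalDegree ≤ d - 1 := by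
  classical
  conv_lhs => rw [p.as_sum, map_sum]
  refine totalDegree_finsetSum_le fun m hm => ?_
  rw [pderiv_monomial]
  have h1 : m.degree ≤ d := (le_totalDegree hm).trans hp
  by_cases hma : m a = 0
  · simp [hma]
  · have h2 : m - Finsupp.single a 1 + Finsupp.single a 1 = m :=
      tsub_add_cancel_of_le (Finsupp.single_le_iff.2 (Nat.one_le_iff_ne_zero.2 hma))
    have h3 := congrArg Finsupp.degree h2
    rw [map_add, Finsupp.degree_single] at h3
    refine (totalDegree_monomial_le _ _).trans ?_
    change (m - Finsupp.single a 1).degree ≤ d - 1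
    omega

theorem MvPolynomial.totalDegree_euler_le [Fintype σ] {p : MvPolynomial σ ℝ} {d : ℕ}
    (hp : p.totalDegree ≤ d) :
    (C (d : ℝ) * p - ∑ a, X a * pderiv a p).totalDegree ≤ d - 1 := by
  classical
  have h : C (d : ℝ) * p - ∑ a, X a * pderiv a p =
      ∑ m ∈ p.support, monomial m (((d : ℝ) - m.degree) * coeff m p) := by
    conv_lhs => rw [p.as_sum]
    simp only [map_sum, Finset.mul_sum]
    rw [Finset.sum_comm, ← Finset.sum_sub_distrib]
    refine Finset.sum_congr rfl fun m _ => ?_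
    simp only [X_mul_pderiv_monomial]
    rw [← Finset.sum_smul, ← Finsupp.degree_eq_sum, C_mul_monomial, sub_mul, map_sub,
      ← map_nsmul, nsmul_eq_mul]
  rw [h]
  refine totalDegree_finsetSum_le fun m hm => ?_
  have h1 : m.degree ≤ d := (le_totalDegree hm).trans hp
  by_cases hd : m.degree = d
  · simp [hd]
  · refine (totalDegree_monomial_le _ _).trans ?_
    change m.degree ≤ d - 1
    omega

theorem MvPolynomial.totalDegree_det_le {n : Type*} [Fintype n] [DecidableEq n]
    (A : Matrix n n (MvPolynomial σ ℝ)) (e : n → ℕ) (h : ∀ i j, (A i j).totalDegree ≤ e i) :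
    A.det.totalDegree ≤ ∑ i, e i := by
  rw [← Matrix.det_transpose, Matrix.det_apply]
  refine totalDegree_finsetSum_le fun τ _ => (totalDegree_smul_le _ _).trans ?_
  refine (totalDegree_finsetProd _ _).trans (Finset.sum_le_sum fun i _ => h _ _)

end PolynomialDegree

/-- Critical values of a differentiable self-map form a null set. -/
theorem ae_regular_value {m : ℕ} {f : (Fin m → ℝ) → Fin m → ℝ}
    {f' : (Fin m → ℝ) → (Fin m → ℝ) →L[ℝ] (Fin m → ℝ)} {U : Set (Fin m → ℝ)}
    (hf : ∀ y ∈ U, HasFDerivAt f (f' y) y) :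
    ∀ᵐ θ, ∀ y ∈ U, f y = θ → ∀ v, f' y v = 0 → v = 0 := by
  have h := MeasureTheory.addHaar_image_eq_zero_of_det_fderivWithin_eq_zero MeasureTheory.volume
    (s := {y ∈ U | (f' y).det = 0}) (fun y hy => (hf y hy.1).hasFDerivWithinAt)
    (fun y hy => hy.2)
  rw [MeasureTheory.measure_eq_zero_iff_ae_notMem] at h
  filter_upwards [h] with θ hθ y hy hyθ v hv
  have hdet : (f' y).det ≠ 0 := fun h0 => hθ ⟨y, ⟨hy, h0⟩, hyθ⟩
  have : Function.Injective (f' y) := by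
    have := LinearMap.ker_eq_bot.1 (((f' y).toLinearMap).equivOfDetNeZero hdet).ker
    exact this
  exact this (by rw [hv, map_zero])

theorem HasStrictFDerivAt.eventually_le_norm_sub {E F : Type*} [NormedAddCommGroup E]
    [NormedSpace ℝ E] [FiniteDimensional ℝ E] [NormedAddCommGroup F] [NormedSpace ℝ F] {f : E → F}
    {f' : E →L[ℝ] F} {x : E} (hf : HasStrictFDerivAt f f' x) (hinj : ∀ v, f' v = 0 → v = 0) :
    ∃ c > 0, ∀ᶠ p in 𝓝 (x, x), ‖p.1 - p.2‖ ≤ c * ‖f p.1 - f p.2‖ := by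
  obtain ⟨K, hK, hanti⟩ := f'.toLinearMap.exists_antilipschitzWith
    (LinearMap.ker_eq_bot'.2 hinj)
  refine ⟨2 * K, by positivity, ?_⟩
  have hKpos : (0 : ℝ) < K := hK
  filter_upwards [hf.isLittleO.def (c := 1 / (2 * K)) (by positivity)] with p hp
  have h1 := hanti.le_mul_dist (p.1 - p.2) 0
  simp only [dist_zero_right, map_zero] at h1
  have h2 : ‖f' (p.1 - p.2)‖ ≤ ‖f p.1 - f p.2‖ + 1 / (2 * K) * ‖p.1 - p.2‖ := by
    have := norm_sub_le (f p.1 - f p.2) (f p.1 - f p.2 - f' (p.1 - p.2))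
    rw [sub_sub_cancel] at this
    linarith
  have h3 : (K : ℝ) * (1 / (2 * K) * ‖p.1 - p.2‖) = ‖p.1 - p.2‖ / 2 := by field_simp
  have h4 : ‖p.1 - p.2‖ ≤ K * ‖f' (p.1 - p.2)‖ := h1
  nlinarith [mul_le_mul_of_nonneg_left h2 hKpos.le]

/-- Persistence of finitely many solutions, each of which persists individually. -/
theorem eventually_exists_finset {E P : Type*} [TopologicalSpace E] [T2Space E] {l : Filter P}
    {R : P → E → Prop} (S : Finset E)
    (h : ∀ s ∈ S, ∀ O ∈ 𝓝 s, ∀ᶠ θ in l, ∃ y ∈ O, R θ y) :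
    ∀ᶠ θ in l, ∃ S' : Finset E, S'.card = S.card ∧ ∀ y ∈ S', R θ y := by
  classical
  obtain ⟨U, hU, hdisj⟩ := S.finite_toSet.t2_separation
  have h1 : ∀ᶠ θ in l, ∀ s ∈ S, ∃ y ∈ U s, R θ y :=
    (Filter.eventually_all_finset S).2 fun s hs => h s hs _ ((hU s).2.mem_nhds (hU s).1)
  filter_upwards [h1] with θ hθ
  choose! y hyU hyR using hθ
  refine ⟨S.image y, Finset.card_image_of_injOn ?_, ?_⟩
  · intro s hs s' hs' hss
    by_contra hne
    have := hdisj hs hs' hne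
    exact Set.disjoint_left.1 this (hyU s hs) (by rw [hss]; exact hyU s' hs')
  · intro z hz
    obtain ⟨s, hs, rfl⟩ := Finset.mem_image.1 hz
    exact hyR s hs

/-- Affine forms `α k + β k ⬝ y` on `ℝ^ℓ` together with the exponents of a Gale dual system. -/
structure GaleData (ℓ M : ℕ) where
  /-- constant terms of the affine forms -/
  α : Fin (M + 1) → ℝ
  /-- linear parts of the affine forms -/
  β : Fin (M + 1) → Fin ℓ → ℝ
  /-- exponents of the products of affine forms -/
  b : Fin ℓ → Fin (M + 1) → ℝ

namespace GaleData

variable {ℓ M : ℕ} (D : GaleData ℓ M)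

/-- The affine form with index `k`. -/
def form (k : Fin (M + 1)) (y : Fin ℓ → ℝ) : ℝ := D.α k + ∑ a, D.β k a * y a

/-- The affine form with index `k` as a polynomial. -/
noncomputable def formPoly (k : Fin (M + 1)) : MvPolynomial (Fin ℓ) ℝ :=
  C (D.α k) + ∑ a, C (D.β k a) * X a

/-- The open region where all affine forms are positive. -/
def region : Set (Fin ℓ → ℝ) := {y | ∀ k, 0 < D.form k y}

/-- The logarithm of the product of powers of the affine forms. -/
noncomputable def logForm (i : Fin ℓ) (y : Fin ℓ → ℝ) : ℝ := ∑ k, D.b i k * Real.log (D.form k y)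

/-- The system whose first `r` equations are logarithmic and whose other ones are polynomial. -/
noncomputable def sys (r : ℕ) (c : Fin ℓ → ℝ) (q : Fin ℓ → MvPolynomial (Fin ℓ) ℝ)
    (y : Fin ℓ → ℝ) (i : Fin ℓ) : ℝ :=
  if (i : ℕ) < r then D.logForm i y - c i else eval y (q i)

/-- The Jacobian matrix of `sys`. -/
noncomputable def jac (r : ℕ) (q : Fin ℓ → MvPolynomial (Fin ℓ) ℝ) (y : Fin ℓ → ℝ) :
    Matrix (Fin ℓ) (Fin ℓ) ℝ :=
  Matrix.of fun i a => if (i : ℕ) < r then ∑ k, D.b i k * (D.β k a / D.form k y)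
    else eval y (pderiv a (q i))

/-- The Jacobian determinant of `sys`, with denominators cleared. -/
noncomputable def scaledJac (r : ℕ) (q : Fin ℓ → MvPolynomial (Fin ℓ) ℝ) (y : Fin ℓ → ℝ) : ℝ :=
  (∏ k, D.form k y) * (D.jac r q y).det

theorem eval_formPoly (k : Fin (M + 1)) (y : Fin ℓ → ℝ) :
    eval y (D.formPoly k) = D.form k y := by
  simp [formPoly, form]

theorem pderiv_formPoly (k : Fin (M + 1)) (a : Fin ℓ) :
    pderiv a (D.formPoly k) = C (D.β k a) := by
  classical
  simp [formPoly, pderiv_X, Pi.single_apply]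

theorem totalDegree_formPoly_le (k : Fin (M + 1)) : (D.formPoly k).totalDegree ≤ 1 := by
  refine (totalDegree_add _ _).trans (max_le (by simp) (totalDegree_finsetSum_le fun a _ => ?_))
  refine (totalDegree_mul _ _).trans ?_
  simp

theorem contDiff_form (k : Fin (M + 1)) {n : WithTop ℕ∞} : ContDiff ℝ n (D.form k) := by
  have := (D.formPoly k).contDiff_eval (n := n)
  simpa only [eval_formPoly] using this

theorem continuous_form (k : Fin (M + 1)) : Continuous (D.form k) :=
  (D.contDiff_form k (n := 0)).continuous

theorem hasStrictFDerivAt_form (k : Fin (M + 1)) (y : Fin ℓ → ℝ) :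
    HasStrictFDerivAt (D.form k)
      (∑ a, D.β k a • (ContinuousLinearMap.proj a : (Fin ℓ → ℝ) →L[ℝ] ℝ)) y := by
  have := (D.formPoly k).hasStrictFDerivAt_eval y
  simpa only [eval_formPoly, pderiv_formPoly, eval_C] using this

theorem isOpen_region : IsOpen D.region := by
  simp only [region, ofPred_forall]
  exact isOpen_iInter_of_finite fun k => isOpen_lt continuous_const (D.continuous_form k)

theorem hasStrictFDerivAt_logForm (i : Fin ℓ) {y : Fin ℓ → ℝ} (hy : ∀ k, D.form k y ≠ 0) :
    HasStrictFDerivAt (D.logForm i)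
      (∑ a, (∑ k, D.b i k * (D.β k a / D.form k y)) •
        (ContinuousLinearMap.proj a : (Fin ℓ → ℝ) →L[ℝ] ℝ)) y := by
  have h : HasStrictFDerivAt (D.logForm i) (∑ k, D.b i k • ((D.form k y)⁻¹ •
      ∑ a, D.β k a • (ContinuousLinearMap.proj a : (Fin ℓ → ℝ) →L[ℝ] ℝ))) y :=
    HasStrictFDerivAt.fun_sum fun k _ =>
      (((D.hasStrictFDerivAt_form k y).log (hy k)).const_mul (D.b i k))
  refine h.congr_fderiv ?_
  ext v
  simp only [sum_apply, smul_apply, Finset.smul_sum,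
    ContinuousLinearMap.proj_apply, smul_eq_mul, Finset.sum_mul]
  rw [Finset.sum_comm]
  refine Finset.sum_congr rfl fun a _ => Finset.sum_congr rfl fun k _ => ?_
  ring

theorem hasStrictFDerivAt_sys (r : ℕ) (c : Fin ℓ → ℝ) (q : Fin ℓ → MvPolynomial (Fin ℓ) ℝ)
    {y : Fin ℓ → ℝ} (hy : ∀ k, D.form k y ≠ 0) :
    HasStrictFDerivAt (D.sys r c q)
      (LinearMap.toContinuousLinearMap (Matrix.toLin' (D.jac r q y))) y := by
  rw [hasStrictFDerivAt_pi']
  intro i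
  by_cases hi : (i : ℕ) < r
  · simp only [sys, hi, if_true]
    refine ((D.hasStrictFDerivAt_logForm i hy).sub_const _).congr_fderiv ?_
    ext v
    simp [jac, hi, Matrix.mulVec, dotProduct]
  · simp only [sys, hi, if_false]
    refine ((q i).hasStrictFDerivAt_eval y).congr_fderiv ?_
    ext v
    simp [jac, hi, Matrix.mulVec, dotProduct]

theorem contDiffOn_jac (r : ℕ) (q : Fin ℓ → MvPolynomial (Fin ℓ) ℝ) (i a : Fin ℓ)
    {n : WithTop ℕ∞} : ContDiffOn ℝ n (fun y => D.jac r q y i a) D.region := by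
  by_cases hi : (i : ℕ) < r
  · simp only [jac, Matrix.of_apply, hi, if_true]
    exact ContDiffOn.sum fun k _ => contDiffOn_const.mul
      (contDiffOn_const.div (D.contDiff_form k).contDiffOn fun y hy => (hy k).ne')
  · simp only [jac, Matrix.of_apply, hi, if_false]
    exact (MvPolynomial.contDiff_eval _).contDiffOn

end GaleData

theorem ContDiffOn.matrix_det {E ι : Type*} [NormedAddCommGroup E] [NormedSpace ℝ E] [Fintype ι]
    [DecidableEq ι] {A : E → Matrix ι ι ℝ} {s : Set E} {n : WithTop ℕ∞}
    (h : ∀ i j, ContDiffOn ℝ n (fun y => A y i j) s) : ContDiffOn ℝ n (fun y => (A y).det) s := by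
  simp only [Matrix.det_apply']
  exact ContDiffOn.sum fun τ _ => contDiffOn_const.mul (contDiffOn_prod fun i _ => h _ _)

namespace GaleData

variable {ℓ M : ℕ} (D : GaleData ℓ M)

theorem contDiffOn_scaledJac (r : ℕ) (q : Fin ℓ → MvPolynomial (Fin ℓ) ℝ)
    {n : WithTop ℕ∞} : ContDiffOn ℝ n (D.scaledJac r q) D.region :=
  (contDiffOn_prod fun k _ => (D.contDiff_form k).contDiffOn).mul
    (ContDiffOn.matrix_det fun i a => D.contDiffOn_jac r q i a)

theorem scaledJac_ne_zero_iff (r : ℕ) (q : Fin ℓ → MvPolynomial (Fin ℓ) ℝ) {y : Fin ℓ → ℝ}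
    (hy : y ∈ D.region) : D.scaledJac r q y ≠ 0 ↔ (D.jac r q y).det ≠ 0 := by
  have : ∏ k, D.form k y ≠ 0 := Finset.prod_ne_zero_iff.2 fun k _ => (hy k).ne'
  simp [scaledJac, this]

end GaleData

namespace GaleData

variable {ℓ M : ℕ} (D : GaleData ℓ M)

/-- The Jacobian matrix bordered by the first affine form, in homogeneous coordinates. -/
noncomputable def extMatrix (r : ℕ) (d : Fin ℓ → ℕ) (q : Fin ℓ → MvPolynomial (Fin ℓ) ℝ)
    (y : Fin ℓ → ℝ) : Matrix (Fin (ℓ + 1)) (Fin (ℓ + 1)) ℝ :=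
  Matrix.of (Fin.cons (Fin.cons (D.α 0) (D.β 0)) fun i =>
    Fin.cons (if (i : ℕ) < r then ∑ k, D.b i k * (D.α k / D.form k y)
      else eval y (C (d i : ℝ) * q i - ∑ a, X a * pderiv a (q i))) (D.jac r q y i))

/-- The cofactors appearing in the comparison of `extMatrix` and `scaledJac`. -/
noncomputable def extCofactor (r : ℕ) (d : Fin ℓ → ℕ) (q : Fin ℓ → MvPolynomial (Fin ℓ) ℝ)
    (i : Fin ℓ) (y : Fin ℓ → ℝ) : ℝ :=
  (∏ k ∈ Finset.univ.erase 0, D.form k y) * ((-1) ^ ((i : ℕ) + 1) *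
    ((D.extMatrix r d q y).submatrix i.succ.succAbove Fin.succ).det)

theorem contDiffOn_extCofactor (r : ℕ) (d : Fin ℓ → ℕ) (q : Fin ℓ → MvPolynomial (Fin ℓ) ℝ)
    (i : Fin ℓ) {n : WithTop ℕ∞} : ContDiffOn ℝ n (D.extCofactor r d q i) D.region := by
  refine (contDiffOn_prod fun k _ => (D.contDiff_form k).contDiffOn).mul
    (contDiffOn_const.mul (ContDiffOn.matrix_det fun i' a => ?_))
  simp only [extMatrix, Matrix.submatrix_apply, Matrix.of_apply]
  generalize i.succ.succAbove i' = i''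
  cases i'' using Fin.cases with
  | zero => simpa using contDiffOn_const
  | succ i'' => simpa using D.contDiffOn_jac r q i'' a

theorem prod_mul_det_extMatrix (r : ℕ) (d : Fin ℓ → ℕ) (q : Fin ℓ → MvPolynomial (Fin ℓ) ℝ)
    (hb : ∀ i, ∑ k, D.b i k = 0) {y : Fin ℓ → ℝ} (hy : y ∈ D.region) :
    (∏ k ∈ Finset.univ.erase 0, D.form k y) * (D.extMatrix r d q y).det =
      D.scaledJac r q y +
        ∑ i : Fin ℓ, (if (i : ℕ) < r then 0 else d i * eval y (q i)) * D.extCofactor r d q i y := by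
  classical
  set B := D.extMatrix r d q y with hB
  have h1 := Matrix.det_updateCol_sum B 0 (Fin.cons 1 y)
  rw [Fin.cons_zero, one_smul] at h1
  have h0 : ∑ i, (Fin.cons 1 y : Fin (ℓ + 1) → ℝ) i • B 0 i = D.form 0 y := by
    rw [Fin.sum_univ_succ]
    simp [hB, extMatrix, form, mul_comm]
  have hs : ∀ i : Fin ℓ, ∑ j, (Fin.cons 1 y : Fin (ℓ + 1) → ℝ) j • B i.succ j =
      if (i : ℕ) < r then 0 else d i * eval y (q i) := by
    intro i
    rw [Fin.sum_univ_succ]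
    by_cases hi : (i : ℕ) < r
    · simp only [hB, extMatrix, Matrix.of_apply, Fin.cons_zero, Fin.cons_succ, hi, if_true, jac,
        smul_eq_mul, one_mul, Finset.mul_sum]
      rw [Finset.sum_comm, ← Finset.sum_add_distrib, ← hb i]
      refine Finset.sum_congr rfl fun k _ => ?_
      have hk := (hy k).ne'
      have : D.α k / D.form k y + ∑ a, y a * (D.β k a / D.form k y) = 1 := by
        rw [eq_comm, ← div_self hk]
        conv_lhs => rw [form.eq_def, add_div, Finset.sum_div]
        congr 1
        exact Finset.sum_congr rfl fun a _ => by rw [form]; ring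
      calc _ = D.b i k * (D.α k / D.form k y + ∑ a, y a * (D.β k a / D.form k y)) := by
            rw [mul_add, Finset.mul_sum]
            exact congrArg _ (Finset.sum_congr rfl fun a _ => by ring)
        _ = _ := by rw [this, mul_one]
    · simp [hB, extMatrix, hi, jac]
  rw [← h1, Matrix.det_succ_column_zero, Fin.sum_univ_succ, mul_add]
  congr 1
  · rw [Matrix.updateCol_self, h0, scaledJac,
      ← Finset.mul_prod_erase Finset.univ (fun k => D.form k y) (Finset.mem_univ 0)]
    have : ((B.updateCol 0 fun k => ∑ i, (Fin.cons 1 y : Fin (ℓ + 1) → ℝ) i • B k i).submatrix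
        (Fin.succAbove 0) Fin.succ) = D.jac r q y := by
      ext i a
      simp [hB, extMatrix]
    rw [this]
    simp
    ring
  · rw [Finset.mul_sum]
    refine Finset.sum_congr rfl fun i _ => ?_
    rw [Matrix.updateCol_self, hs, extCofactor]
    have : ((B.updateCol 0 fun k => ∑ i, (Fin.cons 1 y : Fin (ℓ + 1) → ℝ) i • B k i).submatrix
        i.succ.succAbove Fin.succ) = (D.extMatrix r d q y).submatrix i.succ.succAbove Fin.succ := by
      ext i' a
      simp [hB]
    rw [this, Fin.val_succ]
    ring

/-- Polynomial rows used to expand `extMatrix`. -/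
noncomputable def extRow (r : ℕ) (d : Fin ℓ → ℕ) (q : Fin ℓ → MvPolynomial (Fin ℓ) ℝ)
    (k : Fin (M + 1)) : Fin (ℓ + 1) → Fin (ℓ + 1) → MvPolynomial (Fin ℓ) ℝ :=
  Fin.cons (Fin.cons (C (D.α k)) fun a => C (D.β k a)) fun i =>
    if (i : ℕ) < r then Fin.cons (C (D.α k)) fun a => C (D.β k a)
    else Fin.cons (C (d i : ℝ) * q i - ∑ a, X a * pderiv a (q i)) fun a => pderiv a (q i)

/-- Weights used to expand `extMatrix`. -/
noncomputable def extWeight (r : ℕ) (y : Fin ℓ → ℝ) (k : Fin (M + 1)) : Fin (ℓ + 1) → ℝ :=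
  Fin.cons (if k = 0 then 1 else 0) fun i =>
    if (i : ℕ) < r then D.b i k / D.form k y else if k = 0 then 1 else 0

theorem extMatrix_eq_sum (r : ℕ) (d : Fin ℓ → ℕ) (q : Fin ℓ → MvPolynomial (Fin ℓ) ℝ)
    (y : Fin ℓ → ℝ) (i : Fin (ℓ + 1)) :
    D.extMatrix r d q y i =
      ∑ k, D.extWeight r y k i • fun j => eval y (D.extRow r d q k i j) := by
  ext j
  rw [Finset.sum_apply]
  cases i using Fin.cases with
  | zero =>
    cases j using Fin.cases with
    | zero => simp [extMatrix, extWeight, extRow]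
    | succ a => simp [extMatrix, extWeight, extRow]
  | succ i =>
    by_cases hi : (i : ℕ) < r
    · cases j using Fin.cases with
      | zero =>
        simp only [extMatrix, extWeight, extRow, hi, Matrix.of_apply, Fin.cons_succ, Fin.cons_zero,
          if_true, Pi.smul_apply, smul_eq_mul, eval_C]
        exact Finset.sum_congr rfl fun k _ => by ring
      | succ a =>
        simp only [extMatrix, extWeight, extRow, hi, Matrix.of_apply, Fin.cons_succ, jac,
          if_true, Pi.smul_apply, smul_eq_mul, eval_C]
        exact Finset.sum_congr rfl fun k _ => by ring
    · cases j using Fin.cases with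
      | zero => simp [extMatrix, extWeight, extRow, hi]
      | succ a => simp [extMatrix, extWeight, extRow, hi, jac]

theorem det_extMatrix_eq_sum (r : ℕ) (d : Fin ℓ → ℕ) (q : Fin ℓ → MvPolynomial (Fin ℓ) ℝ)
    (y : Fin ℓ → ℝ) :
    (D.extMatrix r d q y).det = ∑ f : Fin (ℓ + 1) → Fin (M + 1),
      (∏ i, D.extWeight r y (f i) i) *
        eval y (Matrix.det (Matrix.of fun i => D.extRow r d q (f i) i)) := by
  classical
  have h1 : (D.extMatrix r d q y).det = (Matrix.detRowAlternating (R := ℝ)).toMultilinearMap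
      fun i => ∑ k, D.extWeight r y k i • fun j => eval y (D.extRow r d q k i j) := by
    rw [← funext (D.extMatrix_eq_sum r d q y)]
    rfl
  rw [h1, MultilinearMap.map_sum]
  refine Finset.sum_congr rfl fun f _ => ?_
  rw [MultilinearMap.map_smul_univ, smul_eq_mul, RingHom.map_det]
  rfl

theorem exists_poly_term (r : ℕ) (hr : r ≤ ℓ) (d : Fin ℓ → ℕ)
    (q : Fin ℓ → MvPolynomial (Fin ℓ) ℝ)
    (hq : ∀ i : Fin ℓ, r ≤ i → (q i).totalDegree ≤ d i) (f : Fin (ℓ + 1) → Fin (M + 1)) :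
    ∃ P : MvPolynomial (Fin ℓ) ℝ,
      P.totalDegree ≤ M - r + ∑ i : Fin ℓ, (if (i : ℕ) < r then 0 else d i - 1) ∧
      ∀ y ∈ D.region, (∏ k ∈ Finset.univ.erase 0, D.form k y) *
        ((∏ i, D.extWeight r y (f i) i) *
          eval y (Matrix.det (Matrix.of fun i => D.extRow r d q (f i) i))) = eval y P := by
  classical
  by_cases h0 : f 0 = 0
  swap
  · refine ⟨0, by simp, fun y _ => ?_⟩
    rw [Fin.prod_univ_succ]
    simp [extWeight, h0]
  by_cases hpoly : ∀ i : Fin ℓ, r ≤ i → f i.succ = 0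
  swap
  · push Not at hpoly
    obtain ⟨i, hi, hfi⟩ := hpoly
    refine ⟨0, by simp, fun y _ => ?_⟩
    rw [Finset.prod_eq_zero (Finset.mem_univ i.succ)]
    · simp
    · simp [extWeight, hfi, not_lt.2 hi]
  set Ψ : Finset (Fin ℓ) := Finset.univ.filter fun i => (i : ℕ) < r with hΨ
  by_cases hz : ∀ i ∈ Ψ, f i.succ ≠ 0
  swap
  · push Not at hz
    obtain ⟨i, hi, hfi⟩ := hz
    refine ⟨0, by simp, fun y _ => ?_⟩
    rw [Matrix.det_zero_of_row_eq (Fin.succ_ne_zero i).symm]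
    · simp
    · have hi' : (i : ℕ) < r := by simpa [hΨ] using hi
      ext1 j
      simp [extRow, h0, hfi, hi']
  by_cases hinj : InjOn (fun i : Fin ℓ => f i.succ) Ψ
  swap
  · simp only [InjOn, not_forall] at hinj
    obtain ⟨i, hi, i', hi', hff, hne⟩ := hinj
    refine ⟨0, by simp, fun y _ => ?_⟩
    rw [Matrix.det_zero_of_row_eq (i := i.succ) (j := i'.succ) (by simpa using hne)]
    · simp
    · have h1 : (i : ℕ) < r := by simpa [hΨ] using hi
      have h2 : (i' : ℕ) < r := by simpa [hΨ] using hi'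
      have h3 : f i.succ = f i'.succ := hff
      ext1 j
      simp [extRow, h1, h2, h3]
  set T := Ψ.image fun i => f i.succ with hT
  have hTsub : T ⊆ Finset.univ.erase 0 := by
    intro k hk
    obtain ⟨i, hi, rfl⟩ := Finset.mem_image.1 hk
    exact Finset.mem_erase.2 ⟨hz i hi, Finset.mem_univ _⟩
  have hΨcard : Ψ.card = r := by
    rw [hΨ, Fin.card_filter_val_lt, min_eq_right hr]
  have hTcard : T.card = r := by rw [hT, Finset.card_image_of_injOn hinj, hΨcard]
  refine ⟨C (∏ i ∈ Ψ, D.b i (f i.succ)) * (∏ k ∈ Finset.univ.erase 0 \ T, D.formPoly k) *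
    Matrix.det (Matrix.of fun i => D.extRow r d q (f i) i), ?_, fun y hy => ?_⟩
  · refine (totalDegree_mul _ _).trans (add_le_add ?_ ?_)
    · refine (totalDegree_mul _ _).trans ?_
      rw [totalDegree_C, zero_add]
      refine (totalDegree_finsetProd _ _).trans
        ((Finset.sum_le_card_nsmul _ _ 1 fun k _ => D.totalDegree_formPoly_le k).trans ?_)
      rw [Finset.card_sdiff_of_subset hTsub, hTcard]
      simp
    · have := MvPolynomial.totalDegree_det_le (Matrix.of fun i => D.extRow r d q (f i) i)
        (Fin.cons 0 fun i : Fin ℓ => if (i : ℕ) < r then 0 else d i - 1) (by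
          intro i j
          cases i using Fin.cases with
          | zero =>
            cases j using Fin.cases with
            | zero => simp [extRow]
            | succ a => simp [extRow]
          | succ i =>
            by_cases hi : (i : ℕ) < r
            · cases j using Fin.cases with
              | zero => simp [extRow, hi]
              | succ a => simp [extRow, hi]
            · cases j using Fin.cases with
              | zero =>
                simpa [extRow, hi] using
                  MvPolynomial.totalDegree_euler_le (hq i (not_lt.1 hi))
              | succ a =>
                simpa [extRow, hi] using
                  MvPolynomial.totalDegree_pderiv_le (hq i (not_lt.1 hi)) a)
      rw [Fin.sum_univ_succ] at this
      simpa using this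
  · rw [← mul_assoc, map_mul, map_mul, eval_C, map_prod]
    congr 1
    simp only [eval_formPoly]
    rw [← Finset.prod_sdiff hTsub, hT, Finset.prod_image hinj, Fin.prod_univ_succ]
    have h1 : ∏ i : Fin ℓ, D.extWeight r y (f i.succ) i.succ =
        ∏ i ∈ Ψ, D.b i (f i.succ) / D.form (f i.succ) y := by
      rw [hΨ, Finset.prod_filter]
      refine Finset.prod_congr rfl fun i _ => ?_
      by_cases hi : (i : ℕ) < r
      · simp [extWeight, hi]
      · simp [extWeight, hi, hpoly i (not_lt.1 hi)]
    have h2 : D.extWeight r y (f 0) 0 = 1 := by simp [extWeight, h0]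
    rw [h1, h2, one_mul, Finset.prod_div_distrib]
    have h3 : ∏ i ∈ Ψ, D.form (f i.succ) y ≠ 0 :=
      Finset.prod_ne_zero_iff.2 fun i _ => (hy _).ne'
    field_simp

/-- On the region, the scaled Jacobian agrees with a polynomial of small degree, up to multiples
of the polynomial equations. -/
theorem exists_poly_scaledJac (r : ℕ) (hr : r ≤ ℓ) (d : Fin ℓ → ℕ)
    (q : Fin ℓ → MvPolynomial (Fin ℓ) ℝ) (hb : ∀ i, ∑ k, D.b i k = 0)
    (hq : ∀ i : Fin ℓ, r ≤ i → (q i).totalDegree ≤ d i) :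
    ∃ P : MvPolynomial (Fin ℓ) ℝ,
      P.totalDegree ≤ M - r + ∑ i : Fin ℓ, (if (i : ℕ) < r then 0 else d i - 1) ∧
      ∀ y ∈ D.region, eval y P = D.scaledJac r q y +
        ∑ i : Fin ℓ, (if (i : ℕ) < r then 0 else d i * eval y (q i)) *
          D.extCofactor r d q i y := by
  choose P hP1 hP2 using D.exists_poly_term r hr d q hq
  refine ⟨∑ f, P f, totalDegree_finsetSum_le fun f _ => hP1 f, fun y hy => ?_⟩
  rw [← D.prod_mul_det_extMatrix r d q hb hy, det_extMatrix_eq_sum, Finset.mul_sum, map_sum]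
  exact Finset.sum_congr rfl fun f _ => (hP2 f y hy).symm

end GaleData

namespace GaleData

variable {ℓ M : ℕ} (D : GaleData ℓ M)

/-- Genericity of the Gale data, together with the normalisations that make the associated
system projective. -/
structure Generic : Prop where
  le : ℓ ≤ M
  sum_b : ∀ i, ∑ k, D.b i k = 0
  sum_form : ∀ y, ∑ k, D.form k y = 1
  b_gen : ∀ I : Finset (Fin (M + 1)), I.card ≤ ℓ → ∀ v : Fin (M + 1) → ℝ, (∀ k ∉ I, v k = 0) →
    (∀ i : Fin ℓ, (i : ℕ) < I.card → ∑ k, D.b i k * v k = 0) → v = 0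
  form_gen : ∀ I : Finset (Fin (M + 1)), I.card ≤ ℓ + 1 → ∀ v : Fin (M + 1) → ℝ,
    (∀ k ∉ I, v k = 0) → ∑ k, v k * D.α k = 0 → (∀ a, ∑ k, v k * D.β k a = 0) → v = 0

/-- Nondegeneracy of the polynomial equations along the faces of the region. -/
def FaceRegular (r : ℕ) (q : Fin ℓ → MvPolynomial (Fin ℓ) ℝ) : Prop :=
  ∀ (I : Finset (Fin (M + 1))) (y : Fin ℓ → ℝ), (∀ k ∈ I, D.form k y = 0) →
    (∀ i : Fin ℓ, r < i → eval y (q i) = 0) → r + 1 ≤ I.card →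
    I.card = r + 1 ∧ ∀ v : Fin ℓ → ℝ, (∀ k ∈ I, ∑ a, D.β k a * v a = 0) →
      (∀ i : Fin ℓ, r < i → ∑ a, eval y (pderiv a (q i)) * v a = 0) → v = 0

variable {D}

theorem Generic.eq_zero_of_forms (h : D.Generic) {e : Fin (ℓ + 1) → Fin (M + 1)}
    (he : Function.Injective e) {t : ℝ} {y : Fin ℓ → ℝ}
    (hy : ∀ j, D.α (e j) * t + ∑ a, D.β (e j) a * y a = 0) : t = 0 ∧ y = 0 := by
  classical
  let A : Matrix (Fin (ℓ + 1)) (Fin (ℓ + 1)) ℝ :=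
    Matrix.of fun j => Fin.cons (D.α (e j)) (D.β (e j))
  have hA : A.det ≠ 0 := by
    intro h0
    obtain ⟨u, hu, hu0⟩ := Matrix.exists_vecMul_eq_zero_iff.2 h0
    apply hu
    let v : Fin (M + 1) → ℝ := fun k => ∑ j, if e j = k then u j else 0
    have hv : ∀ w : Fin (M + 1) → ℝ, ∑ k, v k * w k = ∑ j, u j * w (e j) := by
      intro w
      simp only [v, Finset.sum_mul]
      rw [Finset.sum_comm]
      refine Finset.sum_congr rfl fun j _ => ?_
      simp [ite_mul]
    have hv0 : v = 0 := by
      refine h.form_gen (Finset.univ.image e) ?_ v ?_ ?_ ?_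
      · exact Finset.card_image_le.trans (by simp)
      · intro k hk
        refine Finset.sum_eq_zero fun j _ => if_neg ?_
        rintro rfl
        exact hk (Finset.mem_image_of_mem e (Finset.mem_univ j))
      · rw [hv]
        simpa [A, Matrix.vecMul, dotProduct] using congrFun hu0 0
      · intro a
        rw [hv]
        simpa [A, Matrix.vecMul, dotProduct] using congrFun hu0 a.succ
    ext j
    have := congrFun hv0 (e j)
    simpa [v, he.eq_iff] using this
  have h1 : A.mulVec (Fin.cons t y) = 0 := by
    ext j
    simp only [Matrix.mulVec, dotProduct]
    rw [Fin.sum_univ_succ]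
    simpa [A] using hy j
  have h2 := Matrix.eq_zero_of_mulVec_eq_zero hA h1
  exact ⟨by simpa using congrFun h2 0, by ext a; simpa using congrFun h2 a.succ⟩

theorem Generic.eq_zero_of_linear_forms (h : D.Generic) {y : Fin ℓ → ℝ}
    (hy : ∀ k, ∑ a, D.β k a * y a = 0) : y = 0 :=
  (h.eq_zero_of_forms (e := Fin.castLE (Nat.succ_le_succ h.le)) (Fin.castLE_injective _) (t := 0)
    fun j => by simpa using hy _).2

theorem Generic.card_le_of_forms_eq_zero (h : D.Generic) {I : Finset (Fin (M + 1))}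
    {y : Fin ℓ → ℝ} (hy : ∀ k ∈ I, D.form k y = 0) : I.card ≤ ℓ := by
  by_contra! hI
  have h1 := h.eq_zero_of_forms (e := fun j => (I.equivFin.symm (Fin.castLE hI j) : Fin (M + 1)))
    (fun j j' hj => by
      have := I.equivFin.symm.injective (Subtype.ext hj)
      exact Fin.castLE_injective _ this) (t := 1) (y := y) (fun j => by
      have := hy _ (I.equivFin.symm (Fin.castLE hI j)).2
      rwa [form, ← mul_one (D.α _)] at this)
  exact one_ne_zero h1.1

theorem Generic.eq_zero_of_linear_relation (h : D.Generic) {I : Finset (Fin (M + 1))}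
    {y : Fin ℓ → ℝ} (hy : ∀ k ∈ I, D.form k y = 0) {v : Fin (M + 1) → ℝ}
    (hv : ∀ k ∉ I, v k = 0) (hv' : ∀ a, ∑ k, v k * D.β k a = 0) : v = 0 := by
  refine h.form_gen I ((h.card_le_of_forms_eq_zero hy).trans (Nat.le_succ _)) v hv ?_ hv'
  have h1 : ∑ k, v k * D.form k y = 0 := by
    refine Finset.sum_eq_zero fun k _ => ?_
    by_cases hk : k ∈ I
    · rw [hy k hk, mul_zero]
    · rw [hv k hk, zero_mul]
  simp only [form, mul_add, Finset.sum_add_distrib, Finset.mul_sum] at h1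
  have h2 : ∑ k, ∑ a, v k * (D.β k a * y a) = 0 := by
    rw [Finset.sum_comm]
    refine Finset.sum_eq_zero fun a _ => ?_
    rw [← zero_mul (y a), ← hv' a, Finset.sum_mul]
    exact Finset.sum_congr rfl fun k _ => by ring
  linarith

theorem Generic.exists_dual (h : D.Generic) {I : Finset (Fin (M + 1))}
    {y : Fin ℓ → ℝ} (hy : ∀ k ∈ I, D.form k y = 0) :
    ∃ w : I → Fin ℓ → ℝ, ∀ k k' : I, ∑ a, D.β k a * w k' a = if k = k' then 1 else 0 := by
  classical
  let B : Matrix I (Fin ℓ) ℝ := Matrix.of fun k a => D.β k a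
  have hB : LinearIndependent ℝ B.row := by
    rw [Fintype.linearIndependent_iff]
    intro g hg
    let v : Fin (M + 1) → ℝ := fun k => if hk : k ∈ I then g ⟨k, hk⟩ else 0
    have hv : v = 0 := by
      refine h.eq_zero_of_linear_relation hy (fun k hk => dif_neg hk) fun a => ?_
      rw [← Finset.sum_subset (Finset.subset_univ I) (fun k _ hk => by simp [v, hk]),
        ← Finset.sum_coe_sort]
      have := congrFun hg a
      simpa [v, B, Finset.sum_apply] using this
    intro k
    simpa [v] using congrFun hv k
  have hsurj : Function.Surjective B.mulVecLin := by
    rw [← LinearMap.range_eq_top]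
    refine Submodule.eq_top_of_finrank_eq ?_
    have := hB.rank_matrix
    rw [Matrix.rank] at this
    rw [this]
    simp
  choose w hw using fun k' : I => hsurj (Pi.single k' 1)
  refine ⟨w, fun k k' => ?_⟩
  have := congrFun (hw k') k
  simpa [B, Matrix.mulVec, dotProduct, Pi.single_apply] using this

theorem Generic.isBounded_region (h : D.Generic) : Bornology.IsBounded D.region := by
  let T : (Fin ℓ → ℝ) →ₗ[ℝ] (Fin (M + 1) → ℝ) := Matrix.mulVecLin (Matrix.of D.β)
  have hT : LinearMap.ker T = ⊥ := LinearMap.ker_eq_bot'.2 fun y hy =>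
    h.eq_zero_of_linear_forms fun k => by
      simpa [T, Matrix.mulVec, dotProduct] using congrFun hy k
  obtain ⟨K, _, hK⟩ := T.exists_antilipschitzWith hT
  refine (hK.isBounded_preimage (Metric.isBounded_closedBall (x := fun k => -D.α k) (r := 1))).subset
    fun y hy => ?_
  rw [mem_preimage, Metric.mem_closedBall, dist_pi_le_iff zero_le_one]
  intro k
  have h1 : D.form k y ≤ 1 := by
    rw [← h.sum_form y]
    exact Finset.single_le_sum (f := fun k => D.form k y) (fun k _ => (hy k).le)
      (Finset.mem_univ k)
  have h2 : T y k = ∑ a, D.β k a * y a := by simp [T, Matrix.mulVec, dotProduct]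
  rw [Real.dist_eq, h2, sub_neg_eq_add, add_comm, abs_le]
  have := hy k
  simp only [form] at this h1
  exact ⟨by linarith, h1⟩

theorem Generic.ae_faceRegular_aux (h : D.Generic) {r : ℕ} (hr : r < ℓ)
    (q : Fin ℓ → MvPolynomial (Fin ℓ) ℝ) (I : Finset (Fin (M + 1))) (hI : r + 1 ≤ I.card)
    {y₀ : Fin ℓ → ℝ} (hy₀ : ∀ k ∈ I, D.form k y₀ = 0) :
    ∀ᵐ θ : Fin ℓ → ℝ, ∀ y : Fin ℓ → ℝ, (∀ k ∈ I, D.form k y = 0) →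
      (∀ i : Fin ℓ, r < i → eval y (q i) = θ i) →
      I.card = r + 1 ∧ ∀ v : Fin ℓ → ℝ, (∀ k ∈ I, ∑ a, D.β k a * v a = 0) →
      (∀ i : Fin ℓ, r < i → ∑ a, eval y (pderiv a (q i)) * v a = 0) → v = 0 := by
  classical
  obtain ⟨w, hw⟩ := h.exists_dual hy₀
  let lin : I → (Fin ℓ → ℝ) →L[ℝ] ℝ := fun k => ∑ a, D.β k a •
    (ContinuousLinearMap.proj a : (Fin ℓ → ℝ) →L[ℝ] ℝ)
  have hlin : ∀ k v, lin k v = ∑ a, D.β k a * v a := fun k v => by simp [lin]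
  let P : (Fin ℓ → ℝ) →L[ℝ] (Fin ℓ → ℝ) :=
    ContinuousLinearMap.id ℝ _ - ∑ k, (lin k).smulRight (w k)
  have hP : ∀ v, P v = v - ∑ k, lin k v • w k := fun v => by simp [P]
  have hlw : ∀ k k', lin k (w k') = if k = k' then 1 else 0 := fun k k' => by
    rw [hlin, hw]
  let e : ∀ i : Fin ℓ, (i : ℕ) ≤ r → I := fun i hi => I.equivFin.symm ⟨i, by omega⟩
  let f : (Fin ℓ → ℝ) → Fin ℓ → ℝ := fun y i =>
    if hi : (i : ℕ) ≤ r then lin (e i hi) y else eval (y₀ + P y) (q i)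
  let f' : (Fin ℓ → ℝ) → (Fin ℓ → ℝ) →L[ℝ] (Fin ℓ → ℝ) := fun y =>
    ContinuousLinearMap.pi fun i => if hi : (i : ℕ) ≤ r then lin (e i hi) else
      (∑ a, eval (y₀ + P y) (pderiv a (q i)) •
        (ContinuousLinearMap.proj a : (Fin ℓ → ℝ) →L[ℝ] ℝ)) ∘L P
  have hf : ∀ y ∈ univ, HasFDerivAt f (f' y) y := by
    intro y _
    rw [hasFDerivAt_pi']
    intro i
    by_cases hi : (i : ℕ) ≤ r
    · simp only [f, hi, dif_pos]
      refine (lin (e i hi)).hasFDerivAt.congr_fderiv ?_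
      ext v
      simp [f', hi]
    · simp only [f, hi, dif_neg, not_false_eq_true]
      have h1 : HasFDerivAt (fun y => y₀ + P y) P y := P.hasFDerivAt.const_add y₀
      refine (((q i).hasStrictFDerivAt_eval (y₀ + P y)).hasFDerivAt.comp y h1).congr_fderiv ?_
      ext v
      simp [f', hi]
  filter_upwards [ae_regular_value hf] with θ hθ y hy hqy
  -- a preimage of `θ` over the point `y`
  let u : I → ℝ := fun k => if hk : (I.equivFin k : ℕ) ≤ r then θ ⟨I.equivFin k, by omega⟩ else 0
  have hker : ∀ k : I, lin k (y - y₀) = 0 := by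
    intro k
    have h1 := hy k k.2
    have h2 := hy₀ k k.2
    rw [hlin]
    simp only [form] at h1 h2
    simp only [Pi.sub_apply, mul_sub, Finset.sum_sub_distrib]
    linarith
  let z := (y - y₀) + ∑ k, u k • w k
  have hlz : ∀ k, lin k z = u k := by
    intro k
    simp [z, hker, hlw]
  have hPz : y₀ + P z = y := by
    rw [hP]
    simp only [hlz, z]
    abel
  have hfz : f z = θ := by
    ext i
    by_cases hi : (i : ℕ) ≤ r
    · simp [f, hi, hlz, u, e]
    · simp only [f, hi, dif_neg, not_false_eq_true]
      rw [hPz]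
      exact hqy i (by omega)
  have hreg := hθ z (mem_univ _) hfz
  constructor
  · by_contra hne
    have hlt : r + 1 < I.card := lt_of_le_of_ne hI (Ne.symm hne)
    let k₀ : I := I.equivFin.symm ⟨r + 1, hlt⟩
    have hPw : P (w k₀) = 0 := by
      rw [hP]
      simp [hlw]
    have h0 : w k₀ = 0 := by
      refine hreg _ ?_
      ext i
      by_cases hi : (i : ℕ) ≤ r
      · have : e i hi ≠ k₀ := by
          intro h0
          have := congrArg Fin.val (I.equivFin.symm.injective h0)
          simp at this
          omega
        simp [f', hi, hlw, this]
      · simp [f', hi, hPw]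
    have := hlw k₀ k₀
    rw [h0, map_zero, if_pos rfl] at this
    exact zero_ne_one this
  · intro v hv hqv
    have hlv : ∀ k : I, lin k v = 0 := fun k => by rw [hlin]; exact hv k k.2
    have hPv : P v = v := by
      rw [hP]
      simp [hlv]
    refine hreg v ?_
    ext i
    by_cases hi : (i : ℕ) ≤ r
    · simp [f', hi, hlv]
    · have := hqv i (by omega)
      simpa [f', hi, hPv, hPz] using this

theorem Generic.ae_faceRegular (h : D.Generic) {r : ℕ} (hr : r < ℓ)
    (q : Fin ℓ → MvPolynomial (Fin ℓ) ℝ) :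
    ∀ᵐ θ : Fin ℓ → ℝ, D.FaceRegular r fun i => q i - C (θ i) := by
  have h1 : ∀ I : Finset (Fin (M + 1)), ∀ᵐ θ : Fin ℓ → ℝ, ∀ y : Fin ℓ → ℝ,
      (∀ k ∈ I, D.form k y = 0) → (∀ i : Fin ℓ, r < i → eval y (q i) = θ i) → r + 1 ≤ I.card →
      I.card = r + 1 ∧ ∀ v : Fin ℓ → ℝ, (∀ k ∈ I, ∑ a, D.β k a * v a = 0) →
      (∀ i : Fin ℓ, r < i → ∑ a, eval y (pderiv a (q i)) * v a = 0) → v = 0 := by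
    intro I
    by_cases hI : r + 1 ≤ I.card
    · by_cases hy : ∃ y₀, ∀ k ∈ I, D.form k y₀ = 0
      · obtain ⟨y₀, hy₀⟩ := hy
        filter_upwards [h.ae_faceRegular_aux hr q I hI hy₀] with θ hθ y h1 h2 _
        exact hθ y h1 h2
      · exact Eventually.of_forall fun θ y h1 => absurd ⟨y, h1⟩ hy
    · exact Eventually.of_forall fun θ y _ _ h2 => absurd h2 hI
  filter_upwards [MeasureTheory.ae_all_iff.2 h1] with θ hθ I y h2 h3 h4
  refine (hθ I y h2 (fun i hi => ?_) h4).imp_right fun h5 v hv hqv => h5 v hv fun i hi => ?_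
  · simpa [sub_eq_zero] using h3 i hi
  · simpa using hqv i hi

end GaleData

namespace GaleData

variable {ℓ M : ℕ} {D : GaleData ℓ M}

theorem Generic.exists_bound (h : D.Generic) {I : Finset (Fin (M + 1))} (hI : I.card ≤ ℓ) :
    ∃ K : ℝ, 0 ≤ K ∧ ∀ (v : Fin (M + 1) → ℝ) (R : ℝ), 0 ≤ R → (∀ k ∉ I, v k = 0) →
      (∀ i : Fin ℓ, (i : ℕ) < I.card → |∑ k, D.b i k * v k| ≤ R) → ∀ k, |v k| ≤ K * R := by
  classical
  let ext : (I → ℝ) →ₗ[ℝ] (Fin (M + 1) → ℝ) :=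
    { toFun := fun u k => if hk : k ∈ I then u ⟨k, hk⟩ else 0
      map_add' := fun u u' => by ext k; by_cases hk : k ∈ I <;> simp [hk]
      map_smul' := fun t u => by ext k; by_cases hk : k ∈ I <;> simp [hk] }
  have hext : ∀ u k, ext u k = if hk : k ∈ I then u ⟨k, hk⟩ else 0 := fun _ _ => rfl
  let T : (I → ℝ) →ₗ[ℝ] (Fin I.card → ℝ) :=
    (Matrix.mulVecLin (Matrix.of fun i k => D.b (Fin.castLE hI i) k)) ∘ₗ ext
  have hTa : ∀ u i, T u i = ∑ k, D.b (Fin.castLE hI i) k * ext u k := fun u i => by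
    simp [T, Matrix.mulVec, dotProduct]
  have hT : LinearMap.ker T = ⊥ := LinearMap.ker_eq_bot'.2 fun u hu => by
    have h1 := h.b_gen I hI (ext u) (fun k hk => by simp [hext, hk]) fun i hi => by
      have := congrFun hu ⟨i, hi⟩
      rw [hTa] at this
      exact this
    ext k
    have := congrFun h1 k
    simpa [hext] using this
  obtain ⟨K, _, hK⟩ := T.exists_antilipschitzWith hT
  refine ⟨K, K.2, fun v R hR hv hb k => ?_⟩
  by_cases hk : k ∈ I
  · let u : I → ℝ := fun k => v k
    have hu : ext u = v := by
      ext k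
      by_cases hk : k ∈ I <;> simp [hext, u, hk, hv]
    have h1 := hK.le_mul_norm_sub u 0
    rw [map_zero, add_zero, add_zero, norm_neg, norm_neg] at h1
    have h2 : ‖T u‖ ≤ R := (pi_norm_le_iff_of_nonneg hR).2 fun i => by
      rw [hTa, hu]
      exact hb _ i.2
    calc |v k| = ‖u ⟨k, hk⟩‖ := rfl
      _ ≤ ‖u‖ := norm_le_pi_norm u _
      _ ≤ K * ‖T u‖ := h1
      _ ≤ K * R := by gcongr
  · rw [hv k hk, abs_zero]
    positivity

/-- The part of a logarithmic form coming from the affine forms that do not vanish at `z`. -/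
noncomputable def restForm (D : GaleData ℓ M) (z : Fin ℓ → ℝ) (i : Fin ℓ) (y : Fin ℓ → ℝ) : ℝ :=
  by classical exact ∑ k, if D.form k z = 0 then 0 else D.b i k * Real.log (D.form k y)

/-- The logarithms of the affine forms that vanish at `z`. -/
noncomputable def logFace (D : GaleData ℓ M) (z y : Fin ℓ → ℝ) (k : Fin (M + 1)) : ℝ :=
  by classical exact if D.form k z = 0 then Real.log (D.form k y) else 0

theorem sum_logFace (z y : Fin ℓ → ℝ) (i : Fin ℓ) :
    ∑ k, D.b i k * D.logFace z y k = D.logForm i y - D.restForm z i y := by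
  classical
  rw [logForm, restForm, ← Finset.sum_sub_distrib]
  refine Finset.sum_congr rfl fun k _ => ?_
  by_cases hk : D.form k z = 0 <;> simp [logFace, hk]

theorem exists_hasStrictFDerivAt_restForm (z : Fin ℓ → ℝ) (i : Fin ℓ) :
    ∃ f', HasStrictFDerivAt (D.restForm z i) (f' : (Fin ℓ → ℝ) →L[ℝ] ℝ) z := by
  classical
  have : ∀ k, ∃ f' : (Fin ℓ → ℝ) →L[ℝ] ℝ, HasStrictFDerivAt
      (fun y => if D.form k z = 0 then 0 else D.b i k * Real.log (D.form k y)) f' z := by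
    intro k
    by_cases hk : D.form k z = 0
    · simp only [hk, if_true]
      exact ⟨_, hasStrictFDerivAt_const _ _⟩
    · simp only [hk, if_false]
      exact ⟨_, ((D.hasStrictFDerivAt_form k z).log hk).const_mul _⟩
  choose f' hf' using this
  exact ⟨_, HasStrictFDerivAt.fun_sum fun k _ => hf' k⟩

theorem continuousAt_restForm (z : Fin ℓ → ℝ) (i : Fin ℓ) : ContinuousAt (D.restForm z i) z :=
  (exists_hasStrictFDerivAt_restForm z i).choose_spec.continuousAt

theorem eventually_logFace_lt {z : Fin ℓ → ℝ} {k : Fin (M + 1)} (hk : D.form k z = 0) (R : ℝ) :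
    ∀ᶠ y in 𝓝 z, y ∈ D.region → D.logFace z y k < R := by
  have h1 : Tendsto (D.form k) (𝓝 z) (𝓝 0) := by
    simpa [hk] using (D.continuous_form k).tendsto z
  filter_upwards [h1.eventually (gt_mem_nhds (Real.exp_pos R))] with y hy hreg
  simp only [logFace, hk, if_true]
  exact (Real.log_lt_iff_lt_exp (hreg k)).2 hy

/-- The indices of the affine forms that vanish at a point. -/
noncomputable def zeroForms (D : GaleData ℓ M) (z : Fin ℓ → ℝ) : Finset (Fin (M + 1)) :=
  by classical exact Finset.univ.filter fun k => D.form k z = 0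

@[simp] theorem mem_zeroForms {z : Fin ℓ → ℝ} {k : Fin (M + 1)} :
    k ∈ D.zeroForms z ↔ D.form k z = 0 := by simp [zeroForms]

theorem Generic.card_zeroForms_le (h : D.Generic) (z : Fin ℓ → ℝ) : (D.zeroForms z).card ≤ ℓ :=
  h.card_le_of_forms_eq_zero (y := z) fun _ hk => mem_zeroForms.1 hk

theorem form_nonneg_of_mem_closure {z : Fin ℓ → ℝ} (hz : z ∈ closure D.region) (k : Fin (M + 1)) :
    0 ≤ D.form k z := by
  have h1 : IsClosed {y | 0 ≤ D.form k y} := isClosed_le continuous_const (D.continuous_form k)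
  exact closure_minimal (fun y hy => (hy k).le) h1 hz

theorem Generic.mem_region_of_bounded (h : D.Generic) {F : Filter (Fin ℓ → ℝ)} [F.NeBot]
    {z : Fin ℓ → ℝ} (hF : F ≤ 𝓝 z) (hreg : D.region ∈ F) {s : ℕ} (hs : (D.zeroForms z).card ≤ s)
    (hR : ∀ i : Fin ℓ, (i : ℕ) < s → ∃ R, ∀ᶠ y in F, |D.logForm i y| ≤ R) : z ∈ D.region := by
  have hz : z ∈ closure D.region :=
    mem_closure_iff_frequently.2 ((Eventually.frequently hreg).filter_mono hF)
  have key : ∀ k, D.form k z ≠ 0 := by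
    intro k₀ hk₀
    obtain ⟨K, hK0, hK⟩ := h.exists_bound (h.card_zeroForms_le z)
    have h1 : ∀ i : Fin ℓ, ∃ R, (i : ℕ) < s →
        ∀ᶠ y in F, |D.logForm i y - D.restForm z i y| ≤ R := by
      intro i
      by_cases hi : (i : ℕ) < s
      · obtain ⟨R, hR⟩ := hR i hi
        have h2 := (((continuousAt_restForm (D := D) z i).tendsto.mono_left hF).abs).eventually
          (gt_mem_nhds (lt_add_one _))
        refine ⟨R + (|D.restForm z i z| + 1), fun _ => ?_⟩
        filter_upwards [hR, h2] with y h3 h4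
        exact (abs_sub _ _).trans (add_le_add h3 h4.le)
      · exact ⟨0, fun hi' => absurd hi' hi⟩
    choose R hR using h1
    let R₀ := ∑ i, |R i|
    have h2 : ∀ᶠ y in F, ∀ i : Fin ℓ, (i : ℕ) < s → |D.logForm i y - D.restForm z i y| ≤ R₀ := by
      rw [eventually_all]
      intro i
      by_cases hi : (i : ℕ) < s
      · filter_upwards [hR i hi] with y hy _
        exact hy.trans ((le_abs_self _).trans
          (Finset.single_le_sum (f := fun i => |R i|) (fun i _ => abs_nonneg _)
            (Finset.mem_univ i)))
      · exact Eventually.of_forall fun y hi' => absurd hi' hi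
    have h3 := (eventually_logFace_lt hk₀ (-(K * R₀))).filter_mono hF
    obtain ⟨y, h2, h3, h4⟩ := (h2.and (h3.and hreg)).exists
    have h5 := hK (D.logFace z y) R₀ (Finset.sum_nonneg fun i _ => abs_nonneg _)
      (fun k hk => by
        have : D.form k z ≠ 0 := fun h0 => hk (mem_zeroForms.2 h0)
        simp [logFace, this]) (fun i hi => by
        rw [sum_logFace]
        exact h2 i (hi.trans_le hs)) k₀
    linarith [h3 h4, neg_abs_le (D.logFace z y k₀)]
  exact fun k => lt_of_le_of_ne (form_nonneg_of_mem_closure hz k) (key k).symm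

/-- The curve in the region cut out by all equations but the one with index `j`. -/
def curveSet (D : GaleData ℓ M) (j : Fin ℓ) (c : Fin ℓ → ℝ)
    (q : Fin ℓ → MvPolynomial (Fin ℓ) ℝ) : Set (Fin ℓ → ℝ) :=
  {y | y ∈ D.region ∧ (∀ i, i < j → D.logForm i y = c i) ∧ ∀ i, j < i → eval y (q i) = 0}

theorem eval_eq_zero_of_mem_closure_curveSet {j : Fin ℓ} {c : Fin ℓ → ℝ}
    {q : Fin ℓ → MvPolynomial (Fin ℓ) ℝ} {z : Fin ℓ → ℝ} (hz : z ∈ closure (D.curveSet j c q))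
    {i : Fin ℓ} (hi : j < i) : eval z (q i) = 0 := by
  have h1 : IsClosed {y | eval y (q i) = 0} :=
    isClosed_eq ((q i).contDiff_eval (n := 0)).continuous continuous_const
  exact closure_minimal (fun y hy => hy.2.2 i hi) h1 hz

theorem FaceRegular.card_zeroForms_le {j : Fin ℓ} {c : Fin ℓ → ℝ}
    {q : Fin ℓ → MvPolynomial (Fin ℓ) ℝ} (hq : D.FaceRegular j q) {z : Fin ℓ → ℝ}
    (hz : z ∈ closure (D.curveSet j c q)) : (D.zeroForms z).card ≤ j + 1 := by
  by_contra! hlt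
  exact hlt.ne' (hq (D.zeroForms z) z (fun k hk => mem_zeroForms.1 hk)
    (fun i hi => eval_eq_zero_of_mem_closure_curveSet hz hi) hlt.le).1

theorem continuousAt_logForm (i : Fin ℓ) {z : Fin ℓ → ℝ} (hz : z ∈ D.region) :
    ContinuousAt (D.logForm i) z :=
  (D.hasStrictFDerivAt_logForm i fun k => (hz k).ne').continuousAt

theorem Generic.isCompact_curveSet_slab (h : D.Generic) {j : Fin ℓ} {c : Fin ℓ → ℝ}
    {q : Fin ℓ → MvPolynomial (Fin ℓ) ℝ} (hq : D.FaceRegular j q) (L : ℝ) :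
    IsCompact {y | y ∈ D.curveSet j c q ∧ |D.logForm j y - c j| ≤ L} := by
  set S := {y | y ∈ D.curveSet j c q ∧ |D.logForm j y - c j| ≤ L} with hS
  refine Metric.isCompact_of_isClosed_isBounded (isClosed_of_closure_subset fun z hz => ?_)
    (h.isBounded_region.subset fun y hy => hy.1.1)
  have hz' : z ∈ closure (D.curveSet j c q) := closure_mono (fun y hy => hy.1) hz
  have : (𝓝[S] z).NeBot := mem_closure_iff_nhdsWithin_neBot.1 hz
  have hSz : ∀ᶠ y in 𝓝[S] z, y ∈ S := self_mem_nhdsWithin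
  have hreg : z ∈ D.region := by
    refine h.mem_region_of_bounded (F := 𝓝[S] z) nhdsWithin_le_nhds
      (hSz.mono fun y hy => hy.1.1) (hq.card_zeroForms_le hz') fun i hi => ?_
    rcases lt_or_eq_of_le (Fin.le_def.2 (Nat.lt_succ_iff.1 hi)) with hij | rfl
    · exact ⟨|c i|, hSz.mono fun y hy => (congrArg _ (hy.1.2.1 i hij)).le⟩
    · refine ⟨L + |c i|, hSz.mono fun y hy => ?_⟩
      have := hy.2
      rw [abs_le] at this ⊢
      constructor <;> linarith [neg_abs_le (c i), le_abs_self (c i)]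
  have hc := fun i => (continuousAt_logForm i hreg).tendsto.mono_left
    (nhdsWithin_le_nhds (s := S))
  refine ⟨⟨hreg, fun i hi => ?_, fun i hi => eval_eq_zero_of_mem_closure_curveSet hz' hi⟩, ?_⟩
  · exact tendsto_nhds_unique (hc i) (tendsto_const_nhds.congr'
      (hSz.mono fun y hy => (hy.1.2.1 i hi).symm))
  · exact le_of_tendsto (((hc j).sub_const (c j)).abs) (hSz.mono fun y hy => hy.2)

end GaleData

theorem Set.exists_finset_of_forall_card_le {E : Type*} {A : Set E} {B : ℕ}
    (h : ∀ S : Finset E, (∀ s ∈ S, s ∈ A) → S.card ≤ B) :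
    ∃ P : Finset E, P.card ≤ B ∧ ∀ s, s ∈ P ↔ s ∈ A := by
  have hfin : A.Finite := by
    by_contra hinf
    obtain ⟨t, ht, hcard⟩ := Set.Infinite.exists_subset_card_eq hinf (B + 1)
    have := h t fun s hs => ht hs
    omega
  exact ⟨hfin.toFinset, h _ fun s hs => hfin.mem_toFinset.1 hs, fun s => hfin.mem_toFinset⟩

theorem abs_sub_le_mul_abs_log_sub {x y η : ℝ} (hx : 0 < x) (hy : 0 < y) (hxη : x ≤ η)
    (hyη : y ≤ η) : |x - y| ≤ η * |Real.log x - Real.log y| := by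
  wlog hxy : y ≤ x generalizing x y
  · rw [abs_sub_comm, abs_sub_comm (Real.log x)]
    exact this hy hx hyη hxη (le_of_not_ge hxy)
  rw [abs_of_nonneg (sub_nonneg.2 hxy), abs_of_nonneg (sub_nonneg.2 (Real.log_le_log hy hxy))]
  have h1 := Real.add_one_le_exp (Real.log y - Real.log x)
  rw [Real.exp_sub, Real.exp_log hx, Real.exp_log hy, le_div_iff₀ hx] at h1
  have h2 : 0 ≤ Real.log x - Real.log y := sub_nonneg.2 (Real.log_le_log hy hxy)
  nlinarith

theorem HasStrictFDerivAt.exists_lipschitz_bound {E : Type*} [NormedAddCommGroup E]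
    [NormedSpace ℝ E] {f : E → ℝ} {f' : E →L[ℝ] ℝ} {z : E} (hf : HasStrictFDerivAt f f' z) :
    ∃ R, 0 ≤ R ∧ ∀ᶠ p in 𝓝 (z, z), |f p.1 - f p.2| ≤ R * ‖p.1 - p.2‖ := by
  obtain ⟨K, s, hs, hK⟩ := hf.exists_lipschitzOnWith
  refine ⟨K, K.2, ?_⟩
  have h2 : s ×ˢ s ∈ 𝓝 (z, z) := prod_mem_nhds hs hs
  filter_upwards [h2] with p hp
  simpa [dist_eq_norm] using hK.dist_le_mul _ hp.1 _ hp.2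

namespace GaleData

variable {ℓ M : ℕ} {D : GaleData ℓ M}

/-- The square polynomial system consisting of affine forms and polynomial equations. -/
noncomputable def faceSystem (D : GaleData ℓ M) (j : Fin ℓ) (e : Fin ℓ → Fin (M + 1))
    (q : Fin ℓ → MvPolynomial (Fin ℓ) ℝ) (i : Fin ℓ) : MvPolynomial (Fin ℓ) ℝ :=
  if j < i then q i else D.formPoly (e i)

theorem exists_face_indexing (j : Fin ℓ) {I : Finset (Fin (M + 1))} (hI : I.card = j + 1) :
    ∃ e : Fin ℓ → Fin (M + 1), (∀ i, i ≤ j → e i ∈ I) ∧ ∀ k ∈ I, ∃ i, i ≤ j ∧ e i = k := by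
  have hlt : ∀ i : Fin ℓ, i ≤ j → (i : ℕ) < I.card := fun i hi => by
    have := Fin.le_def.1 hi
    omega
  refine ⟨fun i => if hi : i ≤ j then I.equivFin.symm ⟨i, hlt i hi⟩ else 0, fun i hi => ?_,
    fun k hk => ?_⟩
  · simp [hi]
  · have h1 : (I.equivFin ⟨k, hk⟩ : ℕ) ≤ j := by
      have := (I.equivFin ⟨k, hk⟩).2
      omega
    refine ⟨⟨I.equivFin ⟨k, hk⟩, h1.trans_lt j.2⟩, Fin.le_def.2 h1, ?_⟩
    have h2 : (⟨I.equivFin ⟨k, hk⟩, h1.trans_lt j.2⟩ : Fin ℓ) ≤ j := Fin.le_def.2 h1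
    simp [h2]

section Face

variable {j : Fin ℓ} {q : Fin ℓ → MvPolynomial (Fin ℓ) ℝ} {I : Finset (Fin (M + 1))}
  {e : Fin ℓ → Fin (M + 1)} {z : Fin ℓ → ℝ}

theorem FaceRegular.eq_zero_of_polyJacobian_mulVec (hq : D.FaceRegular j q) (hI : I.card = j + 1)
    (he : ∀ k ∈ I, ∃ i, i ≤ j ∧ e i = k) (hz : ∀ k ∈ I, D.form k z = 0)
    (hqz : ∀ i, j < i → eval z (q i) = 0) {v : Fin ℓ → ℝ}
    (hv : (polyJacobian (D.faceSystem j e q) z).mulVec v = 0) : v = 0 := by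
  refine (hq I z hz (fun i hi => hqz i (Fin.lt_def.2 hi)) hI.ge).2 v (fun k hk => ?_)
    fun i hi => ?_
  · obtain ⟨i, hi, rfl⟩ := he k hk
    have := congrFun hv i
    simpa [polyJacobian, faceSystem, hi.not_gt, Matrix.mulVec, dotProduct, pderiv_formPoly]
      using this
  · have := congrFun hv i
    have hi' : j < i := Fin.lt_def.2 hi
    simpa [polyJacobian, faceSystem, hi', Matrix.mulVec, dotProduct] using this

theorem FaceRegular.exists_ends_finset (hq : D.FaceRegular j q) {d : Fin ℓ → ℕ}
    (hd : ∀ i, 1 ≤ d i) (hqd : ∀ i, j < i → (q i).totalDegree ≤ d i) :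
    ∃ P : Finset (Fin ℓ → ℝ),
      P.card ≤ (M + 1).choose (j + 1) * ∏ i, (if j < i then d i else 1) ∧
      ∀ (I : Finset (Fin (M + 1))) (z : Fin ℓ → ℝ), I.card = j + 1 → (∀ k ∈ I, D.form k z = 0) →
        (∀ i, j < i → eval z (q i) = 0) → z ∈ P := by
  classical
  have h1 : ∀ I : Finset (Fin (M + 1)), ∃ P : Finset (Fin ℓ → ℝ), I.card = j + 1 →
      P.card ≤ ∏ i, (if j < i then d i else 1) ∧
      ∀ z, z ∈ P ↔ z ∈ {z | (∀ k ∈ I, D.form k z = 0) ∧ ∀ i, j < i → eval z (q i) = 0} := by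
    intro I
    by_cases hI : I.card = j + 1
    · obtain ⟨e, heI, he⟩ := exists_face_indexing j hI
      obtain ⟨P, hP1, hP2⟩ := Set.exists_finset_of_forall_card_le
        (A := {z | (∀ k ∈ I, D.form k z = 0) ∧ ∀ i, j < i → eval z (q i) = 0})
        (B := ∏ i, (if j < i then d i else 1)) (fun S hS => by
          refine card_nondegenerate_zeros_le_prod (D.faceSystem j e q) _ (fun i => ?_)
            (fun i => ?_) S fun s hs => ⟨fun i => ?_, fun h0 => ?_⟩
          · split_ifs
            exacts [hd i, le_rfl]
          · unfold faceSystem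
            split_ifs with hi
            exacts [hqd i hi, D.totalDegree_formPoly_le _]
          · unfold faceSystem
            split_ifs with hi
            · exact (hS s hs).2 i hi
            · rw [eval_formPoly]
              exact (hS s hs).1 _ (heI i (not_lt.1 hi))
          · obtain ⟨v, hv, hv0⟩ := Matrix.exists_mulVec_eq_zero_iff.2 h0
            exact hv (hq.eq_zero_of_polyJacobian_mulVec hI he (hS s hs).1 (hS s hs).2 hv0))
      exact ⟨P, fun _ => ⟨hP1, hP2⟩⟩
    · exact ⟨∅, fun h => absurd h hI⟩
  choose P hP using h1
  refine ⟨(Finset.univ.powersetCard (j + 1)).biUnion P, ?_, fun I z hI hz hqz => ?_⟩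
  · refine (Finset.card_biUnion_le_card_mul _ _ _ fun I hI =>
      (hP I (Finset.mem_powersetCard.1 hI).2).1).trans ?_
    simp
  · exact Finset.mem_biUnion.2 ⟨I, Finset.mem_powersetCard.2 ⟨Finset.subset_univ _, hI⟩,
      ((hP I hI).2 z).2 ⟨hz, hqz⟩⟩

end Face

theorem Generic.eventually_eq_of_mem_curveSet (h : D.Generic) {j : Fin ℓ} {c : Fin ℓ → ℝ}
    {q : Fin ℓ → MvPolynomial (Fin ℓ) ℝ} (hq : D.FaceRegular j q) {z : Fin ℓ → ℝ}
    (hz : (D.zeroForms z).card = j + 1) (hqz : ∀ i, j < i → eval z (q i) = 0) :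
    ∀ᶠ p in 𝓝 (z, z), p.1 ∈ D.curveSet j c q → p.2 ∈ D.curveSet j c q →
      |D.logForm j p.1 - c j| = |D.logForm j p.2 - c j| → p.1 = p.2 := by
  classical
  obtain ⟨K, hK0, hK⟩ := h.exists_bound (h.card_zeroForms_le z)
  obtain ⟨e, heI, he⟩ := exists_face_indexing j hz
  have hsupp : ∀ y, ∀ k ∉ D.zeroForms z, D.logFace z y k = 0 := fun y k hk => by
    have : D.form k z ≠ 0 := fun h0 => hk (mem_zeroForms.2 h0)
    simp [logFace, this]
  have hform : ∀ k ∈ D.zeroForms z, D.form k z = 0 := fun k hk => mem_zeroForms.1 hk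
  have hle : ∀ i : Fin ℓ, (i : ℕ) < (D.zeroForms z).card → i ≤ j := fun i hi =>
    Fin.le_def.2 (by omega)
  have h1 : ∀ i, ∃ R, 0 ≤ R ∧ ∀ᶠ p in 𝓝 (z, z),
      |D.restForm z i p.1 - D.restForm z i p.2| ≤ R * ‖p.1 - p.2‖ := fun i =>
    (exists_hasStrictFDerivAt_restForm (D := D) z i).choose_spec.exists_lipschitz_bound
  choose R hR0 hR using h1
  obtain ⟨a, ha, hF⟩ := (hasStrictFDerivAt_polySystem (D.faceSystem j e q) z).eventually_le_norm_sub
    fun v hv => hq.eq_zero_of_polyJacobian_mulVec hz he hform hqz (by simpa using hv)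
  let Λ := ∑ i, R i
  have hΛ : 0 ≤ Λ := Finset.sum_nonneg fun i _ => hR0 i
  have hRΛ : ∀ i, R i ≤ Λ := fun i => Finset.single_le_sum (fun i _ => hR0 i) (Finset.mem_univ i)
  let η := 1 / (2 * (a * (K * Λ) + 1))
  have hη : 0 < η := by positivity
  have hfst : Tendsto (Prod.fst : (Fin ℓ → ℝ) × (Fin ℓ → ℝ) → _) (𝓝 (z, z)) (𝓝 z) :=
    continuousAt_fst
  have hsnd : Tendsto (Prod.snd : (Fin ℓ → ℝ) × (Fin ℓ → ℝ) → _) (𝓝 (z, z)) (𝓝 z) :=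
    continuousAt_snd
  have hsmall : ∀ᶠ y in 𝓝 z, ∀ k, D.form k z = 0 → D.form k y ≤ η := by
    rw [eventually_all]
    intro k
    by_cases hk : D.form k z = 0
    · have : Tendsto (D.form k) (𝓝 z) (𝓝 0) := by simpa [hk] using (D.continuous_form k).tendsto z
      filter_upwards [this.eventually (gt_mem_nhds hη)] with y hy _ using hy.le
    · exact Eventually.of_forall fun y h0 => absurd h0 hk
  -- the two points lie on the same side
  let Q := ∑ i, (2 * |c i| + 2 * |D.restForm z i z| + 2)
  have hQ : ∀ i, 2 * |c i| + 2 * |D.restForm z i z| + 2 ≤ Q := fun i =>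
    Finset.single_le_sum (f := fun i => 2 * |c i| + 2 * |D.restForm z i z| + 2)
      (fun i _ => by positivity) (Finset.mem_univ i)
  have hrest : ∀ᶠ y in 𝓝 z, ∀ i, |D.restForm z i y| ≤ |D.restForm z i z| + 1 := by
    rw [eventually_all]
    intro i
    filter_upwards [(continuousAt_restForm (D := D) z i).tendsto.abs.eventually
      (gt_mem_nhds (lt_add_one _))] with y hy using hy.le
  have hneg := eventually_logFace_lt (hform _ (heI j le_rfl)) (-(K * Q))
  filter_upwards [hF, eventually_all.2 hR, hfst.eventually hsmall, hsnd.eventually hsmall,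
    hfst.eventually hrest, hsnd.eventually hrest, hfst.eventually hneg, hsnd.eventually hneg]
    with ⟨y₁, y₂⟩ hF hR hs₁ hs₂ hr₁ hr₂ hn₁ hn₂ hy₁ hy₂ habs
  simp only at *
  have hside : D.logForm j y₁ = D.logForm j y₂ := by
    rcases abs_eq_abs.1 habs with h2 | h2
    · linarith
    exfalso
    have h3 := hK (fun k => D.logFace z y₁ k + D.logFace z y₂ k) Q ((by positivity : (0:ℝ) ≤ _).trans (hQ j))
      (fun k hk => by simp [hsupp _ k hk]) (fun i hi => by
        simp only [mul_add, Finset.sum_add_distrib, sum_logFace]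
        have h4 : D.logForm i y₁ + D.logForm i y₂ = 2 * c i := by
          rcases lt_or_eq_of_le (hle i hi) with hij | rfl
          · rw [hy₁.2.1 i hij, hy₂.2.1 i hij]; ring
          · linarith
        have h5 := hr₁ i
        have h6 := hr₂ i
        rw [abs_le] at h5 h6 ⊢
        constructor <;> linarith [hQ i, neg_abs_le (c i), le_abs_self (c i)]) (e j)
    have := neg_abs_le (D.logFace z y₁ (e j) + D.logFace z y₂ (e j))
    have h7 : 0 ≤ K * Q := mul_nonneg hK0 ((by positivity : (0:ℝ) ≤ _).trans (hQ j))
    linarith [hn₁ hy₁.1, hn₂ hy₂.1]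
  have hlog := hK (fun k => D.logFace z y₁ k - D.logFace z y₂ k) (Λ * ‖y₁ - y₂‖) (by positivity)
    (fun k hk => by simp [hsupp _ k hk]) (fun i hi => by
      simp only [mul_sub, Finset.sum_sub_distrib, sum_logFace]
      have h4 : D.logForm i y₁ = D.logForm i y₂ := by
        rcases lt_or_eq_of_le (hle i hi) with hij | rfl
        · rw [hy₁.2.1 i hij, hy₂.2.1 i hij]
        · exact hside
      rw [h4, sub_sub_sub_cancel_left, abs_sub_comm]
      exact (hR i).trans (by gcongr; exact hRΛ i))
  have hnorm : ‖(fun i => eval y₁ (D.faceSystem j e q i)) -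
      fun i => eval y₂ (D.faceSystem j e q i)‖ ≤ η * (K * (Λ * ‖y₁ - y₂‖)) := by
    refine (pi_norm_le_iff_of_nonneg (by positivity)).2 fun i => ?_
    rw [Pi.sub_apply, Real.norm_eq_abs]
    by_cases hi : j < i
    · simp only [faceSystem, hi, if_true, hy₁.2.2 i hi, hy₂.2.2 i hi, sub_zero, abs_zero]
      positivity
    · simp only [faceSystem, hi, if_false, eval_formPoly]
      have hk := hform _ (heI i (not_lt.1 hi))
      refine (abs_sub_le_mul_abs_log_sub (hy₁.1 _) (hy₂.1 _) (hs₁ _ hk) (hs₂ _ hk)).trans ?_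
      have := hlog (e i)
      simp only [logFace, hk, if_true] at this
      gcongr
  have hfin : ‖y₁ - y₂‖ ≤ 1 / 2 * ‖y₁ - y₂‖ := by
    refine (hF.trans (mul_le_mul_of_nonneg_left hnorm ha.le)).trans ?_
    have : a * (η * (K * (Λ * ‖y₁ - y₂‖))) = (a * (K * Λ)) * η * ‖y₁ - y₂‖ := by ring
    rw [this]
    gcongr
    simp only [η]
    rw [mul_one_div, div_le_div_iff₀ (by positivity) (by norm_num)]
    linarith
  have := norm_nonneg (y₁ - y₂)
  exact sub_eq_zero.1 (norm_eq_zero.1 (by linarith))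

theorem Generic.exists_ends_bound (h : D.Generic) {j : Fin ℓ} {c : Fin ℓ → ℝ}
    {q : Fin ℓ → MvPolynomial (Fin ℓ) ℝ} (hq : D.FaceRegular j q) {d : Fin ℓ → ℕ}
    (hd : ∀ i, 1 ≤ d i) (hqd : ∀ i, j < i → (q i).totalDegree ≤ d i) :
    ∃ L₀ : ℝ, ∀ L ≥ L₀, ∀ T : Finset (Fin ℓ → ℝ),
      (∀ y ∈ T, y ∈ D.curveSet j c q ∧ |D.logForm j y - c j| = L) →
      T.card ≤ (M + 1).choose (j + 1) * ∏ i, (if j < i then d i else 1) := by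
  classical
  obtain ⟨P, hP, hPmem⟩ := hq.exists_ends_finset hd hqd
  have hloc : ∀ z, ∃ V ∈ 𝓝 z, ∃ L₀ : ℝ, ∀ L ≥ L₀, ∀ y₁ ∈ V, ∀ y₂ ∈ V,
      y₁ ∈ D.curveSet j c q → y₂ ∈ D.curveSet j c q → |D.logForm j y₁ - c j| = L →
      |D.logForm j y₂ - c j| = L → y₁ = y₂ ∧ z ∈ P := by
    intro z
    by_cases hz : z ∈ closure (D.curveSet j c q)
    · have hqz : ∀ i, j < i → eval z (q i) = 0 := fun i hi =>
        eval_eq_zero_of_mem_closure_curveSet hz hi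
      rcases lt_or_eq_of_le (hq.card_zeroForms_le hz) with hlt | heq
      · have : (𝓝[D.curveSet j c q] z).NeBot := mem_closure_iff_nhdsWithin_neBot.1 hz
        have hself : ∀ᶠ y in 𝓝[D.curveSet j c q] z, y ∈ D.curveSet j c q := self_mem_nhdsWithin
        have hreg : z ∈ D.region := h.mem_region_of_bounded (F := 𝓝[D.curveSet j c q] z)
          nhdsWithin_le_nhds (hself.mono fun y hy => hy.1) (Nat.lt_succ_iff.1 hlt) fun i hi =>
            ⟨|c i|, hself.mono fun y hy => (congrArg _ (hy.2.1 i (Fin.lt_def.2 hi))).le⟩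
        have hc := ((continuousAt_logForm j hreg).sub_const (c j)).abs.eventually
          (gt_mem_nhds (lt_add_one _))
        exact ⟨_, hc, _, fun L hL y₁ hy₁ _ _ _ _ h1 _ => absurd (h1.ge.trans_lt hy₁) (not_lt.2 hL)⟩
      · have h1 := h.eventually_eq_of_mem_curveSet (c := c) hq heq hqz
        rw [nhds_prod_eq, Filter.eventually_iff, mem_prod_self_iff] at h1
        obtain ⟨V, hV, h1⟩ := h1
        exact ⟨V, hV, 0, fun L _ y₁ hy₁ y₂ hy₂ hc₁ hc₂ hL₁ hL₂ =>
          ⟨h1 (mk_mem_prod hy₁ hy₂) hc₁ hc₂ (hL₁.trans hL₂.symm),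
            hPmem _ z heq (fun k hk => mem_zeroForms.1 hk) hqz⟩⟩
    · exact ⟨_, isClosed_closure.isOpen_compl.mem_nhds hz, 0, fun L _ y₁ hy₁ _ _ hc₁ =>
        absurd (subset_closure hc₁) hy₁⟩
  choose V hV L₀ hL₀ using hloc
  obtain ⟨t, -, ht⟩ := (h.isBounded_region.isCompact_closure).elim_nhds_subcover V fun z _ => hV z
  refine ⟨∑ z ∈ t, |L₀ z|, fun L hL T hT => ?_⟩
  have hL' : ∀ z ∈ t, L ≥ L₀ z := fun z hz => (le_abs_self _).trans
    ((Finset.single_le_sum (f := fun z => |L₀ z|) (fun _ _ => abs_nonneg _) hz).trans hL)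
  have hcov : ∀ y, ∃ z, y ∈ T → z ∈ t ∧ y ∈ V z := by
    intro y
    by_cases hy : y ∈ T
    · obtain ⟨z, hz, hyz⟩ := mem_iUnion₂.1 (ht (subset_closure (hT y hy).1.1))
      exact ⟨z, fun _ => ⟨hz, hyz⟩⟩
    · exact ⟨y, fun h0 => absurd h0 hy⟩
  choose φ hφ using hcov
  refine (Finset.card_le_card_of_injOn φ (t := P) (fun y hy => ?_) fun y₁ hy₁ y₂ hy₂ h12 => ?_).trans hP
  · exact (hL₀ (φ y) L (hL' _ (hφ y hy).1) y (hφ y hy).2 y (hφ y hy).2 (hT y hy).1 (hT y hy).1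
      (hT y hy).2 (hT y hy).2).2
  · exact (hL₀ (φ y₁) L (hL' _ (hφ y₁ hy₁).1) y₁ (hφ y₁ hy₁).2 y₂ (h12 ▸ (hφ y₂ hy₂).2)
      (hT y₁ hy₁).1 (hT y₂ hy₂).1 (hT y₁ hy₁).2 (hT y₂ hy₂).2).1

end GaleData

theorem exists_contDiff_one_on_tsupport_subset {ℓ : ℕ} {K U : Set (Fin ℓ → ℝ)} (hK : IsCompact K)
    (hU : IsOpen U) (hKU : K ⊆ U) :
    ∃ χ : (Fin ℓ → ℝ) → ℝ, ContDiff ℝ 1 χ ∧ HasCompactSupport χ ∧ tsupport χ ⊆ U ∧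
      (∀ y ∈ K, χ y = 1) ∧ ∀ y, 0 ≤ χ y := by
  obtain ⟨K', hK', h1, h2⟩ := exists_compact_between hK hU hKU
  obtain ⟨f, hf1, hf0, hf⟩ := exists_contMDiffMap_one_nhds_of_subset_interior
    (modelWithCornersSelf ℝ (Fin ℓ → ℝ)) (n := 1) hK.isClosed h1
  have hsupp : tsupport f ⊆ K' := closure_minimal (fun y hy => by
    by_contra h
    exact hy (hf0 y h)) hK'.isClosed
  exact ⟨f, f.contMDiff.contDiff, hK'.of_isClosed_subset (isClosed_tsupport f) hsupp,
    hsupp.trans h2, fun y hy => hf1.self_of_nhdsSet y hy, fun y => (hf y).1⟩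

namespace GaleData

variable {ℓ M : ℕ} {D : GaleData ℓ M}

/-- The tangent vector field of the curves cut out by all equations but the one with index `j`. -/
noncomputable def tangentField (D : GaleData ℓ M) (j : Fin ℓ)
    (q : Fin ℓ → MvPolynomial (Fin ℓ) ℝ) (y : Fin ℓ → ℝ) : Fin ℓ → ℝ := fun a =>
  (∏ k, D.form k y) * (D.jac (j + 1) q y).adjugate a j

theorem contDiffOn_tangentField (j : Fin ℓ) (q : Fin ℓ → MvPolynomial (Fin ℓ) ℝ)
    {n : WithTop ℕ∞} : ContDiffOn ℝ n (D.tangentField j q) D.region := by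
  refine contDiffOn_pi.2 fun a => (contDiffOn_prod fun k _ => (D.contDiff_form k).contDiffOn).mul ?_
  simp only [Matrix.adjugate_apply]
  refine ContDiffOn.matrix_det fun i a' => ?_
  by_cases hi : i = j
  · subst hi
    simp only [Matrix.updateRow_self]
    exact contDiffOn_const
  · simp only [Matrix.updateRow_ne hi]
    exact D.contDiffOn_jac _ q i a'

theorem jac_mulVec_tangentField (j : Fin ℓ) (q : Fin ℓ → MvPolynomial (Fin ℓ) ℝ) (y : Fin ℓ → ℝ) :
    (D.jac (j + 1) q y).mulVec (D.tangentField j q y) =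
      Pi.single j (D.scaledJac (j + 1) q y) := by
  have h1 : D.tangentField j q y =
      (∏ k, D.form k y) • (D.jac (j + 1) q y).adjugate.mulVec (Pi.single j 1) := by
    ext a
    simp [tangentField]
  rw [h1, Matrix.mulVec_smul, Matrix.mulVec_mulVec, Matrix.mul_adjugate, Matrix.smul_mulVec,
    Matrix.one_mulVec, scaledJac, ← Pi.single_smul, ← Pi.single_smul]
  simp

theorem Generic.exists_curve_ends (h : D.Generic) {j : Fin ℓ} {c : Fin ℓ → ℝ}
    {q : Fin ℓ → MvPolynomial (Fin ℓ) ℝ} (hq : D.FaceRegular j q) {t L : ℝ} (ht : 0 < t)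
    (hL : 0 < L) (S : Finset (Fin ℓ → ℝ)) (hS : ∀ s ∈ S, s ∈ D.curveSet j c q ∧
      D.logForm j s = c j ∧ t < |D.scaledJac (j + 1) q s|) :
    ∃ T : Finset (Fin ℓ → ℝ), 2 * S.card ≤ T.card ∧ ∀ y ∈ T, y ∈ D.curveSet j c q ∧
      (D.scaledJac (j + 1) q y = t ∨ D.scaledJac (j + 1) q y = -t ∨
        |D.logForm j y - c j| = L) := by
  classical
  obtain ⟨χ, hχ, hχc, hχs, hχ1, hχ0⟩ := exists_contDiff_one_on_tsupport_subset
    (h.isCompact_curveSet_slab (c := c) hq L) D.isOpen_region fun y hy => hy.1.1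
  have hχout : ∀ y, y ∉ D.region → χ y = 0 := fun y hy =>
    image_eq_zero_of_notMem_tsupport fun h' => hy (hχs h')
  let X : (Fin ℓ → ℝ) → Fin ℓ → ℝ := fun y => χ y • D.tangentField j q y
  have hXts : tsupport X ⊆ tsupport χ := tsupport_smul_subset_left χ _
  have hXc : HasCompactSupport X := hχc.smul_right
  have hXd : ContDiff ℝ 1 X := by
    refine contDiff_iff_contDiffAt.2 fun y => ?_
    by_cases hy : y ∈ tsupport X
    · exact hχ.contDiffAt.smul ((contDiffOn_tangentField j q).contDiffAt
        (D.isOpen_region.mem_nhds (hχs (hXts hy))))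
    · exact contDiffAt_const.congr_of_eventuallyEq (notMem_tsupport_iff_eventuallyEq.1 hy)
  obtain ⟨K, hK⟩ := ContDiff.lipschitzWith_of_hasCompactSupport hXc hXd one_ne_zero
  obtain ⟨B, hB⟩ := hXc.exists_bound_of_continuous hXd.continuous
  have hB' : ∀ y, ‖X y‖ ≤ (⟨max B 0, le_max_right _ _⟩ : ℝ≥0) := fun y =>
    (hB y).trans (le_max_left _ _)
  have hreg : ∀ γ, IsGlobalCurve X γ → γ 0 ∈ D.region → ∀ s, γ s ∈ D.region := by
    intro γ hγ h0 s
    by_contra hs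
    refine hs ?_
    rw [← IsGlobalCurve.eq_const_of_zero hK hγ (t₀ := s) (by simp [X, hχout _ hs]) 0]
    exact h0
  have hder : ∀ γ, IsGlobalCurve X γ → γ 0 ∈ D.region → ∀ s i,
      HasDerivAt (fun u => D.sys (j + 1) c q (γ u) i)
        (χ (γ s) * (Pi.single j (D.scaledJac (j + 1) q (γ s)) : Fin ℓ → ℝ) i) s := by
    intro γ hγ h0 s i
    have h1 := ((D.hasStrictFDerivAt_sys (j + 1) c q fun k =>
      (hreg γ hγ h0 s k).ne').hasFDerivAt.comp_hasDerivAt s (hγ s))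
    have h2 := hasDerivAt_pi.1 h1 i
    refine h2.congr_deriv ?_
    rw [← jac_mulVec_tangentField]
    simp [X]
  have hsys : ∀ y ∈ D.curveSet j c q, ∀ i, i ≠ j → D.sys (j + 1) c q y i = 0 := by
    intro y hy i hi
    rcases lt_or_gt_of_ne hi with hi | hi
    · have : (i : ℕ) < j + 1 := Nat.lt_succ_of_lt hi
      simp [sys, this, hy.2.1 i hi]
    · have : ¬ (i : ℕ) < j + 1 := not_lt.2 (Nat.succ_le_of_lt hi)
      simp [sys, this, hy.2.2 i hi]
  have hsys' : ∀ y ∈ D.region, (∀ i, i ≠ j → D.sys (j + 1) c q y i = 0) →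
      y ∈ D.curveSet j c q := by
    refine fun y hy h0 => ⟨hy, fun i hi => ?_, fun i hi => ?_⟩
    · have : (i : ℕ) < j + 1 := Nat.lt_succ_of_lt hi
      have h1 := h0 i hi.ne
      simp only [sys, this, if_true] at h1
      linarith
    · have : ¬ (i : ℕ) < j + 1 := not_lt.2 (Nat.succ_le_of_lt hi)
      have h1 := h0 i hi.ne'
      simpa only [sys, this, if_false] using h1
  have hC : ∀ γ, IsGlobalCurve X γ → γ 0 ∈ D.curveSet j c q → ∀ s, γ s ∈ D.curveSet j c q := by
    intro γ hγ h0 s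
    refine hsys' _ (hreg γ hγ h0.1 s) fun i hi => ?_
    have h1 : ∀ u, HasDerivAt (fun u => D.sys (j + 1) c q (γ u) i) 0 u := fun u => by
      simpa [Pi.single_eq_of_ne hi] using hder γ hγ h0.1 u i
    rw [← hsys _ h0 i hi]
    exact is_const_of_deriv_eq_zero (fun u => (h1 u).differentiableAt) (fun u => (h1 u).deriv) s 0
  have hJ : ∀ γ, IsGlobalCurve X γ → γ 0 ∈ D.curveSet j c q →
      Continuous (D.scaledJac (j + 1) q ∘ γ) := by
    intro γ hγ h0
    exact (D.contDiffOn_scaledJac (j + 1) q (n := 0)).continuousOn.comp_continuous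
      (continuous_iff_continuousAt.2 fun s => (hγ s).continuousAt) fun s => hreg γ hγ h0.1 s
  have hg : ∀ γ, IsGlobalCurve X γ → γ 0 ∈ D.curveSet j c q → ∀ s,
      HasDerivAt ((fun y => D.logForm j y - c j) ∘ γ)
        (χ (γ s) * D.scaledJac (j + 1) q (γ s)) s := by
    intro γ hγ h0 s
    have h1 := hder γ hγ h0.1 s j
    simp only [sys, Nat.lt_succ_self, if_true, Pi.single_eq_same] at h1
    exact h1
  obtain ⟨T₁, hT₁, hT₁'⟩ := exists_arc_ends hK hB' hC ht hL hJ hg hχ0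
    (fun y hy hyL => hχ1 y ⟨hy, hyL⟩) (S.filter fun s => t < D.scaledJac (j + 1) q s) fun s hs => by
      rw [Finset.mem_filter] at hs
      exact ⟨(hS s hs.1).1, sub_eq_zero.2 (hS s hs.1).2.1, hs.2⟩
  obtain ⟨T₂, hT₂, hT₂'⟩ := exists_arc_ends hK hB' hC (g := fun y => -(D.logForm j y - c j))
    (J := fun y => -D.scaledJac (j + 1) q y) (χ := χ) ht hL
    (fun γ hγ h0 => (hJ γ hγ h0).neg)
    (fun γ hγ h0 s => by
      have h1 := (hg γ hγ h0 s).neg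
      rw [← mul_neg] at h1
      exact h1) hχ0
    (fun y hy hyL => hχ1 y ⟨hy, by rwa [abs_neg] at hyL⟩)
    (S.filter fun s => ¬ t < D.scaledJac (j + 1) q s) fun s hs => by
      rw [Finset.mem_filter] at hs
      refine ⟨(hS s hs.1).1, by simp [(hS s hs.1).2.1], ?_⟩
      rcases lt_abs.1 (hS s hs.1).2.2 with h1 | h1
      exacts [absurd h1 hs.2, h1]
  refine ⟨T₁ ∪ T₂, ?_, fun y hy => ?_⟩
  · rw [Finset.card_union_of_disjoint, ← Finset.card_filter_add_card_filter_not (s := S)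
      (fun s => t < D.scaledJac (j + 1) q s)]
    · omega
    · rw [Finset.disjoint_left]
      intro y h1 h2
      have h3 : t ≤ D.scaledJac (j + 1) q y := by
        rcases (hT₁' y h1).2 with h | h
        exacts [h.ge, h.2.le]
      have h4 : t ≤ -D.scaledJac (j + 1) q y := by
        rcases (hT₂' y h2).2 with h | h
        exacts [h.ge, h.2.le]
      linarith
  · rcases Finset.mem_union.1 hy with h1 | h1
    · refine ⟨(hT₁' y h1).1, ?_⟩
      rcases (hT₁' y h1).2 with h | h
      exacts [Or.inl h, Or.inr (Or.inr h.1)]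
    · refine ⟨(hT₂' y h1).1, ?_⟩
      rcases (hT₂' y h1).2 with h | h
      · exact Or.inr (Or.inl (by linarith))
      · exact Or.inr (Or.inr (by simpa [abs_sub_comm] using h.1))

end GaleData

namespace GaleData

variable {ℓ M : ℕ} {D : GaleData ℓ M}

/-- `B` bounds the number of nondegenerate zeros of all systems with `r` logarithmic equations and
polynomial equations of degrees at most `d`. -/
def LevelBound (D : GaleData ℓ M) (d : Fin ℓ → ℕ) (r : ℕ) (B : ℝ) : Prop :=
  ∀ (c : Fin ℓ → ℝ) (q : Fin ℓ → MvPolynomial (Fin ℓ) ℝ),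
    (∀ i : Fin ℓ, r ≤ i → (q i).totalDegree ≤ d i) → ∀ S : Finset (Fin ℓ → ℝ),
    (∀ s ∈ S, s ∈ D.region ∧ D.sys r c q s = 0 ∧ (D.jac r q s).det ≠ 0) → (S.card : ℝ) ≤ B

theorem levelBound_zero {d : Fin ℓ → ℕ} (hd : ∀ i, 1 ≤ d i) :
    D.LevelBound d 0 (∏ i, (d i : ℝ)) := by
  intro c q hq S hS
  have h1 : ∀ s, D.jac 0 q s = polyJacobian q s := fun s => by
    ext i a
    simp [jac, polyJacobian]
  have := card_nondegenerate_zeros_le_prod q d hd (fun i => hq i (Nat.zero_le _)) S fun s hs =>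
    ⟨fun i => by simpa [sys] using congrFun (hS s hs).2.1 i, h1 s ▸ (hS s hs).2.2⟩
  exact_mod_cast this

/-- Regularity of the value `τ` of the scaled Jacobian along a curve. -/
def RegularLevel (D : GaleData ℓ M) (j : Fin ℓ) (c : Fin ℓ → ℝ)
    (q : Fin ℓ → MvPolynomial (Fin ℓ) ℝ) (τ : ℝ) : Prop :=
  ∀ y ∈ D.curveSet j c q, D.scaledJac (j + 1) q y = τ → ∀ v : Fin ℓ → ℝ,
    (∀ i, i ≠ j → (D.jac (j + 1) q y).mulVec v i = 0) →
    fderiv ℝ (D.scaledJac (j + 1) q) y v = 0 → v = 0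

theorem LevelBound.card_le {j : Fin ℓ} {d : Fin ℓ → ℕ} {B : ℝ} (hB : D.LevelBound d j B)
    (h : D.Generic)
    (hdj : M - (j + 1) + ∑ i : Fin ℓ, (if (i : ℕ) < j + 1 then 0 else d i - 1) ≤ d j)
    {c : Fin ℓ → ℝ} {q : Fin ℓ → MvPolynomial (Fin ℓ) ℝ}
    (hqd : ∀ i, j < i → (q i).totalDegree ≤ d i) {τ : ℝ} (hτ : D.RegularLevel j c q τ)
    (T : Finset (Fin ℓ → ℝ)) (hT : ∀ y ∈ T, y ∈ D.curveSet j c q ∧ D.scaledJac (j + 1) q y = τ) :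
    (T.card : ℝ) ≤ B := by
  classical
  obtain ⟨P, hPd, hP⟩ := D.exists_poly_scaledJac (j + 1) j.2 d q h.sum_b
    fun i hi => hqd i (Fin.lt_def.2 hi)
  refine hB c (Function.update q j (P - C τ)) (fun i hi => ?_) T fun y hy => ?_
  · rcases eq_or_lt_of_le (Fin.le_def.2 hi) with rfl | hi
    · rw [Function.update_self]
      refine (totalDegree_sub _ _).trans (max_le (hPd.trans hdj) (by simp))
    · rw [Function.update_of_ne hi.ne']
      exact hqd i hi
  obtain ⟨hyC, hyτ⟩ := hT y hy
  have hzero : ∀ i : Fin ℓ, ¬ (i : ℕ) < j + 1 → eval y (q i) = 0 := fun i hi =>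
    hyC.2.2 i (Fin.lt_def.2 (by omega))
  have hsum : ∑ i : Fin ℓ, (if (i : ℕ) < j + 1 then 0 else d i * eval y (q i)) *
      D.extCofactor (j + 1) d q i y = 0 := by
    refine Finset.sum_eq_zero fun i _ => ?_
    by_cases hi : (i : ℕ) < j + 1
    · simp [hi]
    · simp [hi, hzero i hi]
  refine ⟨hyC.1, funext fun i => ?_, fun h0 => ?_⟩
  · rcases lt_trichotomy i j with hi | rfl | hi
    · have : (i : ℕ) < j := hi
      simp [sys, this, hyC.2.1 i hi]
    · simp only [sys, lt_irrefl, if_false, Function.update_self, map_sub, eval_C, hP y hyC.1, hsum,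
        hyτ, add_zero, sub_self, Pi.zero_apply]
    · have : ¬ (i : ℕ) < j := (Fin.lt_def.1 hi).not_gt
      simp [sys, this, Function.update_of_ne hi.ne', hyC.2.2 i hi]
  · obtain ⟨v, hv, hv0⟩ := Matrix.exists_mulVec_eq_zero_iff.2 h0
    have hne : ∀ i, i ≠ j → (D.jac (j + 1) q y).mulVec v i = 0 := by
      intro i hi
      have h1 := congrFun hv0 i
      rcases lt_or_gt_of_ne hi with hij | hij
      · have h2 : (i : ℕ) < j := hij
        have h3 : (i : ℕ) < j + 1 := Nat.lt_succ_of_lt hij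
        simpa only [Matrix.mulVec, dotProduct, jac, Matrix.of_apply, h2, h3, if_true, Pi.zero_apply] using h1
      · have h2 : ¬ (i : ℕ) < j := (Fin.lt_def.1 hij).not_gt
        have h3 : ¬ (i : ℕ) < j + 1 := not_lt.2 (Nat.succ_le_of_lt hij)
        simpa only [Matrix.mulVec, dotProduct, jac, Matrix.of_apply, h2, h3, if_false,
          Function.update_of_ne hi, Pi.zero_apply] using h1
    refine hv (hτ y hyC hyτ v hne ?_)
    have hreg : D.region ∈ 𝓝 y := D.isOpen_region.mem_nhds hyC.1
    have hdJ : HasFDerivAt (D.scaledJac (j + 1) q) (fderiv ℝ (D.scaledJac (j + 1) q) y) y :=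
      (((D.contDiffOn_scaledJac (j + 1) q (n := 1)).contDiffAt hreg).differentiableAt
        one_ne_zero).hasFDerivAt
    have hdh : ∀ i, HasFDerivAt (D.extCofactor (j + 1) d q i)
        (fderiv ℝ (D.extCofactor (j + 1) d q i) y) y := fun i =>
      (((D.contDiffOn_extCofactor (j + 1) d q i (n := 1)).contDiffAt hreg).differentiableAt
        one_ne_zero).hasFDerivAt
    have hterm : ∀ i : Fin ℓ, ∃ g' : (Fin ℓ → ℝ) →L[ℝ] ℝ, HasFDerivAt (fun x =>
        (if (i : ℕ) < j + 1 then 0 else d i * eval x (q i)) * D.extCofactor (j + 1) d q i x) g' y ∧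
        g' v = 0 := by
      intro i
      by_cases hi : (i : ℕ) < j + 1
      · simp only [hi, if_true, zero_mul]
        exact ⟨_, hasFDerivAt_const _ _, by simp⟩
      · simp only [hi, if_false]
        refine ⟨_, (((q i).hasStrictFDerivAt_eval y).hasFDerivAt.const_mul (d i : ℝ)).mul (hdh i),
          ?_⟩
        have h1 := hne i fun h1 => hi (h1 ▸ Nat.lt_succ_self _)
        simp only [Matrix.mulVec, dotProduct, jac, hi, Matrix.of_apply, if_false] at h1
        simp [hzero i hi, h1]
    choose g' hg' hg'v using hterm
    have hsum' := hdJ.add (HasFDerivAt.fun_sum (u := Finset.univ) fun i _ => hg' i)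
    have hP' := (P.hasStrictFDerivAt_eval y).hasFDerivAt.congr_of_eventuallyEq
      (f₁ := fun x => D.scaledJac (j + 1) q x + ∑ i : Fin ℓ,
        (if (i : ℕ) < j + 1 then 0 else d i * eval x (q i)) * D.extCofactor (j + 1) d q i x)
      (by filter_upwards [hreg] with x hx using (hP x hx).symm)
    have h1 := congrArg (fun f => f v) (hsum'.unique hP')
    have h2 := congrFun hv0 j
    simp only [Matrix.mulVec, dotProduct, jac, lt_self_iff_false, Matrix.of_apply, if_false,
      Function.update_self, map_sub, pderiv_C, sub_zero, Pi.zero_apply] at h2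
    simpa [hg'v, h2] using h1

theorem ae_regularLevel (j : Fin ℓ) (c : Fin ℓ → ℝ) (q : Fin ℓ → MvPolynomial (Fin ℓ) ℝ)
    (ε : ℝ) : ∀ᵐ θ : Fin ℓ → ℝ, ∀ y ∈ D.region,
      (∀ i, i ≠ j → D.sys (j + 1) c q y i = θ i) → ε * D.scaledJac (j + 1) q y = θ j →
      ∀ v : Fin ℓ → ℝ, (∀ i, i ≠ j → (D.jac (j + 1) q y).mulVec v i = 0) →
        fderiv ℝ (D.scaledJac (j + 1) q) y v = 0 → v = 0 := by
  classical
  let f : (Fin ℓ → ℝ) → Fin ℓ → ℝ := fun y i =>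
    if i = j then ε * D.scaledJac (j + 1) q y else D.sys (j + 1) c q y i
  let f' : (Fin ℓ → ℝ) → (Fin ℓ → ℝ) →L[ℝ] (Fin ℓ → ℝ) := fun y =>
    ContinuousLinearMap.pi fun i => if i = j then ε • fderiv ℝ (D.scaledJac (j + 1) q) y else
      ContinuousLinearMap.proj i ∘L
        LinearMap.toContinuousLinearMap (Matrix.toLin' (D.jac (j + 1) q y))
  have hf : ∀ y ∈ D.region, HasFDerivAt f (f' y) y := by
    intro y hy
    rw [hasFDerivAt_pi']
    intro i
    by_cases hi : i = j
    · simp only [f, hi, if_true]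
      refine ((((D.contDiffOn_scaledJac (j + 1) q (n := 1)).contDiffAt
        (D.isOpen_region.mem_nhds hy)).differentiableAt one_ne_zero).hasFDerivAt.const_mul
          ε).congr_fderiv ?_
      ext v
      simp [f']
    · simp only [f, hi, if_false]
      refine (hasFDerivAt_pi'.1
        (D.hasStrictFDerivAt_sys (j + 1) c q fun k => (hy k).ne').hasFDerivAt i).congr_fderiv ?_
      ext v
      simp [f', hi]
  filter_upwards [ae_regular_value hf] with θ hθ y hy h1 h2 v h3 h4
  refine hθ y hy (funext fun i => ?_) v (funext fun i => ?_)
  · by_cases hi : i = j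
    · simp [f, hi, h2]
    · simp [f, hi, h1 i hi]
  · by_cases hi : i = j
    · simp [f', hi, h4]
    · simpa [f', hi] using h3 i hi

theorem eventually_exists_perturbed_zeros {r : ℕ} {c : Fin ℓ → ℝ}
    {q : Fin ℓ → MvPolynomial (Fin ℓ) ℝ} (S : Finset (Fin ℓ → ℝ))
    (hS : ∀ s ∈ S, s ∈ D.region ∧ D.sys r c q s = 0 ∧ (D.jac r q s).det ≠ 0) :
    ∃ δ > 0, ∀ᶠ u in 𝓝 (0 : Fin ℓ → ℝ), ∃ S' : Finset (Fin ℓ → ℝ), S'.card = S.card ∧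
      ∀ y ∈ S', y ∈ D.region ∧ D.sys r c q y = u ∧ δ < |D.scaledJac r q y| := by
  have h1 : ∀ᶠ δ in 𝓝[>] (0 : ℝ), ∀ s ∈ S, δ < |D.scaledJac r q s| := by
    rw [Filter.eventually_all_finset]
    intro s hs
    have : 0 < |D.scaledJac r q s| :=
      abs_pos.2 ((D.scaledJac_ne_zero_iff r q (hS s hs).1).2 (hS s hs).2.2)
    exact (gt_mem_nhds this).filter_mono nhdsWithin_le_nhds
  obtain ⟨δ, hδ, hδ0⟩ := (h1.and self_mem_nhdsWithin).exists
  refine ⟨δ, hδ0, eventually_exists_finset S fun s hs O hO => ?_⟩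
  obtain ⟨hreg, hsys, hdet⟩ := hS s hs
  obtain ⟨σ, hσ, hσ'⟩ := exists_local_section
    (D.hasStrictFDerivAt_sys r c q fun k => (hreg k).ne') (by
      intro v w hvw
      have hu : IsUnit (D.jac r q s) := by
        rw [Matrix.isUnit_iff_isUnit_det]
        exact hdet.isUnit
      exact Matrix.mulVec_injective_iff_isUnit.2 hu (by simpa using hvw))
  rw [hsys] at hσ hσ'
  have hJ : ContinuousAt (D.scaledJac r q) s := (D.contDiffOn_scaledJac r q
    (n := 0)).continuousOn.continuousAt (D.isOpen_region.mem_nhds hreg)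
  filter_upwards [hσ', hσ.eventually hO, hσ.eventually (D.isOpen_region.mem_nhds hreg),
    hσ.eventually (hJ.abs.eventually (lt_mem_nhds (hδ s hs)))] with u h1 h2 h3 h4
  exact ⟨σ u, h2, h3, h1, h4⟩

theorem jac_congr {r : ℕ} {q q' : Fin ℓ → MvPolynomial (Fin ℓ) ℝ}
    (h : ∀ i a, pderiv a (q i) = pderiv a (q' i)) : D.jac r q = D.jac r q' := by
  ext y i a
  simp [jac, h]

theorem LevelBound.step {j : Fin ℓ} {d : Fin ℓ → ℕ} {B : ℝ} (hB : D.LevelBound d j B)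
    (h : D.Generic) (hd : ∀ i, 1 ≤ d i)
    (hdj : M - (j + 1) + ∑ i : Fin ℓ, (if (i : ℕ) < j + 1 then 0 else d i - 1) ≤ d j) :
    D.LevelBound d (j + 1) (B + 1 / 2 * ((M + 1).choose (j + 1) *
      ∏ i, (if j < i then d i else 1) : ℕ)) := by
  classical
  intro c q hqd S hS
  obtain ⟨δ, hδ, hpert⟩ := eventually_exists_perturbed_zeros S hS
  have hupd : Tendsto (fun θ : Fin ℓ → ℝ => Function.update θ j 0) (𝓝 0) (𝓝 0) := by
    have h1 : Continuous fun θ : Fin ℓ → ℝ => Function.update θ j 0 :=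
      continuous_id.update j continuous_const
    have h2 := h1.tendsto 0
    rwa [show Function.update (0 : Fin ℓ → ℝ) j 0 = 0 from Function.update_eq_self j 0] at h2
  obtain ⟨W, hW, hWo, hW0⟩ := eventually_nhds_iff.1 (hupd.eventually hpert)
  have hO : IsOpen (W ∩ {θ | 0 < θ j ∧ θ j < δ}) :=
    hWo.inter ((isOpen_lt continuous_const (continuous_apply j)).inter
      (isOpen_lt (continuous_apply j) continuous_const))
  have hne : (W ∩ {θ | 0 < θ j ∧ θ j < δ}).Nonempty := by
    have h1 : Tendsto (fun τ : ℝ => (Pi.single j τ : Fin ℓ → ℝ)) (𝓝 0) (𝓝 0) := by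
      have := (continuous_single (A := fun _ : Fin ℓ => ℝ) j).tendsto 0
      rwa [Pi.single_zero] at this
    have h2 := ((h1.eventually (hWo.mem_nhds hW0)).and (gt_mem_nhds hδ)).filter_mono
      (nhdsWithin_le_nhds (s := Ioi (0 : ℝ)))
    obtain ⟨τ, ⟨h3, h4⟩, h5⟩ := (h2.and self_mem_nhdsWithin).exists
    exact ⟨_, h3, by simpa using h5, by simpa using h4⟩
  have hae := (h.ae_faceRegular j.2 q).and
    ((ae_regularLevel (D := D) j c q 1).and
      (ae_regularLevel (D := D) j c q (-1)))
  obtain ⟨θ, ⟨hθW, hθ0, hθδ⟩, hface, hreg₁, hreg₂⟩ :=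
    (MeasureTheory.Measure.dense_of_ae hae).inter_open_nonempty _ hO hne
  obtain ⟨S', hcard, hS'⟩ := hW θ hθW
  set q' : Fin ℓ → MvPolynomial (Fin ℓ) ℝ := fun i => q i - C (θ i) with hq'
  let c' : Fin ℓ → ℝ := fun i => c i + Function.update θ j 0 i
  have hc'j : c' j = c j := by simp [c']
  have hjac : D.jac (j + 1) q' = D.jac (j + 1) q := jac_congr fun i a => by simp [hq']
  have hscaled : D.scaledJac (j + 1) q' = D.scaledJac (j + 1) q := by
    ext y
    rw [scaledJac, scaledJac, hjac]
  have hqd' : ∀ i, j < i → (q' i).totalDegree ≤ d i := fun i hi =>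
    (totalDegree_sub _ _).trans (max_le (hqd i (Nat.succ_le_of_lt hi)) (by simp))
  have hcurve : ∀ y, y ∈ D.curveSet j c' q' ↔
      y ∈ D.region ∧ ∀ i, i ≠ j → D.sys (j + 1) c q y i = θ i := by
    intro y
    refine ⟨fun hy => ⟨hy.1, fun i hi => ?_⟩, fun hy => ⟨hy.1, fun i hi => ?_, fun i hi => ?_⟩⟩
    · rcases lt_or_gt_of_ne hi with hij | hij
      · have h1 : (i : ℕ) < j + 1 := Nat.lt_succ_of_lt hij
        have := hy.2.1 i hij
        simp only [c', Function.update_of_ne hi] at this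
        simp [sys, h1, this]
      · have h1 : ¬ (i : ℕ) < j + 1 := not_lt.2 (Nat.succ_le_of_lt hij)
        have := hy.2.2 i hij
        simp only [hq', map_sub, eval_C] at this
        simp only [sys, h1, if_false]
        linarith
    · have h1 : (i : ℕ) < j + 1 := Nat.lt_succ_of_lt hi
      have := hy.2 i hi.ne
      simp only [sys, h1, if_true] at this
      simp only [c', Function.update_of_ne hi.ne]
      linarith
    · have h1 : ¬ (i : ℕ) < j + 1 := not_lt.2 (Nat.succ_le_of_lt hi)
      have := hy.2 i hi.ne'
      simp only [sys, h1, if_false] at this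
      simp [hq', this]
  have hR₁ : D.RegularLevel j c' q' (θ j) := by
    intro y hy hJ v hv hv'
    rw [hscaled] at hJ hv'
    rw [hjac] at hv
    exact hreg₁ y hy.1 ((hcurve y).1 hy).2 (by rw [hJ, one_mul]) v hv hv'
  have hR₂ : D.RegularLevel j c' q' (-θ j) := by
    intro y hy hJ v hv hv'
    rw [hscaled] at hJ hv'
    rw [hjac] at hv
    exact hreg₂ y hy.1 ((hcurve y).1 hy).2 (by rw [hJ]; ring) v hv hv'
  obtain ⟨L₀, hL₀⟩ := h.exists_ends_bound (c := c') hface hd hqd'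
  obtain ⟨T, hT, hT'⟩ := h.exists_curve_ends (c := c') hface hθ0
    (lt_max_of_lt_right one_pos : 0 < max L₀ 1) S' fun s hs => by
      obtain ⟨h1, h2, h3⟩ := hS' s hs
      refine ⟨(hcurve s).2 ⟨h1, fun i hi => ?_⟩, ?_, ?_⟩
      · rw [h2, Function.update_of_ne hi]
      · have := congrFun h2 j
        simp only [sys, Nat.lt_succ_self, if_true, Function.update_self] at this
        rw [hc'j]
        linarith
      · rw [hscaled]
        exact hθδ.trans h3
  let T₁ := T.filter fun y => D.scaledJac (j + 1) q' y = θ j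
  let T₂ := T.filter fun y => D.scaledJac (j + 1) q' y = -θ j
  let T₃ := T.filter fun y => |D.logForm j y - c' j| = max L₀ 1
  have hsub : T ⊆ T₁ ∪ (T₂ ∪ T₃) := fun y hy => by
    rcases (hT' y hy).2 with h1 | h1 | h1 <;> simp [T₁, T₂, T₃, hy, h1]
  have h0 : T.card ≤ T₁.card + (T₂.card + T₃.card) := (Finset.card_le_card hsub).trans
    ((Finset.card_union_le _ _).trans (Nat.add_le_add_left (Finset.card_union_le _ _) _))
  have h1 : (T₁.card : ℝ) ≤ B := hB.card_le h hdj hqd' hR₁ T₁ fun y hy =>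
    ⟨(hT' y (Finset.mem_filter.1 hy).1).1, (Finset.mem_filter.1 hy).2⟩
  have h2 : (T₂.card : ℝ) ≤ B := hB.card_le h hdj hqd' hR₂ T₂ fun y hy =>
    ⟨(hT' y (Finset.mem_filter.1 hy).1).1, (Finset.mem_filter.1 hy).2⟩
  have h3 : T₃.card ≤ _ := hL₀ _ (le_max_left _ _) T₃ fun y hy =>
    ⟨(hT' y (Finset.mem_filter.1 hy).1).1, (Finset.mem_filter.1 hy).2⟩
  have h4 : (2 * S.card : ℝ) ≤ T₁.card + (T₂.card + T₃.card) := by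
    rw [← hcard]
    exact_mod_cast hT.trans h0
  have h5 : (T₃.card : ℝ) ≤ _ := Nat.cast_le.2 h3
  linarith

theorem Generic.levelBound (h : D.Generic) {d : Fin ℓ → ℕ} (hd : ∀ i, 1 ≤ d i)
    (hdj : ∀ j : Fin ℓ,
      M - (j + 1) + ∑ i : Fin ℓ, (if (i : ℕ) < j + 1 then 0 else d i - 1) ≤ d j)
    (r : ℕ) (hr : r ≤ ℓ) :
    D.LevelBound d r (∏ i, (d i : ℝ) + 1 / 2 * ∑ j : Fin ℓ, if (j : ℕ) < r then
      (((M + 1).choose (j + 1) * ∏ i, (if j < i then d i else 1) : ℕ) : ℝ) else 0) := by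
  induction r with
  | zero => simpa using levelBound_zero hd
  | succ r ih =>
    have h1 := (ih (Nat.le_of_succ_le hr) : D.LevelBound d (⟨r, hr⟩ : Fin ℓ) _).step h hd (hdj ⟨r, hr⟩)
    convert h1 using 1
    rw [add_assoc, ← mul_add]
    congr 2
    rw [← Finset.sum_erase_add _ _ (Finset.mem_univ (⟨r, hr⟩ : Fin ℓ)),
      ← Finset.sum_erase_add (a := (⟨r, hr⟩ : Fin ℓ)) _ (fun j : Fin ℓ => if (j : ℕ) < r then _ else _)
        (Finset.mem_univ _)]
    simp only [lt_irrefl, Nat.lt_succ_self, if_true, if_false, add_zero]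
    congr 1
    refine Finset.sum_congr rfl fun j hj => ?_
    have h2 : (j : ℕ) ≠ r := fun h2 => (Finset.mem_erase.1 hj).1 (Fin.ext h2)
    have h3 : (j : ℕ) < r + 1 ↔ (j : ℕ) < r := by omega
    simp only [h3]

end GaleData

theorem Matrix.eventually_det_add_smul_ne_zero {m : Type*} [Fintype m] [DecidableEq m]
    (A B : Matrix m m ℝ) (hB : B.det ≠ 0) : ∀ᶠ s in 𝓝[≠] (0 : ℝ), (A + s • B).det ≠ 0 := by
  let p : Polynomial ℝ := ((Polynomial.X : Polynomial ℝ) • B.map Polynomial.C +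
    A.map Polynomial.C).det
  have hp : p ≠ 0 := fun h => hB (by
    rw [← Polynomial.coeff_det_X_add_C_card B A]
    change p.coeff _ = 0
    rw [h, Polynomial.coeff_zero])
  have hev : ∀ s, p.eval s = (A + s • B).det := by
    intro s
    rw [show p.eval s = Polynomial.evalRingHom s p from rfl, RingHom.map_det]
    congr 1
    ext i j
    simp
    ring
  have h1 : ∀ᶠ s in 𝓝[≠] (0 : ℝ), s ∉ (p.roots.toFinset : Set ℝ) \ {0} := by
    have h2 : ((p.roots.toFinset : Set ℝ) \ {0})ᶜ ∈ 𝓝 (0 : ℝ) :=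
      ((p.roots.toFinset.finite_toSet.subset sdiff_subset).isClosed.isOpen_compl).mem_nhds
        (by simp)
    exact mem_nhdsWithin_of_mem_nhds h2
  filter_upwards [h1, self_mem_nhdsWithin] with s hs hs0 h
  refine hs ⟨?_, hs0⟩
  simp [hp, Polynomial.IsRoot, hev, h]

/-- Signed binomial coefficients times a power: a row that is orthogonal to all polynomials
of small degree. -/
noncomputable def momentRow (M i : ℕ) (k : Fin (M + 1)) : ℝ :=
  (-1) ^ (M - k : ℕ) * M.choose k * (k : ℝ) ^ i

theorem sum_momentRow {M i : ℕ} (h : i < M) : ∑ k, momentRow M i k = 0 := by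
  have h1 := congrFun (fwdDiff_iter_pow_eq_zero_of_lt (R := ℝ) h) 0
  rw [fwdDiff_iter_eq_sum_shift, Finset.sum_range] at h1
  simpa [momentRow] using h1

theorem eventually_perturbed_rows_independent {L M : ℕ} (R : Fin L → Fin (M + 1) → ℝ) :
    ∀ᶠ s in 𝓝[≠] (0 : ℝ), ∀ I : Finset (Fin (M + 1)), I.card ≤ L → ∀ v : Fin (M + 1) → ℝ,
      (∀ k ∉ I, v k = 0) →
      (∀ i : Fin L, (i : ℕ) < I.card → ∑ k, (R i k + s * momentRow M i k) * v k = 0) → v = 0 := by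
  rw [eventually_all]
  intro I
  by_cases hI : I.card ≤ L
  swap
  · exact Eventually.of_forall fun s h => absurd h hI
  let e : Fin I.card ≃ I := I.equivFin.symm
  let A : Matrix (Fin I.card) (Fin I.card) ℝ := Matrix.of fun i j => R (Fin.castLE hI i) (e j)
  let B : Matrix (Fin I.card) (Fin I.card) ℝ := Matrix.of fun i j => momentRow M i (e j)
  have hB : B.det ≠ 0 := by
    intro h0
    obtain ⟨v, hv, hv0⟩ := Matrix.exists_mulVec_eq_zero_iff.2 h0
    refine hv (funext fun j => ?_)
    have h1 := Matrix.eq_zero_of_forall_pow_sum_mul_pow_eq_zero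
      (f := fun j => (((e j : Fin (M + 1)) : ℕ) : ℝ))
      (v := fun j => (-1) ^ (M - (e j : Fin (M + 1)) : ℕ) * M.choose (e j : Fin (M + 1)) * v j)
      (fun i j hij => e.injective (Subtype.ext (Fin.ext (Nat.cast_injective hij))))
      (fun i => by
        refine Eq.trans ?_ (congrFun hv0 i)
        simp only [Matrix.mulVec, dotProduct, B, Matrix.of_apply, momentRow]
        exact Finset.sum_congr rfl fun j _ => by ring)
    have h2 := congrFun h1 j
    have h3 : (M.choose (e j : Fin (M + 1)) : ℝ) ≠ 0 :=
      Nat.cast_ne_zero.2 (Nat.choose_pos (Nat.lt_succ_iff.1 (Fin.is_lt _))).ne'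
    simpa [h3] using h2
  filter_upwards [Matrix.eventually_det_add_smul_ne_zero A B hB] with s hs _ v hvI hv
  have h1 : (A + s • B).mulVec (fun j => v (e j)) = 0 := by
    funext i
    rw [Pi.zero_apply, ← hv (Fin.castLE hI i) i.2]
    simp only [Matrix.mulVec, dotProduct, A, B, Matrix.add_apply, Matrix.smul_apply,
      Matrix.of_apply, smul_eq_mul, Fin.val_castLE]
    rw [e.sum_comp (fun k : I => (R (Fin.castLE hI i) k + s * momentRow M i k) * v k),
      Finset.sum_coe_sort I (fun k => (R (Fin.castLE hI i) k + s * momentRow M i k) * v k)]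
    exact Finset.sum_subset (Finset.subset_univ _) fun k _ hk => by rw [hvI k hk, mul_zero]
  have h2 := Matrix.eq_zero_of_mulVec_eq_zero hs h1
  funext k
  by_cases hk : k ∈ I
  · simpa using congrFun h2 (e.symm ⟨k, hk⟩)
  · exact hvI k hk

namespace GaleData

variable {ℓ M : ℕ} (D : GaleData ℓ M)

/-- A one-parameter family of Gale data whose general member is generic. -/
noncomputable def perturb (s : ℝ) : GaleData ℓ M where
  α k := D.α k + s * momentRow M 0 k
  β k a := D.β k a + s * momentRow M (a + 1) k
  b i k := D.b i k + s * momentRow M i k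

theorem eventually_perturb_generic (hM : ℓ < M) (hb : ∀ i, ∑ k, D.b i k = 0)
    (hα : ∑ k, D.α k = 1) (hβ : ∀ a, ∑ k, D.β k a = 0) :
    ∀ᶠ s in 𝓝[≠] (0 : ℝ), (D.perturb s).Generic := by
  filter_upwards [eventually_perturbed_rows_independent D.b,
    eventually_perturbed_rows_independent
      (Fin.cons D.α fun a k => D.β k a : Fin (ℓ + 1) → Fin (M + 1) → ℝ)] with s hs₁ hs₂
  refine ⟨hM.le, fun i => ?_, fun y => ?_, hs₁, fun I hI v hvI h0 h1 => hs₂ I hI v hvI ?_⟩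
  · simp only [perturb, Finset.sum_add_distrib, hb, ← Finset.mul_sum,
      sum_momentRow (i.2.trans hM), mul_zero, add_zero]
  · simp only [form, perturb, Finset.sum_add_distrib, hα, ← Finset.mul_sum,
      sum_momentRow ((Nat.zero_le _).trans_lt hM), mul_zero, add_zero]
    rw [Finset.sum_comm]
    simp only [← Finset.sum_mul, Finset.sum_add_distrib, hβ, ← Finset.mul_sum,
      sum_momentRow (lt_of_le_of_lt (Nat.succ_le_of_lt (Fin.is_lt _)) hM), mul_zero, add_zero,
      zero_mul, Finset.sum_const_zero]
  · intro i _
    refine Fin.cases ?_ (fun a => ?_) i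
    · rw [← h0]
      exact Finset.sum_congr rfl fun k _ => by simp [perturb, mul_comm]
    · rw [← h1 a]
      exact Finset.sum_congr rfl fun k _ => by simp [perturb, mul_comm]

end GaleData

namespace GaleData

variable {ℓ M : ℕ} (D : GaleData ℓ M)

theorem perturb_zero : D.perturb 0 = D := by
  simp [perturb]

theorem contDiff_form_perturb (k : Fin (M + 1)) {n : WithTop ℕ∞} :
    ContDiff ℝ n fun p : ℝ × (Fin ℓ → ℝ) => (D.perturb p.1).form k p.2 := by
  simp only [form, perturb]
  fun_prop

theorem contDiffAt_logForm_perturb (i : Fin ℓ) {n : WithTop ℕ∞} {y : Fin ℓ → ℝ}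
    (hy : y ∈ D.region) :
    ContDiffAt ℝ n (fun p : ℝ × (Fin ℓ → ℝ) => (D.perturb p.1).logForm i p.2) (0, y) := by
  unfold logForm
  refine ContDiffAt.sum fun k _ => ContDiffAt.mul ?_
    ((D.contDiff_form_perturb k).contDiffAt.log ?_)
  · simp only [perturb]
    fun_prop
  · simpa only [perturb_zero] using (hy k).ne'

theorem continuousAt_det_jac_perturb (q : Fin ℓ → MvPolynomial (Fin ℓ) ℝ) {y : Fin ℓ → ℝ}
    (hy : y ∈ D.region) :
    ContinuousAt (fun p : ℝ × (Fin ℓ → ℝ) => ((D.perturb p.1).jac ℓ q p.2).det) (0, y) := by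
  refine Continuous.continuousAt continuous_id.matrix_det |>.comp ?_
  refine continuousAt_pi.2 fun i => continuousAt_pi.2 fun a => ?_
  simp only [Matrix.of_apply, i.2, if_true]
  refine tendsto_finsetSum _ fun k _ => ?_
  refine ContinuousAt.mul ?_ (ContinuousAt.div ?_
    (D.contDiff_form_perturb k (n := 0)).continuous.continuousAt ?_)
  · simp only [perturb]
    fun_prop
  · simp only [perturb]
    fun_prop
  · simpa only [perturb_zero] using (hy k).ne'

theorem eventually_exists_zero_perturb (q : Fin ℓ → MvPolynomial (Fin ℓ) ℝ) {y₀ : Fin ℓ → ℝ}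
    (hy₀ : y₀ ∈ D.region) (h0 : D.sys ℓ 0 q y₀ = 0) (hdet : (D.jac ℓ q y₀).det ≠ 0)
    {O : Set (Fin ℓ → ℝ)} (hO : O ∈ 𝓝 y₀) : ∀ᶠ s in 𝓝 (0 : ℝ), ∃ y ∈ O,
      y ∈ (D.perturb s).region ∧ (D.perturb s).sys ℓ 0 q y = 0 ∧
        ((D.perturb s).jac ℓ q y).det ≠ 0 := by
  let G : ℝ × (Fin ℓ → ℝ) → Fin ℓ → ℝ := fun p => (D.perturb p.1).sys ℓ 0 q p.2
  have hG : ContDiffAt ℝ 1 G (0, y₀) := by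
    refine contDiffAt_pi.2 fun i => ?_
    simp only [G, sys, i.2, if_true, Pi.zero_apply, sub_zero]
    exact D.contDiffAt_logForm_perturb i hy₀
  have hG' := hG.hasStrictFDerivAt one_ne_zero
  set G' := fderiv ℝ G (0, y₀)
  have hpart : G' ∘L ContinuousLinearMap.inr ℝ ℝ (Fin ℓ → ℝ) =
      LinearMap.toContinuousLinearMap (Matrix.toLin' (D.jac ℓ q y₀)) := by
    have h1 : HasFDerivAt (fun y => G (0, y)) (G' ∘L ContinuousLinearMap.inr ℝ ℝ (Fin ℓ → ℝ)) y₀ :=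
      hG'.hasFDerivAt.comp y₀ (hasFDerivAt_prodMk_right 0 y₀)
    have h2 := (D.hasStrictFDerivAt_sys ℓ 0 q fun k => (hy₀ k).ne').hasFDerivAt
    simp only [G, perturb_zero] at h1
    exact h1.unique h2
  have hF := (hasStrictFDerivAt_fst (𝕜 := ℝ) (p := ((0 : ℝ), y₀))).prodMk hG'
  have hsurj : ((ContinuousLinearMap.fst ℝ ℝ (Fin ℓ → ℝ)).prod G').range = ⊤ := by
    refine LinearMap.range_eq_top.2 fun ⟨s, u⟩ => ?_
    have h1 : IsUnit (D.jac ℓ q y₀) := (Matrix.isUnit_iff_isUnit_det _).2 hdet.isUnit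
    obtain ⟨v, hv⟩ := (Matrix.mulVec_surjective_iff_isUnit.2 h1) (u - G' (s, 0))
    refine ⟨(s, v), Prod.ext rfl ?_⟩
    have h2 : G' (0, v) = (D.jac ℓ q y₀).mulVec v := congrArg (fun f => f v) hpart
    have h3 : (s, v) = (s, (0 : Fin ℓ → ℝ)) + (0, v) := by simp
    change G' (s, v) = u
    rw [h3, map_add, h2, hv]
    abel
  have hmap := hF.map_nhds_eq_of_surj hsurj
  have hG0 : G (0, y₀) = 0 := by simp only [G, perturb_zero, h0]
  have hN : {p : ℝ × (Fin ℓ → ℝ) | p.2 ∈ O ∧ p.2 ∈ (D.perturb p.1).region ∧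
      ((D.perturb p.1).jac ℓ q p.2).det ≠ 0} ∈ 𝓝 ((0 : ℝ), y₀) := by
    refine inter_mem (continuous_snd.continuousAt.preimage_mem_nhds hO) (inter_mem ?_ ?_)
    · refine eventually_all.2 fun k => ?_
      refine (D.contDiff_form_perturb k (n := 0)).continuous.continuousAt.eventually
        (lt_mem_nhds ?_)
      simpa only [perturb_zero] using hy₀ k
    · refine (D.continuousAt_det_jac_perturb q hy₀).eventually_ne ?_
      simpa only [perturb_zero] using hdet
  have himg := image_mem_map (m := fun p : ℝ × (Fin ℓ → ℝ) => (p.1, G p)) hN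
  rw [hmap] at himg
  have hc : ContinuousAt (fun s : ℝ => (s, (0 : Fin ℓ → ℝ))) 0 := by fun_prop
  have := hc.preimage_mem_nhds (by simpa only [hG0] using himg)
  filter_upwards [this] with s hs
  obtain ⟨⟨s', y⟩, ⟨h1, h2, h3⟩, h4⟩ := hs
  obtain ⟨rfl, h5⟩ := Prod.mk.inj h4
  exact ⟨y, h1, h2, h5, h3⟩

theorem card_zeros_le (hM : ℓ < M) (hb : ∀ i, ∑ k, D.b i k = 0)
    (hα : ∑ k, D.α k = 1) (hβ : ∀ a, ∑ k, D.β k a = 0) {d : Fin ℓ → ℕ} (hd : ∀ i, 1 ≤ d i)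
    (hdj : ∀ j : Fin ℓ,
      M - (j + 1) + ∑ i : Fin ℓ, (if (i : ℕ) < j + 1 then 0 else d i - 1) ≤ d j)
    (q : Fin ℓ → MvPolynomial (Fin ℓ) ℝ) (S : Finset (Fin ℓ → ℝ))
    (hS : ∀ y ∈ S, y ∈ D.region ∧ D.sys ℓ 0 q y = 0 ∧ (D.jac ℓ q y).det ≠ 0) :
    (S.card : ℝ) ≤ ∏ i, (d i : ℝ) + 1 / 2 * ∑ j : Fin ℓ,
      (((M + 1).choose (j + 1) * ∏ i, (if j < i then d i else 1) : ℕ) : ℝ) := by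
  have h1 := eventually_exists_finset (l := 𝓝[≠] (0 : ℝ)) S fun y hy O hO =>
    (D.eventually_exists_zero_perturb q (hS y hy).1 (hS y hy).2.1 (hS y hy).2.2 hO).filter_mono
      nhdsWithin_le_nhds
  obtain ⟨s, ⟨S', hcard, hS'⟩, hs⟩ :=
    (h1.and (D.eventually_perturb_generic hM hb hα hβ)).exists
  have h2 := hs.levelBound hd hdj ℓ le_rfl 0 q (fun i hi => absurd i.2 hi.not_gt) S' hS'
  simpa only [hcard, Fin.is_lt, if_true] using h2

end GaleData

/-- The monomials with real exponents `E`, in logarithmic coordinates. -/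
noncomputable def expMonomial {n N : ℕ} (E : Fin N → Fin n → ℝ) (t : Fin n → ℝ) (k : Fin N) : ℝ :=
  Real.exp (∑ j, E k j * t j)

/-- `t` is a nondegenerate zero of the system with exponents `E` and coefficients `c`, in
logarithmic coordinates. -/
def IsNondegenerateZero {n N : ℕ} (E : Fin N → Fin n → ℝ) (c : Fin n → Fin N → ℝ)
    (t : Fin n → ℝ) : Prop :=
  (∀ i, ∑ k, c i k * expMonomial E t k = 0) ∧ ∀ η : Fin n → ℝ,
    (∀ i, ∑ k, c i k * (expMonomial E t k * ∑ j, E k j * η j) = 0) → η = 0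

section

variable {n N : ℕ} {E : Fin N → Fin n → ℝ} {c : Fin n → Fin N → ℝ} {t : Fin n → ℝ}

theorem expMonomial_pos (E : Fin N → Fin n → ℝ) (t : Fin n → ℝ) (k : Fin N) :
    0 < expMonomial E t k := Real.exp_pos _

theorem IsNondegenerateZero.eq_zero_of_add (h : IsNondegenerateZero E c t) {η : Fin n → ℝ} {τ : ℝ}
    (hη : ∀ i, ∑ k, c i k * (expMonomial E t k * (∑ j, E k j * η j + τ)) = 0) : η = 0 := by
  refine h.2 η fun i => ?_
  have h1 : ∑ k, c i k * (expMonomial E t k * (∑ j, E k j * η j + τ)) =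
      ∑ k, c i k * (expMonomial E t k * ∑ j, E k j * η j) +
        (∑ k, c i k * expMonomial E t k) * τ := by
    rw [Finset.sum_mul, ← Finset.sum_add_distrib]
    exact Finset.sum_congr rfl fun k _ => by ring
  rw [← hη i, h1, h.1 i, zero_mul, add_zero]

/-- Affine functions of the exponents. -/
def affineExponents (E : Fin N → Fin n → ℝ) : (Fin n → ℝ) × ℝ →ₗ[ℝ] (Fin N → ℝ) where
  toFun p k := ∑ j, E k j * p.1 j + p.2
  map_add' p q := by
    funext k
    simp only [Prod.fst_add, Prod.snd_add, Pi.add_apply, mul_add, Finset.sum_add_distrib]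
    ring
  map_smul' r p := by
    funext k
    simp only [Prod.smul_fst, Prod.smul_snd, Pi.smul_apply, smul_eq_mul, RingHom.id_apply, mul_add,
      Finset.mul_sum]
    congr 1
    exact Finset.sum_congr rfl fun j _ => by ring

theorem IsNondegenerateZero.affineExponents_injective [NeZero N] (h : IsNondegenerateZero E c t) :
    Function.Injective (affineExponents E) := by
  refine (injective_iff_map_eq_zero _).2 fun ⟨η, τ⟩ hp => ?_
  have hk : ∀ k, ∑ j, E k j * η j + τ = 0 := fun k => congrFun hp k
  have hη : η = 0 := h.eq_zero_of_add (τ := τ) fun i => by simp [hk]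
  have := hk 0
  simp only [hη, Pi.zero_apply, mul_zero, Finset.sum_const_zero, zero_add] at this
  rw [hη, this]
  rfl

/-- The linear system together with the sum of the coordinates. -/
def linearSystem (c : Fin n → Fin N → ℝ) : (Fin N → ℝ) →ₗ[ℝ] (Fin n → ℝ) × ℝ where
  toFun w := (fun i => ∑ k, c i k * w k, ∑ k, w k)
  map_add' v w := by
    ext <;> simp [mul_add, Finset.sum_add_distrib]
  map_smul' r v := by
    ext <;> simp [Finset.mul_sum, mul_left_comm]

theorem IsNondegenerateZero.linearSystem_surjective [NeZero N] (h : IsNondegenerateZero E c t) :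
    Function.Surjective (linearSystem c) := by
  let f : (Fin n → ℝ) →ₗ[ℝ] (Fin n → ℝ) :=
    { toFun := fun η i => ∑ k, c i k * (expMonomial E t k * ∑ j, E k j * η j)
      map_add' := fun v w => by
        ext; simp [mul_add, Finset.sum_add_distrib]
      map_smul' := fun r v => by
        ext; simp [Finset.mul_sum, mul_left_comm] }
  have hf : Function.Surjective f := LinearMap.surjective_of_injective
    ((injective_iff_map_eq_zero f).2 fun η hη => h.2 η fun i => congrFun hη i)
  rintro ⟨u, τ⟩
  obtain ⟨η, hη⟩ := hf u
  have hσ : ∑ k, expMonomial E t k ≠ 0 :=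
    (Finset.sum_pos (fun k _ => expMonomial_pos E t k) Finset.univ_nonempty).ne'
  set w : Fin N → ℝ := fun k => expMonomial E t k * ∑ j, E k j * η j
  set r := (τ - ∑ k, w k) / ∑ k, expMonomial E t k with hr
  refine ⟨w + r • expMonomial E t, ?_⟩
  rw [map_add, map_smul]
  have h1 : linearSystem c (expMonomial E t) = (0, ∑ k, expMonomial E t k) :=
    Prod.ext (funext h.1) rfl
  have h2 : linearSystem c w = (u, ∑ k, w k) := Prod.ext hη rfl
  rw [h1, h2, hr]
  ext
  · simp
  · simp [hσ]

end

theorem Submodule.exists_matrix_mulVec_eq_zero_iff {m N : ℕ} (K : Submodule ℝ (Fin N → ℝ))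
    (hK : Module.finrank ℝ K + m = N) :
    ∃ b : Matrix (Fin m) (Fin N) ℝ, ∀ w, b.mulVec w = 0 ↔ w ∈ K := by
  have h1 : Module.finrank ℝ ((Fin N → ℝ) ⧸ K) = m := by
    have := K.finrank_quotient_add_finrank
    rw [Module.finrank_fin_fun] at this
    omega
  let e : ((Fin N → ℝ) ⧸ K) ≃ₗ[ℝ] (Fin m → ℝ) := LinearEquiv.ofFinrankEq _ _ (by simp [h1])
  refine ⟨LinearMap.toMatrix' (e.toLinearMap ∘ₗ K.mkQ), fun w => ?_⟩
  rw [LinearMap.toMatrix'_mulVec]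
  simp

theorem Submodule.exists_matrix_mulVec_range {m N : ℕ} (K : Submodule ℝ (Fin N → ℝ))
    (hK : Module.finrank ℝ K = m) :
    ∃ β : Matrix (Fin N) (Fin m) ℝ, (∀ w, w ∈ K ↔ ∃ y, β.mulVec y = w) ∧
      ∀ y, β.mulVec y = 0 → y = 0 := by
  let e : (Fin m → ℝ) ≃ₗ[ℝ] K := LinearEquiv.ofFinrankEq _ _ (by simp [hK])
  refine ⟨LinearMap.toMatrix' (K.subtype ∘ₗ e.toLinearMap), fun w => ⟨fun hw => ⟨e.symm ⟨w, hw⟩, ?_⟩,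
    ?_⟩, fun y hy => ?_⟩
  · simp [LinearMap.toMatrix'_mulVec]
  · rintro ⟨y, rfl⟩
    simp [LinearMap.toMatrix'_mulVec]
  · simpa [LinearMap.toMatrix'_mulVec] using hy

theorem IsNondegenerateZero.exists_galeData {n ℓ : ℕ} {E : Fin (n + ℓ + 1) → Fin n → ℝ}
    {c : Fin n → Fin (n + ℓ + 1) → ℝ} {t₀ : Fin n → ℝ} (h₀ : IsNondegenerateZero E c t₀) :
    ∃ (D : GaleData ℓ (n + ℓ)) (Y : (Fin n → ℝ) → Fin ℓ → ℝ), (∀ i, ∑ k, D.b i k = 0) ∧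
      ∑ k, D.α k = 1 ∧ (∀ a, ∑ k, D.β k a = 0) ∧
      (∀ t, IsNondegenerateZero E c t → Y t ∈ D.region ∧ D.sys ℓ 0 0 (Y t) = 0 ∧
        (D.jac ℓ 0 (Y t)).det ≠ 0) ∧ InjOn Y {t | IsNondegenerateZero E c t} := by
  obtain ⟨b, hb⟩ := (affineExponents E).range.exists_matrix_mulVec_eq_zero_iff (m := ℓ) (by
    rw [LinearMap.finrank_range_of_inj h₀.affineExponents_injective]
    simp
    omega)
  obtain ⟨β, hβ, hβinj⟩ := (linearSystem c).ker.exists_matrix_mulVec_range (m := ℓ) (by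
    have := (linearSystem c).finrank_range_add_finrank_ker
    rw [LinearMap.range_eq_top.2 h₀.linearSystem_surjective] at this
    simp at this
    omega)
  let σ : (Fin n → ℝ) → ℝ := fun t => ∑ k, expMonomial E t k
  have hσ : ∀ t, 0 < σ t := fun t =>
    Finset.sum_pos (fun k _ => expMonomial_pos E t k) Finset.univ_nonempty
  let u : (Fin n → ℝ) → Fin (n + ℓ + 1) → ℝ := fun t k => expMonomial E t k / σ t
  have hu : ∀ t k, 0 < u t k := fun t k => div_pos (expMonomial_pos E t k) (hσ t)
  have hsys : ∀ t, IsNondegenerateZero E c t → linearSystem c (u t) = (0, 1) := by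
    intro t ht
    refine Prod.ext (funext fun i => ?_) ?_
    · simp only [linearSystem, u, LinearMap.coe_mk, AddHom.coe_mk, ← mul_div_assoc,
        ← Finset.sum_div, ht.1 i, zero_div, Pi.zero_apply]
    · simp only [linearSystem, u, LinearMap.coe_mk, AddHom.coe_mk, ← Finset.sum_div]
      exact div_self (hσ t).ne'
  let D : GaleData ℓ (n + ℓ) := ⟨u t₀, β, b⟩
  have hY : ∀ t, ∃ y, IsNondegenerateZero E c t → ∀ k, D.form k y = u t k := by
    intro t
    by_cases ht : IsNondegenerateZero E c t
    · obtain ⟨y, hy⟩ := (hβ (u t - u t₀)).1 (by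
        rw [LinearMap.mem_ker, map_sub, hsys t ht, hsys t₀ h₀, sub_self])
      refine ⟨y, fun _ k => ?_⟩
      have : β.mulVec y k = u t k - u t₀ k := congrFun hy k
      change u t₀ k + β.mulVec y k = u t k
      rw [this]
      ring
    · exact ⟨0, fun h => absurd h ht⟩
  choose Y hY using hY
  have hlog : ∀ t k, Real.log (u t k) = affineExponents E (t, -Real.log (σ t)) k := by
    intro t k
    rw [Real.log_div (expMonomial_pos E t k).ne' (hσ t).ne', expMonomial, Real.log_exp]
    rfl
  have hker : ∀ y, linearSystem c (β.mulVec y) = 0 := fun y => (hβ _).2 ⟨y, rfl⟩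
  refine ⟨D, Y, fun i => ?_, ?_, fun a => ?_, fun t ht => ⟨fun k => ?_, ?_, fun hdet => ?_⟩, ?_⟩
  · have h1 := congrFun ((hb 1).2 ⟨(0, 1), by ext; simp [affineExponents]⟩) i
    simpa [Matrix.mulVec, dotProduct] using h1
  · exact congrArg Prod.snd (hsys t₀ h₀)
  · have h1 := congrArg Prod.snd (hker (Pi.single a 1))
    simpa [linearSystem] using h1
  · rw [hY t ht]
    exact hu t k
  · funext i
    simp only [GaleData.sys, i.2, if_true, GaleData.logForm, hY t ht, Pi.zero_apply, sub_zero]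
    refine congrFun ((hb (fun k => Real.log (u t k))).2 ⟨(t, -Real.log (σ t)), ?_⟩) i
    exact (funext (hlog t)).symm
  · obtain ⟨v, hv, hv0⟩ := Matrix.exists_mulVec_eq_zero_iff.2 hdet
    obtain ⟨⟨η, τ⟩, hητ⟩ := (hb fun k => β.mulVec v k / u t k).1 (by
      refine Eq.trans ?_ hv0
      funext i
      simp only [Matrix.mulVec, dotProduct, GaleData.jac, i.2, if_true, Matrix.of_apply, hY t ht,
        Finset.sum_div, Finset.mul_sum, Finset.sum_mul]
      rw [Finset.sum_comm]
      exact Finset.sum_congr rfl fun _ _ => Finset.sum_congr rfl fun _ _ => by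
        simp only [D]
        ring)
    have hw : ∀ k, β.mulVec v k = u t k * (∑ j, E k j * η j + τ) := by
      intro k
      have h1 : ∑ j, E k j * η j + τ = β.mulVec v k / u t k := congrFun hητ k
      rw [h1, mul_div_cancel₀ _ (hu t k).ne']
    have hη : η = 0 := ht.eq_zero_of_add (τ := τ) fun i => by
      have h1 : ∑ k, c i k * β.mulVec v k = 0 := congrFun (congrArg Prod.fst (hker v)) i
      simp only [hw] at h1
      rw [← mul_zero (σ t), ← h1, Finset.mul_sum]
      refine Finset.sum_congr rfl fun k _ => ?_
      have := (hσ t).ne'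
      simp only [u]
      field_simp
    have hτ : τ = 0 := by
      have h1 : ∑ k, β.mulVec v k = 0 := congrArg Prod.snd (hker v)
      have h2 : ∑ k, u t k = 1 := congrArg Prod.snd (hsys t ht)
      simpa [hw, hη, ← Finset.sum_mul, h2] using h1
    refine hv (hβinj v (funext fun k => ?_))
    simp [hw, hη, hτ]
  · intro t ht t' ht' htt'
    have h1 : ∀ k, u t k = u t' k := fun k => by rw [← hY t ht k, ← hY t' ht' k, htt']
    have h2 : affineExponents E (t, -Real.log (σ t)) = affineExponents E (t', -Real.log (σ t')) :=
      funext fun k => by rw [← hlog t k, ← hlog t' k, h1 k]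
    exact congrArg Prod.fst (h₀.affineExponents_injective h2)

theorem exists_finset_zeros_deriv {f f' : ℝ → ℝ} (hf : ∀ x, HasDerivAt f (f' x) x)
    (S : Finset ℝ) (hS : ∀ x ∈ S, f x = 0) :
    ∃ S' : Finset ℝ, S.card ≤ S'.card + 1 ∧ ∀ y ∈ S', f' y = 0 ∧ ∃ s ∈ S, y < s := by
  classical
  induction S using Finset.induction_on_max with
  | empty => exact ⟨∅, by simp⟩
  | insert a S ha ih =>
    obtain ⟨S', hcard, hS'⟩ := ih fun x hx => hS x (Finset.mem_insert_of_mem hx)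
    have haS : a ∉ S := fun h => (ha a h).false
    rcases S.eq_empty_or_nonempty with rfl | hne
    · exact ⟨∅, by simp⟩
    have hm := S.max'_mem hne
    obtain ⟨y, hy, hy0⟩ := exists_hasDerivAt_eq_zero (ha _ hm)
      (fun x _ => (hf x).continuousAt.continuousWithinAt)
      ((hS _ (Finset.mem_insert_of_mem hm)).trans (hS a (Finset.mem_insert_self _ _)).symm)
      fun x _ => hf x
    have hyS : y ∉ S' := fun h => by
      obtain ⟨s, hs, hys⟩ := (hS' y h).2
      exact absurd (hys.trans_le (S.le_max' s hs)) hy.1.not_gt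
    refine ⟨insert y S', ?_, fun z hz => ?_⟩
    · rw [Finset.card_insert_of_notMem haS, Finset.card_insert_of_notMem hyS]
      omega
    · rcases Finset.mem_insert.1 hz with rfl | hz
      · exact ⟨hy0, a, Finset.mem_insert_self _ _, hy.2⟩
      · obtain ⟨h1, s, hs, h2⟩ := hS' z hz
        exact ⟨h1, s, Finset.mem_insert_of_mem hs, h2⟩

theorem card_zeros_exponential_sum_lt {ι : Type*} (T : Finset ι) (E c : ι → ℝ)
    (hE : InjOn E T) (hc : ∃ k ∈ T, c k ≠ 0) (S : Finset ℝ)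
    (hS : ∀ t ∈ S, ∑ k ∈ T, c k * Real.exp (E k * t) = 0) : S.card < T.card := by
  classical
  induction T using Finset.induction_on generalizing E c S with
  | empty => simp at hc
  | insert k₀ T hk₀ ih =>
    rw [Finset.card_insert_of_notMem hk₀]
    by_cases hT : ∃ k ∈ T, c k ≠ 0
    · obtain ⟨k, hk, hck⟩ := hT
      have hne : E k - E k₀ ≠ 0 := fun h => hk₀ (by
        rwa [← hE (by simp [hk]) (by simp) (sub_eq_zero.1 h)])
      obtain ⟨S', hcard, hS'⟩ := exists_finset_zeros_deriv
        (f := fun t => c k₀ + ∑ k ∈ T, c k * Real.exp ((E k - E k₀) * t))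
        (f' := fun t => ∑ k ∈ T, c k * (E k - E k₀) * Real.exp ((E k - E k₀) * t))
        (fun x => by
          refine (HasDerivAt.fun_sum fun k _ => ?_).const_add _
          have h1 := (((hasDerivAt_id x).const_mul (E k - E k₀)).exp).const_mul (c k)
          refine h1.congr_deriv ?_
          simp only [id, mul_one]
          ring) S (fun t ht => by
          have h1 := hS t ht
          rw [Finset.sum_insert hk₀] at h1
          have h2 : c k₀ + ∑ k ∈ T, c k * Real.exp ((E k - E k₀) * t) =
              Real.exp (-(E k₀ * t)) *
                (c k₀ * Real.exp (E k₀ * t) + ∑ k ∈ T, c k * Real.exp (E k * t)) := by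
            rw [mul_add, Finset.mul_sum, mul_left_comm, ← Real.exp_add, neg_add_cancel,
              Real.exp_zero, mul_one]
            congr 1
            refine Finset.sum_congr rfl fun k _ => ?_
            rw [mul_left_comm, ← Real.exp_add]
            ring_nf
          rw [h2, h1, mul_zero])
      have := ih (fun k => E k - E k₀) (fun k => c k * (E k - E k₀))
        (fun i hi j hj hij => hE (by simp_all) (by simp_all) (sub_left_injective hij))
        ⟨k, hk, mul_ne_zero hck hne⟩ S' fun t ht => (hS' t ht).1
      omega
    · push Not at hT
      have hck : c k₀ ≠ 0 := by
        obtain ⟨k, hk, hck⟩ := hc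
        rcases Finset.mem_insert.1 hk with rfl | hk
        · exact hck
        · exact absurd (hT k hk) hck
      suffices S = ∅ by simp [this]
      refine Finset.eq_empty_of_forall_notMem fun t ht => ?_
      have h1 := hS t ht
      rw [Finset.sum_insert hk₀, Finset.sum_eq_zero fun k hk => by rw [hT k hk, zero_mul]] at h1
      simp [hck, Real.exp_ne_zero] at h1

theorem IsNondegenerateZero.card_le_of_univariate {N : ℕ} {E : Fin N → Fin 1 → ℝ}
    (hE : Function.Injective E) {c : Fin 1 → Fin N → ℝ} (S : Finset (Fin 1 → ℝ))
    (hS : ∀ t ∈ S, IsNondegenerateZero E c t) : S.card ≤ N - 1 := by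
  classical
  rcases S.eq_empty_or_nonempty with rfl | ⟨t, ht⟩
  · simp
  have hc : ∃ k, c 0 k ≠ 0 := by
    by_contra! h
    have := congrFun ((hS t ht).2 1 fun i => by simp [Subsingleton.elim i 0, h]) 0
    simp at this
  have h1 := card_zeros_exponential_sum_lt Finset.univ (fun k => E k 0) (c 0)
    (fun i _ j _ hij => hE (funext fun l => by rw [Subsingleton.elim l 0]; exact hij))
    (by simpa using hc) (S.image fun t => t 0) (by
      intro s hs
      obtain ⟨t, ht, rfl⟩ := Finset.mem_image.1 hs
      simpa [expMonomial] using (hS t ht).1 0)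
  rw [Finset.card_image_of_injective _ fun t t' h => funext fun l => by
    rw [Subsingleton.elim l 0]; exact h] at h1
  simp at h1
  omega

theorem isNondegenerateZero_log {n N : ℕ} {a : Fin N → Fin n → ℤ} {c : Fin n → Fin N → ℝ}
    {Φ : (Fin n → ℝ) → Fin n → ℝ} (hΦ : ∀ x i, Φ x i = ∑ k, c i k * ∏ j, x j ^ a k j)
    {x : Fin n → ℝ} (hx : ∀ j, 0 < x j) (h0 : ∀ i, Φ x i = 0)
    (D : (Fin n → ℝ) ≃L[ℝ] (Fin n → ℝ))
    (hD : HasFDerivAt Φ (D : (Fin n → ℝ) →L[ℝ] (Fin n → ℝ)) x) :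
    IsNondegenerateZero (fun k j => (a k j : ℝ)) c fun j => Real.log (x j) := by
  have hmon : ∀ (t : Fin n → ℝ) k, ∏ j, Real.exp (t j) ^ a k j =
      expMonomial (fun k j => (a k j : ℝ)) t k := by
    intro t k
    rw [expMonomial, Real.exp_sum]
    exact Finset.prod_congr rfl fun j _ => by
      rw [← Real.exp_log (zpow_pos (Real.exp_pos (t j)) (a k j)), Real.log_zpow, Real.log_exp]
  have hexp : (fun j => Real.exp (Real.log (x j))) = x := funext fun j => Real.exp_log (hx j)
  refine ⟨fun i => ?_, fun η hη => ?_⟩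
  · simp only [← hmon, ← h0 i, hΦ, Real.exp_log (hx _)]
  · have hcurve : HasDerivAt (fun s : ℝ => fun j => Real.exp (Real.log (x j) + s * η j))
        (fun j => x j * η j) 0 := by
      refine hasDerivAt_pi.2 fun j => ?_
      have h1 := (((hasDerivAt_id (0 : ℝ)).mul_const (η j)).const_add (Real.log (x j))).exp
      refine h1.congr_deriv ?_
      simp [Real.exp_log (hx j)]
    have hcomp : HasDerivAt (fun s : ℝ => Φ fun j => Real.exp (Real.log (x j) + s * η j))
        (D fun j => x j * η j) 0 := by
      refine HasFDerivAt.comp_hasDerivAt (l' := (D : (Fin n → ℝ) →L[ℝ] (Fin n → ℝ))) 0 ?_ hcurve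
      simpa [hexp] using hD
    have hzero : D (fun j => x j * η j) = 0 := by
      funext i
      have h1 := (hasDerivAt_pi.1 hcomp i)
      simp only [hΦ, hmon] at h1
      refine (h1.unique ?_).trans (hη i)
      refine HasDerivAt.fun_sum fun k _ => HasDerivAt.const_mul _ ?_
      have h2 : HasDerivAt (fun s : ℝ => ∑ j, (a k j : ℝ) * (Real.log (x j) + s * η j))
          (∑ j, (a k j : ℝ) * η j) 0 := by
        refine HasDerivAt.fun_sum fun j _ => HasDerivAt.const_mul _ ?_
        simpa using ((hasDerivAt_id (0 : ℝ)).mul_const (η j)).const_add (Real.log (x j))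
      simpa [expMonomial] using h2.exp
    have h1 := D.map_eq_zero_iff.1 hzero
    funext j
    have h2 := congrFun h1 j
    simpa [(hx j).ne'] using h2

theorem sum_two_pow_degrees {n ℓ : ℕ} (hn : 1 ≤ n) (j : Fin ℓ) :
    n + ℓ - (j + 1) + ∑ i : Fin ℓ, (if (i : ℕ) < j + 1 then 0 else n * 2 ^ (ℓ - 1 - i : ℕ) - 1) =
      n * 2 ^ (ℓ - 1 - j : ℕ) := by
  have h1 : ∀ m, ∑ k ∈ Finset.range m, (n * 2 ^ k - 1) + m + n = n * 2 ^ m := by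
    intro m
    induction m with
    | zero => simp
    | succ m ih =>
      rw [Finset.sum_range_succ, pow_succ]
      have : 1 ≤ n * 2 ^ m := Nat.mul_pos hn (by positivity)
      have h2 : n * (2 ^ m * 2) = n * 2 ^ m + n * 2 ^ m := by ring
      omega
  have h2 : ∑ i : Fin ℓ, (if (i : ℕ) < j + 1 then 0 else n * 2 ^ (ℓ - 1 - i : ℕ) - 1) =
      ∑ k ∈ Finset.range (ℓ - 1 - j), (n * 2 ^ k - 1) := by
    rw [Fin.sum_univ_eq_sum_range
      (fun i => if i < (j : ℕ) + 1 then 0 else n * 2 ^ (ℓ - 1 - i : ℕ) - 1) ℓ,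
      ← Finset.sum_range_reflect]
    have h3 : Finset.range (ℓ - 1 - j) ⊆ Finset.range ℓ :=
      Finset.range_subset_range.2 (by omega)
    rw [← Finset.sum_subset h3]
    · refine Finset.sum_congr rfl fun k hk => ?_
      rw [Finset.mem_range] at hk
      rw [if_neg (by omega)]
      congr 3
      omega
    · intro k hk hk'
      rw [Finset.mem_range] at hk hk'
      rw [if_pos (by omega)]
  have := h1 (ℓ - 1 - j)
  have := j.2
  omega

theorem prod_two_pow_degrees (n ℓ : ℕ) :
    ∏ i : Fin ℓ, n * 2 ^ (ℓ - 1 - i : ℕ) = n ^ ℓ * 2 ^ (ℓ * (ℓ - 1) / 2) := by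
  rw [Finset.prod_mul_distrib, Finset.prod_pow_eq_pow_sum,
    Fin.sum_univ_eq_sum_range (fun i => ℓ - 1 - i) ℓ, Finset.sum_range_reflect (fun i => i) ℓ,
    Finset.sum_range_id]
  simp

theorem choose_mul_two_pow_le {n m j : ℕ} (hn : 2 ≤ n) (hj : j ≤ m + 1) :
    (n + m).choose j * 2 ^ j ≤ (m + 2).choose j * n ^ j := by
  have h : ∀ j, j ≤ m + 1 → (n + m).descFactorial j * 2 ^ j ≤ (m + 2).descFactorial j * n ^ j := by
    intro j
    induction j with
    | zero => simp
    | succ j ih =>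
      intro hj
      rw [Nat.descFactorial_succ, Nat.descFactorial_succ, pow_succ, pow_succ]
      obtain ⟨p, rfl⟩ := Nat.exists_eq_add_of_le (Nat.le_of_succ_le_succ hj)
      obtain ⟨q, rfl⟩ := Nat.exists_eq_add_of_le hn
      have h1 : (2 + q + (j + p) - j) * 2 ≤ (j + p + 2 - j) * (2 + q) := by
        rw [show 2 + q + (j + p) - j = 2 + q + p by omega,
          show j + p + 2 - j = p + 2 by omega]
        nlinarith [Nat.zero_le (p * q)]
      calc _ = ((2 + q + (j + p) - j) * 2) * ((2 + q + (j + p)).descFactorial j * 2 ^ j) := by ring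
        _ ≤ ((j + p + 2 - j) * (2 + q)) * ((j + p + 2).descFactorial j * (2 + q) ^ j) :=
          Nat.mul_le_mul h1 (ih (Nat.le_of_succ_le hj))
        _ = _ := by ring
  have := h j hj
  rw [Nat.descFactorial_eq_factorial_mul_choose, Nat.descFactorial_eq_factorial_mul_choose,
    mul_assoc, mul_assoc] at this
  exact Nat.le_of_mul_le_mul_left this (Nat.factorial_pos j)

theorem choose_mul_prod_le {n ℓ : ℕ} (hn : 2 ≤ n) (j : Fin ℓ) :
    (n + ℓ + 1).choose (j + 1) * (∏ i : Fin ℓ, if j < i then n * 2 ^ (ℓ - 1 - i : ℕ) else 1) *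
        (∏ i : Fin ℓ, if j < i then 1 else 2 ^ (ℓ - i : ℕ)) ≤
      (ℓ + 3).choose (j + 1) * ∏ i : Fin ℓ, n * 2 ^ (ℓ - 1 - i : ℕ) := by
  have h1 := choose_mul_two_pow_le (m := ℓ + 1) (j := j + 1) hn (by omega)
  have hcard : ∀ r : ℕ, ∏ i : Fin ℓ, (if j < i then 1 else r) = r ^ ((j : ℕ) + 1) := by
    intro r
    rw [Finset.prod_ite, Finset.prod_const_one, one_mul, Finset.prod_const]
    congr 1
    rw [← Fin.card_Iic j]
    congr 1
    ext i
    simp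
  have h2 : (∏ i : Fin ℓ, if j < i then n * 2 ^ (ℓ - 1 - i : ℕ) else 1) *
      (∏ i : Fin ℓ, if j < i then 1 else 2 ^ (ℓ - i : ℕ)) * n ^ ((j : ℕ) + 1) =
      (∏ i : Fin ℓ, n * 2 ^ (ℓ - 1 - i : ℕ)) * 2 ^ ((j : ℕ) + 1) := by
    rw [← hcard n, ← hcard 2, ← Finset.prod_mul_distrib, ← Finset.prod_mul_distrib,
      ← Finset.prod_mul_distrib]
    refine Finset.prod_congr rfl fun i _ => ?_
    split_ifs
    · ring
    · rw [show ℓ - (i : ℕ) = ℓ - 1 - i + 1 by omega, pow_succ]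
      ring
  refine le_of_mul_le_mul_left (a := n ^ ((j : ℕ) + 1)) ?_ (by positivity)
  calc _ = (n + (ℓ + 1)).choose (j + 1) * ((∏ i : Fin ℓ, n * 2 ^ (ℓ - 1 - i : ℕ)) *
        2 ^ ((j : ℕ) + 1)) := by rw [← h2, add_assoc]; ring
    _ = ((n + (ℓ + 1)).choose (j + 1) * 2 ^ ((j : ℕ) + 1)) *
        (∏ i : Fin ℓ, n * 2 ^ (ℓ - 1 - i : ℕ)) := by ring
    _ ≤ _ := Nat.mul_le_mul_right _ h1
    _ = _ := by ring

theorem sum_choose_div_prod_le (ℓ : ℕ) :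
    ∑ j : Fin ℓ, ((ℓ + 3).choose (j + 1) : ℝ) /
      ∏ i : Fin ℓ, (if j < i then 1 else 2 ^ (ℓ - i : ℕ) : ℝ) ≤ 11 / 4 := by
  rcases lt_or_ge ℓ 3 with hℓ | hℓ
  · interval_cases ℓ
    · norm_num
    · norm_num [Fin.sum_univ_succ, Fin.prod_univ_succ, Nat.choose]
    · norm_num [Fin.sum_univ_succ, Fin.prod_univ_succ, Nat.choose]
  obtain ⟨m, rfl⟩ := Nat.exists_eq_add_of_le' hℓ
  have hw : ∀ j : Fin (m + 2), (2 : ℝ) ^ (2 * m + 5) ≤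
      ∏ i : Fin (m + 3), (if j.succ < i then 1 else 2 ^ (m + 3 - i : ℕ) : ℝ) := by
    intro j
    rw [Fin.prod_univ_succ, Fin.prod_univ_succ, if_neg (by simp), if_neg (by simp), ← mul_assoc,
      show 2 * m + 5 = (m + 3) + (m + 2) by ring, pow_add]
    refine le_mul_of_one_le_right (by positivity) (Finset.prod_induction _ (1 ≤ ·)
      (fun _ _ => one_le_mul_of_one_le_of_one_le) le_rfl fun i _ => ?_)
    split_ifs
    · exact le_rfl
    · exact one_le_pow₀ (one_le_two (α := ℝ))
  rw [Fin.sum_univ_succ]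
  have h0 : ∏ i : Fin (m + 3), (if 0 < i then 1 else 2 ^ (m + 3 - i : ℕ) : ℝ) = 2 ^ (m + 3) := by
    rw [Fin.prod_univ_succ]
    simp
  have h1 : ∑ j : Fin (m + 2), ((m + 3 + 3).choose (j.succ + 1) : ℝ) /
      ∏ i : Fin (m + 3), (if j.succ < i then 1 else 2 ^ (m + 3 - i : ℕ) : ℝ) ≤
      2 ^ (m + 6) / 2 ^ (2 * m + 5) := by
    calc _ ≤ ∑ j : Fin (m + 2), ((m + 6).choose (j.succ + 1) : ℝ) / 2 ^ (2 * m + 5) :=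
        Finset.sum_le_sum fun j _ => div_le_div_of_nonneg_left (by positivity) (by positivity)
          (hw j)
      _ = (∑ j : Fin (m + 2), ((m + 6).choose (j.succ + 1) : ℝ)) / 2 ^ (2 * m + 5) := by
        rw [Finset.sum_div]
      _ ≤ _ := by
        refine div_le_div_of_nonneg_right ?_ (by positivity)
        have h2 := Nat.sum_range_choose (m + 6)
        rw [show m + 6 + 1 = (m + 2) + 5 by ring, Finset.sum_range_succ, Finset.sum_range_succ,
          Finset.sum_range_succ, Finset.sum_range_succ', Finset.sum_range_succ',
          ← Fin.sum_univ_eq_sum_range (fun i => (m + 6).choose (i + 1 + 1))] at h2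
        have h3 : ∑ j : Fin (m + 2), (m + 6).choose ((j.succ : ℕ) + 1) ≤ 2 ^ (m + 6) := by
          simp only [Fin.val_succ]
          omega
        exact_mod_cast h3
  rw [h0]
  have h2 : (m : ℝ) + 22 ≤ 22 * 2 ^ m := by
    have h3 : m + 1 ≤ 2 ^ m := Nat.lt_two_pow_self
    have h4 : (m : ℝ) + 1 ≤ 2 ^ m := by exact_mod_cast h3
    have h5 : (0 : ℝ) ≤ m := Nat.cast_nonneg m
    linarith
  have h3 : (2 : ℝ) ^ (m + 6) / 2 ^ (2 * m + 5) = 16 / 2 ^ (m + 3) := by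
    rw [div_eq_div_iff (by positivity) (by positivity), ← pow_add,
      show (16 : ℝ) = 2 ^ 4 by norm_num, ← pow_add]
    congr 1
    ring
  have h4 : (((m + 3 + 3).choose ((0 : Fin (m + 3)) + 1 : ℕ) : ℕ) : ℝ) = m + 6 := by
    simp
    ring
  rw [h4]
  refine (add_le_add_right (h1.trans_eq h3) _).trans ?_
  rw [← add_div, div_le_iff₀ (by positivity), pow_add]
  linarith

theorem IsNondegenerateZero.card_lt {n ℓ : ℕ} (hn : 1 ≤ n) (hℓ : 1 ≤ ℓ)
    {E : Fin (n + ℓ + 1) → Fin n → ℝ} (hE : Function.Injective E)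
    {c : Fin n → Fin (n + ℓ + 1) → ℝ} (S : Finset (Fin n → ℝ))
    (hS : ∀ t ∈ S, IsNondegenerateZero E c t) :
    (S.card : ℝ) < (Real.exp 1 ^ 2 + 3) / 4 * 2 ^ (ℓ * (ℓ - 1) / 2) * (n : ℝ) ^ ℓ := by
  classical
  have hexp : (29 / 4 : ℝ) < Real.exp 1 ^ 2 := by
    nlinarith [Real.exp_one_gt_d9]
  rcases hn.eq_or_lt with rfl | hn
  · have h1 : S.card ≤ ℓ + 1 := (card_le_of_univariate hE S hS).trans (by omega)
    have h2 : ℓ + 1 ≤ 2 * 2 ^ (ℓ * (ℓ - 1) / 2) := by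
      obtain ⟨m, rfl⟩ := Nat.exists_eq_add_of_le' hℓ
      have h3 : m ≤ (m + 1) * (m + 1 - 1) / 2 := by
        rw [Nat.le_div_iff_mul_le two_pos, Nat.add_sub_cancel]
        rcases m with - | m
        · simp
        · nlinarith
      have h4 : m + 1 ≤ 2 ^ m := Nat.lt_two_pow_self
      have h5 := Nat.pow_le_pow_right two_pos h3
      omega
    have h3 : (S.card : ℝ) ≤ 2 * 2 ^ (ℓ * (ℓ - 1) / 2) := by exact_mod_cast h1.trans h2
    have h4 : (0 : ℝ) < 2 ^ (ℓ * (ℓ - 1) / 2) := by positivity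
    simp only [Nat.cast_one, one_pow, mul_one]
    nlinarith
  have hP : (0 : ℝ) < 2 ^ (ℓ * (ℓ - 1) / 2) * (n : ℝ) ^ ℓ := by positivity
  rw [mul_assoc]
  rcases S.eq_empty_or_nonempty with rfl | ⟨t, ht⟩
  · rw [Finset.card_empty, Nat.cast_zero]
    positivity
  obtain ⟨D, Y, hb, hα, hβ, hY, hYinj⟩ := (hS t ht).exists_galeData
  have h1 := D.card_zeros_le (by omega) hb hα hβ (d := fun i => n * 2 ^ (ℓ - 1 - i : ℕ))
    (fun i => Nat.mul_pos (by omega) (by positivity))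
    (fun j => (sum_two_pow_degrees (by omega) j).le) 0 (S.image Y) fun y hy => by
      obtain ⟨t, ht, rfl⟩ := Finset.mem_image.1 hy
      exact hY t (hS t ht)
  rw [Finset.card_image_of_injOn (hYinj.mono hS)] at h1
  have hprod : ∏ i : Fin ℓ, ((n * 2 ^ (ℓ - 1 - i : ℕ) : ℕ) : ℝ) =
      2 ^ (ℓ * (ℓ - 1) / 2) * (n : ℝ) ^ ℓ := by
    rw [← Nat.cast_prod, prod_two_pow_degrees]
    push_cast
    ring
  have h2 : ∑ j : Fin ℓ, (((n + ℓ + 1).choose (j + 1) *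
      ∏ i : Fin ℓ, (if j < i then n * 2 ^ (ℓ - 1 - i : ℕ) else 1) : ℕ) : ℝ) ≤
      2 ^ (ℓ * (ℓ - 1) / 2) * (n : ℝ) ^ ℓ * (11 / 4) := by
    refine le_trans ?_ (mul_le_mul_of_nonneg_left (sum_choose_div_prod_le ℓ) hP.le)
    rw [Finset.mul_sum]
    refine Finset.sum_le_sum fun j _ => ?_
    have h3 : (0 : ℝ) < ∏ i : Fin ℓ, (if j < i then 1 else 2 ^ (ℓ - i : ℕ) : ℝ) :=
      Finset.prod_pos fun i _ => by split_ifs <;> positivity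
    rw [← mul_div_assoc, le_div_iff₀ h3, ← hprod]
    have h4 := choose_mul_prod_le (by omega) (n := n) j
    have h5 : (((n + ℓ + 1).choose (j + 1) *
        (∏ i : Fin ℓ, if j < i then n * 2 ^ (ℓ - 1 - i : ℕ) else 1) *
        (∏ i : Fin ℓ, if j < i then 1 else 2 ^ (ℓ - i : ℕ)) : ℕ) : ℝ) ≤
        (((ℓ + 3).choose (j + 1) * ∏ i : Fin ℓ, n * 2 ^ (ℓ - 1 - i : ℕ) : ℕ) : ℝ) := by
      exact_mod_cast h4
    push_cast at h5 ⊢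
    linarith
  rw [hprod] at h1
  nlinarith

end

/-- The fewnomial bound of Bihan-Sottile: a system of n Laurent polynomials
in n variables with n+ℓ+1 distinct monomials has fewer than ((e²+3)/4)·2^(ℓ(ℓ-1)/2)·n^ℓ
nondegenerate positive solutions. -/
theorem fewnomial_bound
    (n ℓ : ℕ) (hn : 1 ≤ n) (hℓ : 1 ≤ ℓ)
    (a : Fin (n + ℓ + 1) → Fin n → ℤ) (hainj : Function.Injective a)
    (c : Fin n → Fin (n + ℓ + 1) → ℝ)
    (Φ : (Fin n → ℝ) → Fin n → ℝ)
    (hΦ : ∀ x i, Φ x i = ∑ k, c i k * ∏ j, x j ^ a k j) :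
    {x : Fin n → ℝ | (∀ j, 0 < x j) ∧ (∀ i, Φ x i = 0) ∧
        ∃ D : (Fin n → ℝ) ≃L[ℝ] (Fin n → ℝ),
          HasFDerivAt Φ (D : (Fin n → ℝ) →L[ℝ] (Fin n → ℝ)) x}.Finite ∧
    ({x : Fin n → ℝ | (∀ j, 0 < x j) ∧ (∀ i, Φ x i = 0) ∧
        ∃ D : (Fin n → ℝ) ≃L[ℝ] (Fin n → ℝ),
          HasFDerivAt Φ (D : (Fin n → ℝ) →L[ℝ] (Fin n → ℝ)) x}.ncard : ℝ) <
      (Real.exp 1 ^ 2 + 3) / 4 * 2 ^ (ℓ * (ℓ - 1) / 2) * (n : ℝ) ^ ℓ := by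
  classical
  set A : Set (Fin n → ℝ) := {x | (∀ j, 0 < x j) ∧ (∀ i, Φ x i = 0) ∧
        ∃ D : (Fin n → ℝ) ≃L[ℝ] (Fin n → ℝ),
          HasFDerivAt Φ (D : (Fin n → ℝ) →L[ℝ] (Fin n → ℝ)) x}
  have hE : Function.Injective fun k j => (a k j : ℝ) := fun k k' h =>
    hainj (funext fun j => Int.cast_injective (congrFun h j))
  have hcard : ∀ S : Finset (Fin n → ℝ), (∀ x ∈ S, x ∈ A) →
      (S.card : ℝ) < (Real.exp 1 ^ 2 + 3) / 4 * 2 ^ (ℓ * (ℓ - 1) / 2) * (n : ℝ) ^ ℓ := by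
    intro S hS
    have hinj : Set.InjOn (fun (x : Fin n → ℝ) j => Real.log (x j)) S := fun x hx y hy hxy =>
      funext fun j => Real.log_injOn_pos ((hS x hx).1 j) ((hS y hy).1 j) (congrFun hxy j)
    rw [← Finset.card_image_of_injOn hinj]
    refine IsNondegenerateZero.card_lt hn hℓ hE (c := c) _ fun t ht => ?_
    obtain ⟨x, hx, rfl⟩ := Finset.mem_image.1 ht
    obtain ⟨h1, h2, D, hD⟩ := hS x hx
    exact isNondegenerateZero_log hΦ h1 h2 D hD
  obtain ⟨P, -, hP⟩ := Set.exists_finset_of_forall_card_le (A := A) fun S hS =>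
    Nat.le_floor (hcard S hS).le
  have hPA : A = P := Set.ext fun x => (hP x).symm
  rw [hPA]
  refine ⟨P.finite_toSet, ?_⟩
  rw [Set.ncard_coe_finset]
  exact hcard P fun x hx => (hP x).1 hx
end

section
/- Let n, ℓ ≥ 1, let A be the n×(n+ℓ) integer matrix with columns a_1, …, a_{n+ℓ} ∈ ℤ^n and suppose A has rank n over ℚ. Let C be a real n×(n+ℓ) matrix of rank n, let b ∈ ℝ^n, and define F : (0,∞)^n → ℝ^n by F(x)_i = Σ_{k=1}^{n+ℓ} C_{i,k} x^{a_k}. Let β^{(1)}, …, β^{(ℓ)} ∈ ℤ^{n+ℓ} be linearly independent vectors with A β^{(j)} = 0 for all j. Let L : ℝ^ℓ → ℝ^{n+ℓ} be an injective linear map with C ∘ L = 0, with components L_i(y), and let λ ∈ ℝ^{n+ℓ} satisfy Cλ = b. Then the relation {(x, y) : x^{a_i} = L_i(y) + λ_i for all i = 1, …, n+ℓ} defines a bijection between the solution set {x ∈ (0,∞)^n : F(x) = b} and the set {y ∈ ℝ^ℓ : L_i(y) + λ_i > 0 for all i, and ∏_{i=1}^{n+ℓ} (L_i(y) + λ_i)^{β^{(j)}_i}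 = 1 for j = 1, …, ℓ}. That is, for each positive solution x of F(x) = b there is a unique y ∈ ℝ^ℓ with L(y) = (x^{a_1}, …, x^{a_{n+ℓ}}) − λ, this y solves the Gale system, and every solution y of the Gale system arises from exactly one such x. -/
/-- A short complex `U → V → W` of finite-dimensional spaces with injective first map, surjective
second map and `dim V = dim W + dim U` is exact in the middle. -/
theorem LinearMap.mem_range_of_apply_eq_zero_of_finrank_eq {K U V W : Type*} [Field K]
    [AddCommGroup U] [Module K U] [AddCommGroup V] [Module K V] [AddCommGroup W] [Module K W]
    [FiniteDimensional K V] (g : U →ₗ[K] V) (f : V →ₗ[K] W)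
    (hg : Function.Injective g) (hf : Function.Surjective f) (hfg : ∀ u, f (g u) = 0)
    (hdim : Module.finrank K V = Module.finrank K W + Module.finrank K U)
    {v : V} (hv : f v = 0) : ∃ u, g u = v := by
  have hle : LinearMap.range g ≤ LinearMap.ker f := by
    rintro _ ⟨u, rfl⟩
    exact hfg u
  have hrank := f.finrank_range_add_finrank_ker
  rw [LinearMap.range_eq_top.2 hf, finrank_top] at hrank
  have heq := Submodule.eq_of_le_of_finrank_eq hle (by
    rw [LinearMap.finrank_range_of_inj hg]
    omega)
  exact LinearMap.mem_range.1 (heq ▸ LinearMap.mem_ker.2 hv)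

/-- A matrix over a field with full row rank is surjective as a linear map. -/
theorem Matrix.mulVec_surjective_of_rank_eq {K m p : Type*} [Field K] [Fintype m] [Fintype p]
    (M : Matrix m p K) (h : M.rank = Fintype.card m) : Function.Surjective M.mulVec := by
  have htop : LinearMap.range M.mulVecLin = ⊤ :=
    Submodule.eq_top_of_finrank_eq (by
      rw [Module.finrank_fintype_fun_eq_card]
      exact h)
  exact LinearMap.range_eq_top.1 htop

/-- An integer matrix with full row rank over `ℚ` has a right inverse over `ℝ`. -/
theorem Matrix.exists_real_right_inverse_of_rank_eq {m p : Type*} [Fintype m] [Fintype p]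
    [DecidableEq m] (M : Matrix m p ℤ)
    (h : (M.map (Int.cast : ℤ → ℚ)).rank = Fintype.card m) :
    ∃ N : Matrix p m ℝ, M.map (Int.cast : ℤ → ℝ) * N = 1 := by
  classical
  obtain ⟨N, hN⟩ := Matrix.mulVec_surjective_iff_exists_right_inverse.1
    (Matrix.mulVec_surjective_of_rank_eq _ h)
  refine ⟨N.map (algebraMap ℚ ℝ), ?_⟩
  have hmap := congrArg (fun P => P.map (algebraMap ℚ ℝ)) hN
  simp only [Matrix.map_mul] at hmap
  rw [Matrix.map_one _ (map_zero _) (map_one _), Matrix.map_map] at hmap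
  convert hmap using 3
  ext
  simp

/-- Integer vectors that are linearly independent over `ℤ` form a matrix of full row rank
over `ℚ`. -/
theorem LinearIndependent.rank_map_intCast {m p : Type*} [Fintype m] [Fintype p]
    {M : Matrix m p ℤ} (h : LinearIndependent ℤ M.row) :
    (M.map (Int.cast : ℤ → ℚ)).rank = Fintype.card m := by
  refine LinearIndependent.rank_matrix ?_
  rw [← LinearIndependent.iff_fractionRing (R := ℤ)]
  let c : (p → ℤ) →ₗ[ℤ] (p → ℚ) := LinearMap.compLeft (Algebra.linearMap ℤ ℚ) p
  have hc : LinearMap.ker c = ⊥ := by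
    refine LinearMap.ker_eq_bot.2 fun u v huv => funext fun i => ?_
    have hi := congrFun huv i
    simpa [c] using hi
  exact h.map' c hc

/-- The logarithm of a Laurent monomial at a positive point. -/
theorem Real.log_prod_zpow {ι : Type*} (s : Finset ι) {x : ι → ℝ} (hx : ∀ i, 0 < x i)
    (a : ι → ℤ) : Real.log (∏ i ∈ s, x i ^ a i) = ∑ i ∈ s, (a i : ℝ) * Real.log (x i) := by
  rw [Real.log_prod fun i _ => (zpow_pos (hx i) _).ne']
  simp only [Real.log_zpow]


/-- Gale duality for positive solutions of a fewnomial system: the positive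
solutions of F(x) = b are in bijection with the solutions of the dual Gale system of master
functions in the positive chamber, via the relation x^{a_i} = L_i(y) + λ_i. -/
theorem gale_duality_positive
    (n ℓ : ℕ) (hn : 1 ≤ n) (hℓ : 1 ≤ ℓ)
    (A : Matrix (Fin n) (Fin (n + ℓ)) ℤ)
    (hArank : (A.map (Int.cast : ℤ → ℚ)).rank = n)
    (C : Matrix (Fin n) (Fin (n + ℓ)) ℝ) (hCrank : C.rank = n)
    (b : Fin n → ℝ)
    (β : Fin ℓ → Fin (n + ℓ) → ℤ)
    (hβindep : LinearIndependent ℤ β)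
    (hβker : ∀ j, A.mulVec (β j) = 0)
    (L : (Fin ℓ → ℝ) →ₗ[ℝ] (Fin (n + ℓ) → ℝ))
    (hLinj : Function.Injective L)
    (hCL : ∀ y, C.mulVec (L y) = 0)
    (lam : Fin (n + ℓ) → ℝ) (hlam : C.mulVec lam = b) :
    (∀ x : Fin n → ℝ, (∀ j, 0 < x j) →
      (∀ i, ∑ k, C i k * ∏ j, x j ^ A j k = b i) →
      ∃! y : Fin ℓ → ℝ,
        (∀ k : Fin (n + ℓ), ∏ j, x j ^ A j k = L y k + lam k) ∧
        (∀ k, 0 < L y k + lam k) ∧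
        (∀ j, ∏ k, (L y k + lam k) ^ β j k = 1)) ∧
    (∀ y : Fin ℓ → ℝ, (∀ k, 0 < L y k + lam k) →
      (∀ j, ∏ k, (L y k + lam k) ^ β j k = 1) →
      ∃! x : Fin n → ℝ, (∀ j, 0 < x j) ∧
        (∀ i, ∑ k, C i k * ∏ j, x j ^ A j k = b i) ∧
        (∀ k : Fin (n + ℓ), ∏ j, x j ^ A j k = L y k + lam k)) := by
  have hCsurj := C.mulVec_surjective_of_rank_eq (by simpa using hCrank)
  obtain ⟨R, hR⟩ := A.exists_real_right_inverse_of_rank_eq (by simpa using hArank)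
  obtain ⟨S, hS⟩ := (Matrix.of β).exists_real_right_inverse_of_rank_eq hβindep.rank_map_intCast
  have hort : ∀ j i, ∑ k, (β j k : ℝ) * (A i k : ℝ) = 0 := fun j i => by
    have h := congrFun (hβker j) i
    simp only [Matrix.mulVec, dotProduct, Pi.zero_apply] at h
    simp_rw [mul_comm (β j _ : ℝ)]
    exact_mod_cast h
  let T := (A.map (Int.cast : ℤ → ℝ)).transpose
  let B := (Matrix.of β).map (Int.cast : ℤ → ℝ)
  have hTinj : Function.Injective T.mulVecLin := by
    refine Function.LeftInverse.injective (g := R.transpose.mulVec) fun u => ?_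
    rw [Matrix.mulVecLin_apply, Matrix.mulVec_mulVec, ← Matrix.transpose_mul, hR,
      Matrix.transpose_one, Matrix.one_mulVec]
  have hBsurj : Function.Surjective B.mulVecLin :=
    Matrix.mulVec_surjective_iff_exists_right_inverse.2 ⟨S, hS⟩
  have hBT : ∀ u, B.mulVecLin (T.mulVecLin u) = 0 := fun u => by
    have h0 : B * T = 0 := by
      ext j i
      exact hort j i
    simp only [Matrix.mulVecLin_apply, Matrix.mulVec_mulVec, h0, Matrix.zero_mulVec]
  have hlog : ∀ x : Fin n → ℝ, (∀ j, 0 < x j) → ∀ k,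
      Real.log (∏ j, x j ^ A j k) = T.mulVecLin (fun j => Real.log (x j)) k := fun x hx k =>
    Real.log_prod_zpow _ hx _
  have hlogB : ∀ z : Fin (n + ℓ) → ℝ, (∀ k, 0 < z k) → ∀ j,
      Real.log (∏ k, z k ^ β j k) = B.mulVecLin (fun k => Real.log (z k)) j := fun z hz j =>
    Real.log_prod_zpow _ hz _
  constructor
  · intro x hx hF
    have hpos : ∀ k, 0 < ∏ j, x j ^ A j k := fun k =>
      Finset.prod_pos fun j _ => zpow_pos (hx j) _
    obtain ⟨y, hy⟩ := L.mem_range_of_apply_eq_zero_of_finrank_eq C.mulVecLin hLinj hCsurj hCL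
      (by simp) (v := (fun k => ∏ j, x j ^ A j k) - lam) (by
        rw [Matrix.mulVecLin_apply, Matrix.mulVec_sub, hlam, sub_eq_zero]
        exact funext hF)
    have hyk : ∀ k, ∏ j, x j ^ A j k = L y k + lam k := fun k => by
      rw [hy, Pi.sub_apply, sub_add_cancel]
    refine ⟨y, ⟨hyk, fun k => hyk k ▸ hpos k, fun j => ?_⟩, fun y' hy' => ?_⟩
    · simp_rw [← hyk]
      refine Real.eq_one_of_pos_of_log_eq_zero
        (Finset.prod_pos fun k _ => zpow_pos (hpos k) _) ?_
      rw [hlogB _ hpos, funext (hlog x hx), hBT, Pi.zero_apply]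
    · exact hLinj (funext fun k => add_right_cancel ((hy'.1 k).symm.trans (hyk k)))
  · intro y hpos hG
    obtain ⟨u, hu⟩ := T.mulVecLin.mem_range_of_apply_eq_zero_of_finrank_eq B.mulVecLin hTinj
      hBsurj hBT (by simp [add_comm]) (v := fun k => Real.log (L y k + lam k)) (by
        funext j
        rw [← hlogB _ hpos, hG, Real.log_one, Pi.zero_apply])
    have hxpos : ∀ j, 0 < Real.exp (u j) := fun j => Real.exp_pos _
    have hmon : ∀ k, ∏ j, Real.exp (u j) ^ A j k = L y k + lam k := fun k => by
      refine Real.log_injOn_pos (Finset.prod_pos fun j _ => zpow_pos (hxpos j) _) (hpos k) ?_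
      rw [hlog _ hxpos]
      simp only [Real.log_exp]
      exact congrFun hu k
    refine ⟨fun j => Real.exp (u j), ⟨hxpos, fun i => ?_, hmon⟩, ?_⟩
    · simp_rw [hmon]
      have h : C.mulVec (L y + lam) = b := by rw [Matrix.mulVec_add, hCL, hlam, zero_add]
      exact congrFun h i
    · rintro x ⟨hx, -, hxk⟩
      have h : (fun j => Real.log (x j)) = u := hTinj (by
        rw [hu]
        funext k
        rw [← hlog x hx, hxk])
      funext j
      rw [← congrFun h j, Real.exp_log (hx j)]
end
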